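/- Let n ≥ 4 be an integer and let p be a real number with 2n/(n−1) ≤ p < n. If u : ℝⁿ → ℝ is a smooth function with compact support contained in the open unit ball Bⁿ and equality holds in the Poincaré–Sobolev inequality ∫_{Bⁿ} ((1−|x|²)/2)^p |∇u|^p (2/(1−|x|²))^n dx − ((n−1)/p)^p ∫_{Bⁿ} |u|^p (2/(1−|x|²))^n dx = S(n,p)^p ( ∫_{Bⁿ} |u|^{np/(n−p)} (2/(1−|x|²))^n dx )^{(n−p)/n}, then u is identically zero. -/

import Mathlib

open Real MeasureTheory

/-- Volume of the Euclidean unit ball in `ℝⁿ`. -/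
noncomputable def unitBallVol (n : ℕ) : ℝ := π ^ ((n : ℝ) / 2) / Real.Gamma ((n : ℝ) / 2 + 1)

/-- The sharp constant `S(n,p)` in the `Lᵖ` Sobolev inequality in `ℝⁿ`. -/
noncomputable def sobolevConst (n : ℕ) (p : ℝ) : ℝ :=
  ((1 / (n : ℝ)) * (((n : ℝ) * (p - 1)) / ((n : ℝ) - p)) ^ (1 - 1 / p) *
    (Real.Gamma (n : ℝ) /
      (Real.Gamma ((n : ℝ) / p) * Real.Gamma ((n : ℝ) + 1 - (n : ℝ) / p) * unitBallVol n)) ^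
        (1 / (n : ℝ)))⁻¹

/-! ### Radial volume in the hyperbolic ball -/

/-- `sinh` of the hyperbolic distance to the origin of a point of Euclidean norm `r`. -/
noncomputable def hypSinh (r : ℝ) : ℝ := 2 * r / (1 - r ^ 2)

/-- The conformal factor of the Poincaré ball at Euclidean radius `r`. -/
noncomputable def confFactor (r : ℝ) : ℝ := 2 / (1 - r ^ 2)

/-- The radial volume density of the Poincaré ball, normalised as a derivative of `sⁿ`. -/
noncomputable def radDens (m : ℕ) (r : ℝ) : ℝ := (m + 1) * hypSinh r ^ m * confFactor r

/-- The volume of the ball of Euclidean radius `r`, normalised by the Euclidean unit ball. -/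
noncomputable def radVol (m : ℕ) (r : ℝ) : ℝ := ∫ t in (0 : ℝ)..r, radDens m t

lemma one_sub_sq_pos {r : ℝ} (h0 : 0 ≤ r) (h1 : r < 1) : 0 < 1 - r ^ 2 := by nlinarith

lemma hypSinh_pos {r : ℝ} (h0 : 0 < r) (h1 : r < 1) : 0 < hypSinh r :=
  div_pos (by linarith) (one_sub_sq_pos h0.le h1)

lemma confFactor_pos {r : ℝ} (h0 : 0 ≤ r) (h1 : r < 1) : 0 < confFactor r :=
  div_pos two_pos (one_sub_sq_pos h0 h1)

lemma radDens_pos (m : ℕ) {r : ℝ} (h0 : 0 < r) (h1 : r < 1) : 0 < radDens m r := by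
  have := hypSinh_pos h0 h1
  have := confFactor_pos h0.le h1
  unfold radDens; positivity

lemma radDens_nonneg (m : ℕ) {r : ℝ} (h0 : 0 ≤ r) (h1 : r < 1) : 0 ≤ radDens m r := by
  have : 0 ≤ hypSinh r := div_nonneg (by linarith) (one_sub_sq_pos h0 h1).le
  have := confFactor_pos h0 h1
  unfold radDens; positivity

lemma continuousOn_confFactor : ContinuousOn confFactor (Set.Ioo (-1) 1) := by
  unfold confFactor
  refine continuousOn_const.div (by fun_prop) fun x hx => ?_
  have : x ^ 2 < 1 := (sq_lt_one_iff_abs_lt_one x).2 (abs_lt.2 hx)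
  linarith

lemma continuousOn_hypSinh : ContinuousOn hypSinh (Set.Ioo (-1) 1) := by
  unfold hypSinh
  refine ContinuousOn.div (by fun_prop) (by fun_prop) fun x hx => ?_
  have : x ^ 2 < 1 := (sq_lt_one_iff_abs_lt_one x).2 (abs_lt.2 hx)
  linarith

lemma continuousOn_radDens (m : ℕ) : ContinuousOn (radDens m) (Set.Ioo (-1) 1) := by
  unfold radDens
  exact (continuousOn_const.mul (continuousOn_hypSinh.pow m)).mul continuousOn_confFactor

lemma hasDerivAt_radVol (m : ℕ) {r : ℝ} (hr : r ∈ Set.Ioo (-1 : ℝ) 1) :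
    HasDerivAt (radVol m) (radDens m r) r := by
  have hc := continuousOn_radDens m
  have h0 : (0 : ℝ) ∈ Set.Ioo (-1 : ℝ) 1 := by constructor <;> norm_num
  have hsub : Set.uIcc 0 r ⊆ Set.Ioo (-1 : ℝ) 1 := Set.OrdConnected.uIcc_subset (by infer_instance) h0 hr
  refine intervalIntegral.integral_hasDerivAt_right (hc.mono hsub).intervalIntegrable ?_
    (hc.continuousAt (isOpen_Ioo.mem_nhds hr))
  exact hc.stronglyMeasurableAtFilter isOpen_Ioo r hr

lemma continuousOn_radVol (m : ℕ) : ContinuousOn (radVol m) (Set.Ioo (-1) 1) :=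
  fun _ hr => (hasDerivAt_radVol m hr).continuousAt.continuousWithinAt

@[simp] lemma radVol_zero (m : ℕ) : radVol m 0 = 0 := by simp [radVol]

lemma Ico_subset_Ioo_neg : Set.Ico (0 : ℝ) 1 ⊆ Set.Ioo (-1) 1 :=
  fun _ hx => ⟨by linarith [hx.1], hx.2⟩

lemma strictMonoOn_radVol (m : ℕ) : StrictMonoOn (radVol m) (Set.Ico 0 1) := by
  refine strictMonoOn_of_deriv_pos (convex_Ico 0 1)
    ((continuousOn_radVol m).mono Ico_subset_Ioo_neg) fun x hx => ?_
  rw [interior_Ico] at hx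
  rw [(hasDerivAt_radVol m ⟨by linarith [hx.1], hx.2⟩).deriv]
  exact radDens_pos m hx.1 hx.2

lemma radVol_pos (m : ℕ) {r : ℝ} (h0 : 0 < r) (h1 : r < 1) : 0 < radVol m r := by
  have := strictMonoOn_radVol m ⟨le_refl 0, one_pos⟩ ⟨h0.le, h1⟩ h0
  simpa using this

lemma hasDerivAt_hypSinh {r : ℝ} (h0 : 0 ≤ r) (h1 : r < 1) :
    HasDerivAt hypSinh (confFactor r * ((1 + r ^ 2) / (1 - r ^ 2))) r := by
  have hp := one_sub_sq_pos h0 h1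
  have h := ((hasDerivAt_id r).const_mul 2).div (((hasDerivAt_id r).pow 2).const_sub 1) hp.ne'
  refine h.congr_deriv ?_
  unfold confFactor
  simp
  field_simp
  ring

lemma hasDerivAt_hypCosh {r : ℝ} (h0 : 0 ≤ r) (h1 : r < 1) :
    HasDerivAt (fun r : ℝ => (1 + r ^ 2) / (1 - r ^ 2)) (confFactor r * hypSinh r) r := by
  have hp := one_sub_sq_pos h0 h1
  have h := (((hasDerivAt_id r).pow 2).const_add 1).div (((hasDerivAt_id r).pow 2).const_sub 1) hp.ne'
  refine h.congr_deriv ?_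
  unfold confFactor hypSinh
  simp
  field_simp
  ring

lemma hypCosh_sq {r : ℝ} (h0 : 0 ≤ r) (h1 : r < 1) :
    ((1 + r ^ 2) / (1 - r ^ 2)) ^ 2 = 1 + hypSinh r ^ 2 := by
  have hp := one_sub_sq_pos h0 h1
  unfold hypSinh
  field_simp
  ring

lemma radVol_lt_hypSinh_pow {m : ℕ} (hm : 1 ≤ m) {r : ℝ} (h0 : 0 < r) (h1 : r < 1) :
    m * (radVol m r / (m + 1)) < hypSinh r ^ m := by
  have hmono : StrictMonoOn (fun r => hypSinh r ^ m - m * (radVol m r / (m + 1))) (Set.Ico 0 1) := by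
    refine strictMonoOn_of_deriv_pos (convex_Ico 0 1) ?_ fun x hx => ?_
    · exact ((continuousOn_hypSinh.pow m).sub
        (continuousOn_const.mul ((continuousOn_radVol m).div_const _))).mono Ico_subset_Ioo_neg
    · rw [interior_Ico] at hx
      have hd := ((hasDerivAt_hypSinh hx.1.le hx.2).pow m).sub
        (((hasDerivAt_radVol m ⟨by linarith [hx.1], hx.2⟩).div_const ((m : ℝ) + 1)).const_mul (m : ℝ))
      rw [show (fun r => hypSinh r ^ m - m * (radVol m r / (m + 1))) = 
        (hypSinh ^ m - fun y => (m : ℝ) * (radVol m y / (m + 1))) from rfl, hd.deriv]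
      have hs := hypSinh_pos hx.1 hx.2
      have hw := confFactor_pos hx.1.le hx.2
      have hc : hypSinh x < (1 + x ^ 2) / (1 - x ^ 2) := by
        unfold hypSinh
        have hp := one_sub_sq_pos hx.1.le hx.2
        have := hx.2
        gcongr
        nlinarith
      obtain ⟨k, rfl⟩ : ∃ k, m = k + 1 := ⟨m - 1, by omega⟩
      unfold radDens
      have : (0 : ℝ) < ((k + 1 : ℕ) : ℝ) := by positivity
      rw [Nat.add_sub_cancel, mul_assoc (((k + 1 : ℕ) : ℝ) + 1), mul_div_cancel_left₀ _ (by positivity),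
        pow_succ (hypSinh x)]
      have h3 : hypSinh x ^ k * hypSinh x * confFactor x <
          hypSinh x ^ k * (confFactor x * ((1 + x ^ 2) / (1 - x ^ 2))) := by
        rw [mul_assoc, mul_comm (hypSinh x)]
        gcongr
      nlinarith [mul_lt_mul_of_pos_left h3 this]
  have := hmono ⟨le_refl 0, one_pos⟩ ⟨h0.le, h1⟩ h0
  have h00 : hypSinh 0 = 0 := by simp [hypSinh]
  simp only [h00, radVol_zero, zero_div, mul_zero, sub_zero,
    zero_pow (by omega : m ≠ 0)] at this
  linarith

lemma hasDerivAt_radVol_rpow {m : ℕ} (hm : 1 ≤ m) {r : ℝ} (h0 : 0 < r) (h1 : r < 1) (q : ℝ) :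
    HasDerivAt (fun r => (m * (radVol m r / (m + 1))) ^ q)
      (q * (m * (radVol m r / (m + 1))) ^ (q - 1) * (m * hypSinh r ^ m * confFactor r)) r := by
  have hX := radVol_pos m h0 h1
  have hm' : (0 : ℝ) < m := by exact_mod_cast hm
  have hy : 0 < m * (radVol m r / (m + 1)) := by positivity
  have hd := (((hasDerivAt_radVol m ⟨by linarith, h1⟩).div_const ((m : ℝ) + 1)).const_mul
    (m : ℝ)).rpow_const (p := q) (Or.inl hy.ne')
  refine hd.congr_deriv ?_
  unfold radDens
  field_simp

lemma continuousOn_radVol_rpow {m : ℕ} {q : ℝ} (hq : 0 ≤ q) :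
    ContinuousOn (fun r => (m * (radVol m r / (m + 1))) ^ q) (Set.Ico 0 1) :=
  ((continuousOn_const.mul ((continuousOn_radVol m).div_const _)).mono Ico_subset_Ioo_neg).rpow_const
    fun _ _ => Or.inr hq

lemma continuousOn_hypCosh :
    ContinuousOn (fun r : ℝ => (1 + r ^ 2) / (1 - r ^ 2)) (Set.Ico 0 1) :=
  fun _ hx => (hasDerivAt_hypCosh hx.1 hx.2).continuousAt.continuousWithinAt

lemma radVol_aux_pos {m : ℕ} (hm : 1 ≤ m) {r : ℝ} (h0 : 0 < r) (h1 : r < 1) :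
    0 < hypSinh r ^ (m + 1) * ((1 + r ^ 2) / (1 - r ^ 2)) - radVol m r
      - (m * (radVol m r / (m + 1))) ^ (((m : ℝ) + 2) / m) := by
  have hm' : (0 : ℝ) < m := by exact_mod_cast hm
  have hmono : StrictMonoOn (fun r => hypSinh r ^ (m + 1) * ((1 + r ^ 2) / (1 - r ^ 2)) - radVol m r
      - (m * (radVol m r / (m + 1))) ^ (((m : ℝ) + 2) / m)) (Set.Ico 0 1) := by
    refine strictMonoOn_of_deriv_pos (convex_Ico 0 1) ?_ fun x hx => ?_
    · exact ((((continuousOn_hypSinh.mono Ico_subset_Ioo_neg).pow _).mul continuousOn_hypCosh).sub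
        ((continuousOn_radVol m).mono Ico_subset_Ioo_neg)).sub
        (continuousOn_radVol_rpow (by positivity))
    · rw [interior_Ico] at hx
      have hs := hypSinh_pos hx.1 hx.2
      have hw := confFactor_pos hx.1.le hx.2
      have hX := radVol_pos m hx.1 hx.2
      have hd := ((((hasDerivAt_hypSinh hx.1.le hx.2).pow (m + 1)).mul
        (hasDerivAt_hypCosh hx.1.le hx.2)).sub
        (hasDerivAt_radVol m ⟨by linarith [hx.1], hx.2⟩)).sub
        (hasDerivAt_radVol_rpow hm hx.1 hx.2 (((m : ℝ) + 2) / m))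
      have hd2 : HasDerivAt (fun r => hypSinh r ^ (m + 1) * ((1 + r ^ 2) / (1 - r ^ 2)) - radVol m r
          - (m * (radVol m r / (m + 1))) ^ (((m : ℝ) + 2) / m)) _ x := hd
      rw [hd2.deriv]
      have hy : 0 < m * (radVol m x / (m + 1)) := by positivity
      have hlt := radVol_lt_hypSinh_pow hm hx.1 hx.2
      have hpow : (m * (radVol m x / (m + 1))) ^ (2 / (m : ℝ)) < hypSinh x ^ 2 := by
        calc (m * (radVol m x / (m + 1))) ^ (2 / (m : ℝ)) < (hypSinh x ^ m) ^ (2 / (m : ℝ)) :=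
              Real.rpow_lt_rpow hy.le hlt (by positivity)
          _ = hypSinh x ^ 2 := by
              rw [← Real.rpow_natCast, ← Real.rpow_mul hs.le, mul_div_cancel₀ _ hm'.ne']
              norm_cast
      have he : ((m : ℝ) + 2) / m - 1 = 2 / m := by field_simp; ring
      have hcc := hypCosh_sq hx.1.le hx.2
      rw [he]
      generalize (m * (radVol m x / (m + 1))) ^ (2 / (m : ℝ)) = Z at *
      simp only [Nat.add_sub_cancel, Pi.pow_apply]
      unfold radDens
      generalize (1 + x ^ 2) / (1 - x ^ 2) = C at *
      have : 0 < (m + 2) * (hypSinh x ^ m * confFactor x) * (hypSinh x ^ 2 - Z) := by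
        have : 0 < hypSinh x ^ 2 - Z := by linarith
        positivity
      convert this using 1
      push_cast
      field_simp
      rw [pow_succ (hypSinh x) m]
      linear_combination ((m : ℝ) + 1) * hypSinh x ^ m * hcc
  have := hmono ⟨le_refl 0, one_pos⟩ ⟨h0.le, h1⟩ h0
  have h00 : hypSinh 0 = 0 := by simp [hypSinh]
  have hne : ((m : ℝ) + 2) / m ≠ 0 := by positivity
  simp only [h00, radVol_zero, zero_div, mul_zero, sub_zero, Real.zero_rpow hne,
    zero_pow (by omega : m + 1 ≠ 0), zero_mul] at this
  exact this

lemma radVol_sq_add_lt {m : ℕ} (hm : 1 ≤ m) {r : ℝ} (h0 : 0 < r) (h1 : r < 1) :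
    radVol m r ^ 2 + (m * (radVol m r / (m + 1))) ^ (2 * ((m : ℝ) + 1) / m) <
      hypSinh r ^ (2 * (m + 1)) := by
  have hm' : (0 : ℝ) < m := by exact_mod_cast hm
  have hmono : StrictMonoOn (fun r => hypSinh r ^ (2 * (m + 1)) - radVol m r ^ 2
      - (m * (radVol m r / (m + 1))) ^ (2 * ((m : ℝ) + 1) / m)) (Set.Ico 0 1) := by
    refine strictMonoOn_of_deriv_pos (convex_Ico 0 1) ?_ fun x hx => ?_
    · exact (((continuousOn_hypSinh.mono Ico_subset_Ioo_neg).pow _).sub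
        (((continuousOn_radVol m).mono Ico_subset_Ioo_neg).pow 2)).sub
        (continuousOn_radVol_rpow (by positivity))
    · rw [interior_Ico] at hx
      have hs := hypSinh_pos hx.1 hx.2
      have hw := confFactor_pos hx.1.le hx.2
      have hX := radVol_pos m hx.1 hx.2
      have hd := (((hasDerivAt_hypSinh hx.1.le hx.2).pow (2 * (m + 1))).sub
        ((hasDerivAt_radVol m ⟨by linarith [hx.1], hx.2⟩).pow 2)).sub
        (hasDerivAt_radVol_rpow hm hx.1 hx.2 (2 * ((m : ℝ) + 1) / m))
      have hd2 : HasDerivAt (fun r => hypSinh r ^ (2 * (m + 1)) - radVol m r ^ 2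
          - (m * (radVol m r / (m + 1))) ^ (2 * ((m : ℝ) + 1) / m)) _ x := hd
      rw [hd2.deriv]
      have haux := radVol_aux_pos hm hx.1 hx.2
      have he : 2 * ((m : ℝ) + 1) / m - 1 = (m + 2) / m := by field_simp; ring
      rw [he]
      generalize (m * (radVol m x / (m + 1))) ^ (((m : ℝ) + 2) / m) = Z at *
      unfold radDens
      generalize (1 + x ^ 2) / (1 - x ^ 2) = C at *
      have : 0 < 2 * ((m : ℝ) + 1) * (hypSinh x ^ m * confFactor x) *
          (hypSinh x ^ (m + 1) * C - radVol m x - Z) := by positivity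
      convert this using 1
      rw [show 2 * (m + 1) - 1 = m + (m + 1) by omega, pow_add]
      push_cast
      field_simp
  have := hmono ⟨le_refl 0, one_pos⟩ ⟨h0.le, h1⟩ h0
  have h00 : hypSinh 0 = 0 := by simp [hypSinh]
  have hne : 2 * ((m : ℝ) + 1) / m ≠ 0 := by positivity
  simp only [h00, radVol_zero, zero_div, mul_zero, sub_zero, Real.zero_rpow hne,
    zero_pow (by omega : 2 * (m + 1) ≠ 0), zero_pow two_ne_zero] at this
  linarith

/-- The pointwise comparison between hyperbolic and Euclidean radial gradients. -/
lemma radVol_rpow_add_lt {m : ℕ} (hm : 1 ≤ m) {p : ℝ} (hp : 2 * ((m : ℝ) + 1) / m ≤ p)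
    {r : ℝ} (h0 : 0 < r) (h1 : r < 1) :
    radVol m r ^ (m * p / (m + 1)) + (m / (m + 1)) ^ p * radVol m r ^ p <
      hypSinh r ^ (m * p) := by
  have hm' : (0 : ℝ) < m := by exact_mod_cast hm
  have hs := hypSinh_pos h0 h1
  have hX := radVol_pos m h0 h1
  have hq : 1 ≤ p / (2 * ((m : ℝ) + 1) / m) := (one_le_div (by positivity)).2 hp
  have hq0 : 0 < p / (2 * ((m : ℝ) + 1) / m) := by linarith
  have hp0 : 0 < p := lt_of_lt_of_le (by positivity) hp
  have key := radVol_sq_add_lt hm h0 h1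
  calc radVol m r ^ (m * p / (m + 1)) + (m / (m + 1)) ^ p * radVol m r ^ p
      = (radVol m r ^ 2) ^ (p / (2 * ((m : ℝ) + 1) / m)) +
        ((m * (radVol m r / (m + 1))) ^ (2 * ((m : ℝ) + 1) / m)) ^ (p / (2 * ((m : ℝ) + 1) / m)) := by
        rw [← Real.rpow_natCast, ← Real.rpow_mul hX.le, ← Real.rpow_mul (by positivity),
          ← Real.mul_rpow (by positivity) (by positivity)]
        congr 2
        · push_cast; field_simp
        · field_simp
        · field_simp
    _ ≤ (radVol m r ^ 2 + (m * (radVol m r / (m + 1))) ^ (2 * ((m : ℝ) + 1) / m)) ^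
          (p / (2 * ((m : ℝ) + 1) / m)) := Real.add_rpow_le_rpow_add (by positivity) (by positivity) hq
    _ < (hypSinh r ^ (2 * (m + 1))) ^ (p / (2 * ((m : ℝ) + 1) / m)) :=
        Real.rpow_lt_rpow (by positivity) key hq0
    _ = hypSinh r ^ (m * p) := by
        rw [← Real.rpow_natCast, ← Real.rpow_mul hs.le]
        congr 1
        push_cast; field_simp

/-- Young's inequality with a weight and a parameter. -/
lemma weighted_young {p κ x u v : ℝ} (hp : 1 < p) (hκ : 0 < κ) (hx : 0 < x) (hu : 0 ≤ u)
    (hv : 0 ≤ v) :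
    u * v ≤ κ * u ^ (p / (p - 1)) * x + (κ * (p / (p - 1))) ^ (1 - p) / p * (v ^ p * x ^ (1 - p)) := by
  have hp1 : 0 < p - 1 := by linarith
  have hp0 : 0 < p := by linarith
  have hq : 0 < p / (p - 1) := by positivity
  set ε : ℝ := (κ * (p / (p - 1)) * x) ^ ((p - 1) / p) with hε
  have hbase : 0 < κ * (p / (p - 1)) * x := by positivity
  have hεpos : 0 < ε := Real.rpow_pos_of_pos hbase _
  have hconj : (p / (p - 1)).HolderConjugate p := by
    rw [Real.holderConjugate_iff]
    refine ⟨by rw [lt_div_iff₀ hp1]; linarith, ?_⟩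
    field_simp
    ring
  have hy := Real.young_inequality_of_nonneg (mul_nonneg hεpos.le hu) (div_nonneg hv hεpos.le) hconj
  have h1 : ε ^ (p / (p - 1)) = κ * (p / (p - 1)) * x := by
    rw [hε, ← Real.rpow_mul hbase.le]
    rw [show (p - 1) / p * (p / (p - 1)) = 1 by field_simp, Real.rpow_one]
  have h2 : ε ^ p = ((κ * (p / (p - 1))) ^ (1 - p) * x ^ (1 - p))⁻¹ := by
    rw [hε, ← Real.rpow_mul hbase.le, ← Real.mul_rpow (by positivity) hx.le,
      ← Real.rpow_neg hbase.le]
    congr 1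
    field_simp
    ring
  rw [Real.mul_rpow hεpos.le hu, Real.div_rpow hv hεpos.le, h1, h2] at hy
  have e1 : ε * u * (v / ε) = u * v := by field_simp
  rw [e1] at hy
  refine hy.trans (le_of_eq ?_)
  field_simp

/-- A lower bound for the derivative of a function that is continuous on `[a, b]` and absolutely
continuous away from `a` integrates to a lower bound for its increment. -/
lemma integral_le_sub_of_le_deriv {R g : ℝ → ℝ} {a b : ℝ} (hab : a < b)
    (hc : ContinuousOn R (Set.Icc a b))
    (hac : ∀ ε ∈ Set.Ioo a b, AbsolutelyContinuousOnInterval R ε b)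
    (hg : IntervalIntegrable g volume a b)
    (hle : ∀ᵐ r, r ∈ Set.Ioo a b → g r ≤ deriv R r) :
    ∫ r in a..b, g r ≤ R b - R a := by
  have h1 : ∀ ε ∈ Set.Ioo a b, ∫ r in ε..b, g r ≤ R b - R ε := by
    intro ε hε
    rw [← (hac ε hε).integral_deriv_eq_sub]
    refine intervalIntegral.integral_mono_ae_restrict hε.2.le ?_ (hac ε hε).intervalIntegrable_deriv ?_
    · exact hg.mono_set (by
        rw [Set.uIcc_of_le hε.2.le, Set.uIcc_of_le hab.le]; exact Set.Icc_subset_Icc_left hε.1.le)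
    · rw [Filter.EventuallyLE, ae_restrict_iff' measurableSet_Icc]
      have hb : ∀ᵐ r : ℝ, r ≠ b := by simp [ae_iff]
      filter_upwards [hle, hb] with r hr hrb hmem
      exact hr ⟨hε.1.trans_le hmem.1, lt_of_le_of_ne hmem.2 hrb⟩
  have hcont : ContinuousOn (fun ε => ∫ r in ε..b, g r) (Set.Icc a b) := by
    have := intervalIntegral.continuousOn_primitive_interval' hg.symm (a := b) Set.left_mem_uIcc
    rw [Set.uIcc_of_ge hab.le] at this
    refine this.neg.congr fun ε _ => ?_
    simp [intervalIntegral.integral_symm b ε]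
  have hne : (nhdsWithin a (Set.Ioo a b)).NeBot := left_nhdsWithin_Ioo_neBot hab
  have t1 : Filter.Tendsto (fun ε => ∫ r in ε..b, g r) (nhdsWithin a (Set.Ioo a b))
      (nhds (∫ r in a..b, g r)) :=
    (hcont a ⟨le_refl a, hab.le⟩).mono_left (nhdsWithin_mono a Set.Ioo_subset_Icc_self)
  have t2 : Filter.Tendsto (fun ε => R b - R ε) (nhdsWithin a (Set.Ioo a b)) (nhds (R b - R a)) :=
    tendsto_const_nhds.sub
      ((hc a ⟨le_refl a, hab.le⟩).mono_left (nhdsWithin_mono a Set.Ioo_subset_Icc_self))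
  exact le_of_tendsto_of_tendsto t1 t2 (by
    filter_upwards [self_mem_nhdsWithin] with ε hε using h1 ε hε)

lemma LipschitzWith.absolutelyContinuousOnInterval_rpow {φ : ℝ → ℝ} {K : NNReal}
    (hφ : LipschitzWith K φ) (h0 : ∀ r, 0 ≤ φ r) {q : ℝ} (hq : 1 ≤ q) (a b : ℝ) :
    AbsolutelyContinuousOnInterval (fun r => φ r ^ q) a b := by
  obtain ⟨C, hC⟩ := (isCompact_uIcc (a := a) (b := b)).bddAbove_image hφ.continuous.continuousOn
  have hcd : ContDiff ℝ 1 (fun x : ℝ => x ^ q) := Real.contDiff_rpow_const_of_le (by simpa using hq)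
  obtain ⟨L, hL⟩ := (hcd.contDiffOn (s := Set.Icc 0 C)).exists_lipschitzOnWith (by decide)
    (convex_Icc _ _) isCompact_Icc
  exact (hL.comp hφ.lipschitzOnWith fun r hr =>
    ⟨h0 r, hC (Set.mem_image_of_mem _ hr)⟩).absolutelyContinuousOnInterval

lemma abs_deriv_le_of_lipschitz {φ : ℝ → ℝ} {K : NNReal} (hφ : LipschitzWith K φ) (r : ℝ) :
    |deriv φ r| ≤ K := norm_deriv_le_of_lipschitz hφ

lemma contDiffOn_radVol (m : ℕ) : ContDiffOn ℝ 1 (radVol m) (Set.Ioo (-1) 1) := by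
  refine (contDiffOn_succ_iff_deriv_of_isOpen (n := 0) isOpen_Ioo).2 ⟨fun r hr =>
    (hasDerivAt_radVol m hr).differentiableAt.differentiableWithinAt, by simp, ?_⟩
  rw [contDiffOn_zero]
  exact (continuousOn_radDens m).congr fun r hr => (hasDerivAt_radVol m hr).deriv

/-- The radial hyperbolic `p`-energy is integrable for Lipschitz profiles. -/
lemma intervalIntegrable_radial_energy {m : ℕ} (hm : 1 ≤ m) {p ρ : ℝ} (hp : 1 < p) (hρ0 : 0 < ρ)
    (hρ1 : ρ < 1) {φ : ℝ → ℝ} {K : NNReal} (hφ : LipschitzWith K φ) :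
    IntervalIntegrable
      (fun r => |deriv φ r| ^ p * radDens m r ^ (1 - p) * hypSinh r ^ (m * p)) volume 0 ρ := by
  have hsub : Set.Icc 0 ρ ⊆ Set.Ioo (-1 : ℝ) 1 := fun x hx => ⟨by linarith [hx.1], by linarith [hx.2]⟩
  have hg : ContinuousOn (fun r => K ^ p * (((m : ℝ) + 1) ^ (1 - p) * hypSinh r ^ m *
      confFactor r ^ (1 - p))) (Set.Icc 0 ρ) := by
    refine continuousOn_const.mul ((continuousOn_const.mul
      ((continuousOn_hypSinh.mono hsub).pow m)).mul
      ((continuousOn_confFactor.mono hsub).rpow_const fun x hx => Or.inl ?_))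
    exact (confFactor_pos hx.1 (by linarith [hx.2])).ne'
  rw [intervalIntegrable_iff_integrableOn_Ioo_of_le hρ0.le]
  have hgi := (hg.integrableOn_Icc (μ := volume)).mono_set Set.Ioo_subset_Icc_self
  refine hgi.mono' ?_ ?_
  · have hsub' : Set.Ioo 0 ρ ⊆ Set.Icc 0 ρ := Set.Ioo_subset_Icc_self
    refine (((measurable_deriv φ).abs.pow_const p).aestronglyMeasurable.mul ?_).mul ?_
    · refine ContinuousOn.aestronglyMeasurable ?_ measurableSet_Ioo
      exact ((continuousOn_radDens m).mono (hsub'.trans hsub)).rpow_const fun x hx =>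
        Or.inl (radDens_pos m hx.1 (by linarith [hx.2])).ne'
    · refine ContinuousOn.aestronglyMeasurable ?_ measurableSet_Ioo
      exact (continuousOn_hypSinh.mono (hsub'.trans hsub)).rpow_const fun x hx =>
        Or.inl (hypSinh_pos hx.1 (by linarith [hx.2])).ne'
  · rw [ae_restrict_iff' measurableSet_Ioo]
    refine Filter.Eventually.of_forall fun r hr => ?_
    have h1 : r < 1 := by linarith [hr.2]
    have hs := hypSinh_pos hr.1 h1
    have hw := confFactor_pos hr.1.le h1
    have hd := radDens_pos m hr.1 h1
    rw [Real.norm_of_nonneg (by positivity), mul_assoc]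
    have heq : radDens m r ^ (1 - p) * hypSinh r ^ (m * p) =
        ((m : ℝ) + 1) ^ (1 - p) * hypSinh r ^ m * confFactor r ^ (1 - p) := by
      unfold radDens
      rw [Real.mul_rpow (by positivity) hw.le, Real.mul_rpow (by positivity) (by positivity),
        ← Real.rpow_natCast, ← Real.rpow_mul hs.le]
      have : hypSinh r ^ (m * (1 - p)) * hypSinh r ^ (m * p) = hypSinh r ^ (m : ℝ) := by
        rw [← Real.rpow_add hs]; congr 1; ring
      linear_combination (((m : ℝ) + 1) ^ (1 - p) * confFactor r ^ (1 - p)) * this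
    rw [heq]
    have : |deriv φ r| ^ p ≤ (K : ℝ) ^ p :=
      Real.rpow_le_rpow (abs_nonneg _) (abs_deriv_le_of_lipschitz hφ r) (by linarith)
    gcongr

lemma intervalIntegrable_radial_weight {m : ℕ} (hm : 1 ≤ m) {p ρ q c : ℝ} (hp : 1 < p) (hρ0 : 0 < ρ)
    (hρ1 : ρ < 1) {φ : ℝ → ℝ} {K : NNReal} (hφ : LipschitzWith K φ) (hc : 0 < c)
    (hle : ∀ r ∈ Set.Ioo 0 ρ, c * radVol m r ^ q ≤ hypSinh r ^ (m * p)) :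
    IntervalIntegrable
      (fun r => |deriv φ r| ^ p * radDens m r ^ (1 - p) * radVol m r ^ q) volume 0 ρ := by
  have h := (intervalIntegrable_radial_energy hm hp hρ0 hρ1 hφ).const_mul c⁻¹
  rw [intervalIntegrable_iff_integrableOn_Ioo_of_le hρ0.le] at h ⊢
  have hsub : Set.Ioo 0 ρ ⊆ Set.Ioo (-1 : ℝ) 1 := fun x hx => ⟨by linarith [hx.1], by linarith [hx.2]⟩
  refine h.mono' ?_ ?_
  · refine (((measurable_deriv φ).abs.pow_const p).aestronglyMeasurable.mul ?_).mul ?_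
    · refine ContinuousOn.aestronglyMeasurable ?_ measurableSet_Ioo
      exact ((continuousOn_radDens m).mono hsub).rpow_const fun x hx =>
        Or.inl (radDens_pos m hx.1 (by linarith [hx.2])).ne'
    · refine ContinuousOn.aestronglyMeasurable ?_ measurableSet_Ioo
      exact ((continuousOn_radVol m).mono hsub).rpow_const fun x hx =>
        Or.inl (radVol_pos m hx.1 (by linarith [hx.2])).ne'
  · rw [ae_restrict_iff' measurableSet_Ioo]
    refine Filter.Eventually.of_forall fun r hr => ?_
    have h1 : r < 1 := by linarith [hr.2]
    have hd := radDens_pos m hr.1 h1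
    have hX := radVol_pos m hr.1 h1
    rw [Real.norm_of_nonneg (by positivity)]
    have := hle r hr
    rw [← mul_assoc, mul_comm c⁻¹, mul_assoc, mul_assoc, mul_assoc]
    have h2 : radVol m r ^ q ≤ c⁻¹ * hypSinh r ^ (m * p) := by
      rw [inv_mul_eq_div, le_div_iff₀ hc]; linarith
    calc |deriv φ r| ^ p * (radDens m r ^ (1 - p) * radVol m r ^ q)
        ≤ |deriv φ r| ^ p * (radDens m r ^ (1 - p) * (c⁻¹ * hypSinh r ^ (m * p))) := by gcongr
      _ = _ := by ring

/-- Hardy's inequality with respect to the radial volume. -/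
lemma radial_hardy {m : ℕ} {p ρ : ℝ} (hp : 1 < p) (hρ0 : 0 < ρ) (hρ1 : ρ < 1)
    {φ : ℝ → ℝ} {K : NNReal} (hφ : LipschitzWith K φ) (h0 : ∀ r, 0 ≤ φ r) (hφρ : φ ρ = 0)
    (hint : IntervalIntegrable
      (fun r => |deriv φ r| ^ p * radDens m r ^ (1 - p) * radVol m r ^ p) volume 0 ρ) :
    ∫ r in (0 : ℝ)..ρ, φ r ^ p * radDens m r ≤
      p ^ p * ∫ r in (0 : ℝ)..ρ, |deriv φ r| ^ p * radDens m r ^ (1 - p) * radVol m r ^ p := by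
  have hp0 : 0 < p := by linarith
  have hsub : Set.Icc 0 ρ ⊆ Set.Ioo (-1 : ℝ) 1 := fun x hx => ⟨by linarith [hx.1], by linarith [hx.2]⟩
  have hcd : ContinuousOn (fun r => φ r ^ p * radDens m r) (Set.uIcc 0 ρ) := by
    rw [Set.uIcc_of_le hρ0.le]
    exact (hφ.continuous.rpow_const fun _ => Or.inr hp0.le).continuousOn.mul
      ((continuousOn_radDens m).mono hsub)
  have hi1 := hcd.intervalIntegrable (μ := volume)
  have key := integral_le_sub_of_le_deriv (R := fun r => φ r ^ p * radVol m r)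
    (g := fun r => 1 / p * (φ r ^ p * radDens m r) -
      p ^ (p - 1) * (|deriv φ r| ^ p * radDens m r ^ (1 - p) * radVol m r ^ p)) hρ0
    ((hφ.continuous.rpow_const fun _ => Or.inr hp0.le).continuousOn.mul
      ((continuousOn_radVol m).mono hsub)) ?_ ((hi1.const_mul _).sub (hint.const_mul _)) ?_
  · rw [intervalIntegral.integral_sub (hi1.const_mul _) (hint.const_mul _),
      intervalIntegral.integral_const_mul, intervalIntegral.integral_const_mul, hφρ,
      Real.zero_rpow hp0.ne', radVol_zero] at key
    have hpp : p ^ p = p * p ^ (p - 1) := by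
      rw [Real.rpow_sub_one hp0.ne']; field_simp
    rw [hpp, mul_assoc]
    simp only [zero_mul, mul_zero, sub_zero] at key
    rw [sub_nonpos, one_div, inv_mul_le_iff₀ hp0] at key
    exact key
  · intro ε hε
    refine (hφ.absolutelyContinuousOnInterval_rpow h0 hp.le ε ρ).mul
      (ContDiffOn.absolutelyContinuousOnInterval ((contDiffOn_radVol m).mono ?_))
    rw [Set.uIcc_of_le hε.2.le]
    exact (Set.Icc_subset_Icc_left hε.1.le).trans hsub
  · filter_upwards [hφ.ae_differentiableAt] with r hr hmem
    have h1 : r < 1 := by linarith [hmem.2]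
    have hd := radDens_pos m hmem.1 h1
    have hX := radVol_pos m hmem.1 h1
    have hder := (hr.hasDerivAt.rpow_const (p := p) (Or.inr hp.le)).mul
      (hasDerivAt_radVol m ⟨by linarith [hmem.1], h1⟩)
    have hder' : HasDerivAt (fun r => φ r ^ p * radVol m r) _ r := hder
    rw [hder'.deriv]
    have hκ : 0 < (p - 1) / p := div_pos (by linarith) hp0
    have hy := weighted_young (κ := (p - 1) / p) hp hκ hd (Real.rpow_nonneg (h0 r) (p - 1))
      (by positivity : 0 ≤ p * |deriv φ r| * radVol m r)
    rw [← Real.rpow_mul (h0 r), show (p - 1) * (p / (p - 1)) = p by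
      have : p - 1 ≠ 0 := by linarith
      field_simp, show (p - 1) / p * (p / (p - 1)) = 1 by
      have : p - 1 ≠ 0 := by linarith
      field_simp, Real.one_rpow, Real.mul_rpow (by positivity) hX.le,
      Real.mul_rpow hp0.le (abs_nonneg _)] at hy
    have hneg : -|deriv φ r| ≤ deriv φ r := neg_abs_le _
    have hnn : 0 ≤ p * φ r ^ (p - 1) * radVol m r := by
      have := Real.rpow_nonneg (h0 r) (p - 1)
      positivity
    have h3 := mul_le_mul_of_nonneg_left hneg hnn
    have hpp : p ^ p = p * p ^ (p - 1) := by
      rw [Real.rpow_sub_one hp0.ne']; field_simp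
    rw [hpp] at hy
    have e1 : (p - 1) / p * φ r ^ p * radDens m r = φ r ^ p * radDens m r - 1 / p * (φ r ^ p * radDens m r) := by
      field_simp
    have e2 : 1 / p * (p * p ^ (p - 1) * |deriv φ r| ^ p * radVol m r ^ p * radDens m r ^ (1 - p))
        = p ^ (p - 1) * (|deriv φ r| ^ p * radDens m r ^ (1 - p) * radVol m r ^ p) := by
      field_simp
    rw [e1, e2] at hy
    linarith

/-- The cumulative distribution of the extremal profile in the volume variable. -/
noncomputable def extremalCdf (m : ℕ) (b Z : ℝ) : ℝ := ∫ t in (0 : ℝ)..Z, ((1 + t ^ b) ^ (m + 1))⁻¹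

lemma extremalCdf_pos (m : ℕ) {b Z : ℝ} (hb : 0 < b) (hZ : 0 < Z) : 0 < extremalCdf m b Z := by
  refine intervalIntegral.intervalIntegral_pos_of_pos_on ?_ (fun x hx => ?_) hZ
  · refine ContinuousOn.intervalIntegrable ?_
    rw [Set.uIcc_of_le hZ.le]
    refine ContinuousOn.inv₀ (by
      have : Continuous fun x : ℝ => x ^ b := Real.continuous_rpow_const hb.le
      fun_prop) fun x hx => ?_
    have := Real.rpow_nonneg hx.1 b
    positivity
  · have := Real.rpow_nonneg hx.1.le b
    positivity

/-- The quantile function of the extremal profile. -/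
lemma exists_extremal_quantile (m : ℕ) {b Z : ℝ} (hb : 0 < b) (hZ : 0 < Z) :
    ∃ H : ℝ → ℝ, ContDiff ℝ 1 H ∧ StrictMono H ∧ H 0 = 0 ∧ H (extremalCdf m b Z) = Z ∧
      ∀ x ∈ Set.Ioc 0 (extremalCdf m b Z), HasDerivAt H ((1 + H x ^ b) ^ (m + 1)) x := by
  set g : ℝ → ℝ := fun t => ((1 + (min |t| Z) ^ b) ^ (m + 1))⁻¹ with hg
  have hmin : ∀ t : ℝ, 0 ≤ min |t| Z := fun t => le_min (abs_nonneg t) hZ.le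
  have hbase : ∀ t : ℝ, 0 < (1 + (min |t| Z) ^ b) ^ (m + 1) := fun t => by
    have := Real.rpow_nonneg (hmin t) b
    positivity
  have hgpos : ∀ t, 0 < g t := fun t => inv_pos.2 (hbase t)
  have hgc : Continuous g := by
    refine Continuous.inv₀ ?_ fun t => (hbase t).ne'
    have : Continuous fun t : ℝ => (min |t| Z) ^ b :=
      (continuous_abs.min continuous_const).rpow_const fun _ => Or.inr hb.le
    fun_prop
  set δ : ℝ := ((1 + Z ^ b) ^ (m + 1))⁻¹ with hδ
  have hδpos : 0 < δ := by have := Real.rpow_nonneg hZ.le b; positivity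
  have hgδ : ∀ t, δ ≤ g t := fun t => by
    have : (min |t| Z) ^ b ≤ Z ^ b := Real.rpow_le_rpow (hmin t) (min_le_right _ _) hb.le
    have := Real.rpow_nonneg (hmin t) b
    simp only [hδ, hg]
    gcongr
  set G : ℝ → ℝ := fun y => ∫ t in (0 : ℝ)..y, g t with hG
  have hGd : ∀ y, HasDerivAt G (g y) y := fun y =>
    intervalIntegral.integral_hasDerivAt_right (hgc.intervalIntegrable _ _)
      hgc.aestronglyMeasurable.stronglyMeasurableAtFilter hgc.continuousAt
  have hGc : Continuous G := continuous_iff_continuousAt.2 fun y => (hGd y).continuousAt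
  have hGm : StrictMono G := strictMono_of_deriv_pos fun y => by rw [(hGd y).deriv]; exact hgpos y
  have hG0 : G 0 = 0 := by simp [hG]
  have hmono : Monotone fun y => G y - δ * y := by
    refine monotone_of_deriv_nonneg (fun y => ?_) fun y => ?_
    · exact ((hGd y).sub ((hasDerivAt_id y).const_mul δ)).differentiableAt
    · have := ((hGd y).sub ((hasDerivAt_id y).const_mul δ)).deriv
      simp only [id_eq, mul_one] at this
      have h2 : deriv (fun y => G y - δ * y) y = g y - δ := this
      rw [h2]; linarith [hgδ y]
  have hsurj : Function.Surjective G := by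
    refine hGc.surjective ?_ ?_
    · refine Filter.tendsto_atTop_mono' _ ?_ (Filter.tendsto_id.const_mul_atTop hδpos)
      filter_upwards [Filter.eventually_ge_atTop 0] with y hy
      have := hmono hy
      simp only [hG0, mul_zero, sub_zero] at this
      simp only [id]; linarith
    · refine Filter.tendsto_atBot_mono' _ ?_ (Filter.tendsto_id.const_mul_atBot hδpos)
      filter_upwards [Filter.eventually_le_atBot 0] with y hy
      have := hmono hy
      simp only [hG0, mul_zero, sub_zero] at this
      simp only [id]; linarith
  let e := hGm.orderIsoOfSurjective G hsurj
  have heG : ∀ y, e y = G y := fun y => rfl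
  have hGe : ∀ x, G (e.symm x) = x := fun x => e.apply_symm_apply x
  have hec : Continuous e.symm := e.symm.continuous
  have hed : ∀ x, HasDerivAt e.symm (g (e.symm x))⁻¹ x := fun x =>
    HasDerivAt.of_local_left_inverse hec.continuousAt (hGd _) (hgpos _).ne'
      (Filter.Eventually.of_forall hGe)
  have hGZ : G Z = extremalCdf m b Z := by
    simp only [hG, extremalCdf]
    refine intervalIntegral.integral_congr fun t ht => ?_
    rw [Set.uIcc_of_le hZ.le] at ht
    simp only [hg, abs_of_nonneg ht.1, min_eq_left ht.2]
  have heZ : e.symm (extremalCdf m b Z) = Z := by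
    rw [← hGZ, ← heG, e.symm_apply_apply]
  have he0 : e.symm 0 = 0 := by
    conv_lhs => rw [← hG0, ← heG, e.symm_apply_apply]
  refine ⟨e.symm, ?_, e.symm.strictMono, he0, heZ, fun x hx => ?_⟩
  · rw [contDiff_one_iff_deriv]
    refine ⟨fun x => (hed x).differentiableAt, ?_⟩
    have : deriv e.symm = fun x => (g (e.symm x))⁻¹ := funext fun x => (hed x).deriv
    rw [this]
    exact (hgc.comp hec).inv₀ fun x => (hgpos _).ne'
  · have h1 : 0 ≤ e.symm x := by rw [← he0]; exact e.symm.monotone hx.1.le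
    have h2 : e.symm x ≤ Z := by rw [← heZ]; exact e.symm.monotone hx.2
    have := hed x
    simpa only [hg, abs_of_nonneg h1, min_eq_left h2, inv_inv] using this

lemma transport_amgm {m : ℕ} {X Y x y : ℝ} (hX : 0 < X) (hY : 0 < Y) (hx : 0 ≤ x)
    (hy : 0 ≤ y) :
    x ^ ((m : ℝ) / (m + 1)) * y ^ (1 / ((m : ℝ) + 1)) ≤
      (m : ℝ) / (m + 1) * (X ^ ((m : ℝ) / (m + 1) - 1) * x * Y ^ (1 / ((m : ℝ) + 1))) +
      1 / ((m : ℝ) + 1) * (X ^ ((m : ℝ) / (m + 1)) * (Y ^ (1 / ((m : ℝ) + 1) - 1) * y)) := by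
  have hm : (0 : ℝ) < m + 1 := by positivity
  have key := Real.geom_mean_le_arith_mean2_weighted (w₁ := (m : ℝ) / (m + 1)) (w₂ := 1 / ((m : ℝ) + 1))
    (p₁ := X ^ ((m : ℝ) / (m + 1) - 1) * x * Y ^ (1 / ((m : ℝ) + 1)))
    (p₂ := X ^ ((m : ℝ) / (m + 1)) * (Y ^ (1 / ((m : ℝ) + 1) - 1) * y))
    (by positivity) (by positivity) (by positivity) (by positivity) (by field_simp)
  refine le_trans (le_of_eq ?_) key
  rw [Real.mul_rpow (by positivity) (by positivity), Real.mul_rpow (by positivity) (by positivity),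
    Real.mul_rpow (by positivity) (by positivity), Real.mul_rpow (by positivity) (by positivity),
    ← Real.rpow_mul hX.le, ← Real.rpow_mul hY.le, ← Real.rpow_mul hX.le, ← Real.rpow_mul hY.le]
  have e1 : X ^ (((m : ℝ) / (m + 1) - 1) * (m / (m + 1))) * X ^ ((m : ℝ) / (m + 1) * (1 / (m + 1))) = 1 := by
    rw [← Real.rpow_add hX]
    rw [show (((m : ℝ) / (m + 1) - 1) * (m / (m + 1))) + ((m : ℝ) / (m + 1) * (1 / (m + 1))) = 0 by
      field_simp; ring, Real.rpow_zero]
  have e2 : Y ^ (1 / ((m : ℝ) + 1) * (m / (m + 1))) * Y ^ ((1 / ((m : ℝ) + 1) - 1) * (1 / (m + 1))) = 1 := by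
    rw [← Real.rpow_add hY]
    rw [show (1 / ((m : ℝ) + 1) * (m / (m + 1))) + ((1 / ((m : ℝ) + 1) - 1) * (1 / (m + 1))) = 0 by
      field_simp; ring, Real.rpow_zero]
  generalize X ^ (((m : ℝ) / (m + 1) - 1) * (m / (m + 1))) = X₁ at *
  generalize X ^ ((m : ℝ) / (m + 1) * (1 / (m + 1))) = X₂ at *
  generalize Y ^ (1 / ((m : ℝ) + 1) * (m / (m + 1))) = Y₁ at *
  generalize Y ^ ((1 / ((m : ℝ) + 1) - 1) * (1 / (m + 1))) = Y₂ at *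
  generalize x ^ ((m : ℝ) / (m + 1)) = x₁
  generalize y ^ (1 / ((m : ℝ) + 1)) = y₁
  linear_combination -(x₁ * y₁ * Y₁ * Y₂) * e1 - (x₁ * y₁) * e2

/-- The pointwise differential inequality behind the sharp radial Sobolev inequality. -/
lemma bliss_pointwise {m : ℕ} {p f d X x Y c : ℝ} (hp1 : 1 < p) (hpn : p < m + 1) (hm : 1 ≤ m)
    (hf : 0 ≤ f) (hX : 0 < X) (hx : 0 < x) (hY : 0 < Y) (hc : 0 < c) :
    -((m / (m + 1) * c ^ (1 / ((m : ℝ) + 1)) * (p / (p - 1))) ^ (1 - p) / p *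
        (p * m / (m + 1 - p)) ^ p * (|d| ^ p * x ^ (1 - p) * X ^ (m * p / (m + 1)))) ≤
      p * m / (m + 1 - p) * f ^ (p * m / (m + 1 - p) - 1) * d *
          (X ^ ((m : ℝ) / (m + 1)) * Y ^ (1 / ((m : ℝ) + 1))) +
        f ^ (p * m / (m + 1 - p)) *
          ((m : ℝ) / (m + 1) * (X ^ ((m : ℝ) / (m + 1) - 1) * x * Y ^ (1 / ((m : ℝ) + 1))) +
            1 / ((m : ℝ) + 1) * (X ^ ((m : ℝ) / (m + 1)) * (Y ^ (1 / ((m : ℝ) + 1) - 1) *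
              (c * f ^ ((m + 1) * p / (m + 1 - p)) * x *
                (1 + Y ^ (p / ((p - 1) * (m + 1)))) ^ (m + 1))))) -
        c ^ (1 / ((m : ℝ) + 1) - 1) *
          (m / (m + 1 - p) * (c * (f ^ ((m + 1) * p / (m + 1 - p)) * x)) -
            (p - 1) / (m + 1 - p) * (c * f ^ ((m + 1) * p / (m + 1 - p)) * x *
              ((1 + Y ^ (p / ((p - 1) * (m + 1)))) -
                m * (p / ((p - 1) * (m + 1))) * Y ^ (p / ((p - 1) * (m + 1)))))) := by
  have hm' : (0 : ℝ) < m := by exact_mod_cast hm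
  have hn : (0 : ℝ) < m + 1 := by positivity
  have hp0 : 0 < p := by linarith
  have hp1' : 0 < p - 1 := by linarith
  have hnp : 0 < m + 1 - p := by linarith
  have hcr : 0 < c ^ (1 / ((m : ℝ) + 1)) := Real.rpow_pos_of_pos hc _
  have hκ : 0 < m / (m + 1) * c ^ (1 / ((m : ℝ) + 1)) := by positivity
  have hY' := Real.rpow_pos_of_pos hY (p / ((p - 1) * (m + 1)))
  have hF := Real.rpow_nonneg hf ((m + 1) * p / (m + 1 - p))
  have hα1 : 0 < p * m / (m + 1 - p) - 1 := by
    rw [sub_pos, lt_div_iff₀ hnp]; nlinarith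
  have hα0 : 0 < p * m / (m + 1 - p) := by linarith
  -- the arithmetic-geometric mean step
  have hag := transport_amgm (m := m) hX hY hx.le (y := c * f ^ ((m + 1) * p / (m + 1 - p)) * x *
                (1 + Y ^ (p / ((p - 1) * (m + 1)))) ^ (m + 1)) (by positivity)
  have hag2 := mul_le_mul_of_nonneg_left hag (Real.rpow_nonneg hf (p * m / (m + 1 - p)))
  have e1 : f ^ (p * m / (m + 1 - p)) * (x ^ ((m : ℝ) / (m + 1)) *
      (c * f ^ ((m + 1) * p / (m + 1 - p)) * x *
        (1 + Y ^ (p / ((p - 1) * (m + 1)))) ^ (m + 1)) ^ (1 / ((m : ℝ) + 1))) =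
      c ^ (1 / ((m : ℝ) + 1)) * f ^ ((m + 1) * p / (m + 1 - p)) * x *
        (1 + Y ^ (p / ((p - 1) * (m + 1)))) := by
    rw [Real.mul_rpow (by positivity) (by positivity), Real.mul_rpow (by positivity) hx.le,
      Real.mul_rpow hc.le hF, ← Real.rpow_mul hf, ← Real.rpow_natCast (1 + _) (m + 1),
      ← Real.rpow_mul (by positivity)]
    push_cast
    rw [mul_one_div_cancel hn.ne', Real.rpow_one]
    have h1 : x ^ ((m : ℝ) / (m + 1)) * x ^ (1 / ((m : ℝ) + 1)) = x := by
      rw [← Real.rpow_add hx, ← add_div, div_self hn.ne', Real.rpow_one]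
    have h2 : f ^ (p * m / (m + 1 - p)) * f ^ ((m + 1) * p / (m + 1 - p) * (1 / ((m : ℝ) + 1))) =
        f ^ ((m + 1) * p / (m + 1 - p)) := by
      rw [← Real.rpow_add_of_nonneg hf hα0.le (by positivity)]
      congr 1
      field_simp
    rw [← h2]
    nth_rewrite 3 [← h1]
    ring
  rw [e1] at hag2
  -- Young's inequality
  have hy := weighted_young hp1 hκ hx
    (u := f ^ (p * m / (m + 1 - p) - 1) * Y ^ (1 / ((m : ℝ) + 1)))
    (v := p * m / (m + 1 - p) * |d| * X ^ ((m : ℝ) / (m + 1)))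
    (mul_nonneg (Real.rpow_nonneg hf _) (Real.rpow_nonneg hY.le _)) (by positivity)
  have e2 : (f ^ (p * m / (m + 1 - p) - 1) * Y ^ (1 / ((m : ℝ) + 1))) ^ (p / (p - 1)) =
      f ^ ((m + 1) * p / (m + 1 - p)) * Y ^ (p / ((p - 1) * (m + 1))) := by
    rw [Real.mul_rpow (Real.rpow_nonneg hf _) (Real.rpow_nonneg hY.le _), ← Real.rpow_mul hf,
      ← Real.rpow_mul hY.le]
    congr 2
    · field_simp; ring
    · field_simp
  have e3 : (p * m / (m + 1 - p) * |d| * X ^ ((m : ℝ) / (m + 1))) ^ p =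
      (p * m / (m + 1 - p)) ^ p * |d| ^ p * X ^ (m * p / (m + 1)) := by
    rw [Real.mul_rpow (by positivity) (by positivity), Real.mul_rpow hα0.le (abs_nonneg _),
      ← Real.rpow_mul hX.le]
    congr 2
    field_simp
  rw [e2, e3] at hy
  have hneg : -|d| ≤ d := neg_abs_le _
  have hnn : 0 ≤ p * m / (m + 1 - p) * f ^ (p * m / (m + 1 - p) - 1) *
      (X ^ ((m : ℝ) / (m + 1)) * Y ^ (1 / ((m : ℝ) + 1))) :=
    mul_nonneg (mul_nonneg hα0.le (Real.rpow_nonneg hf _))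
      (mul_nonneg (Real.rpow_nonneg hX.le _) (Real.rpow_nonneg hY.le _))
  have h3 := mul_le_mul_of_nonneg_left hneg hnn
  have e4 : c ^ (1 / ((m : ℝ) + 1) - 1) * c = c ^ (1 / ((m : ℝ) + 1)) := by
    rw [Real.rpow_sub_one hc.ne']; field_simp
  generalize Y ^ (p / ((p - 1) * (m + 1))) = V at *
  generalize f ^ ((m + 1) * p / (m + 1 - p)) = F at *
  have e5 : c ^ (1 / ((m : ℝ) + 1) - 1) *
      (m / (m + 1 - p) * (c * (F * x)) - (p - 1) / (m + 1 - p) * (c * F * x *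
              ((1 + V) - m * (p / ((p - 1) * (m + 1))) * V))) =
      c ^ (1 / ((m : ℝ) + 1)) * F * x * (1 + V) -
        (m / (m + 1) * c ^ (1 / ((m : ℝ) + 1))) * (F * V) * x := by
    rw [← e4]
    generalize c ^ (1 / ((m : ℝ) + 1) - 1) = cc
    field_simp
    ring
  rw [e5]
  generalize (m / (m + 1) * c ^ (1 / ((m : ℝ) + 1)) * (p / (p - 1))) ^ (1 - p) = K at *
  linarith

lemma hasDerivAt_extremal_boundary (m : ℕ) {b y : ℝ} (hy : 0 < y) :
    HasDerivAt (fun y : ℝ => y * ((1 + y ^ b) ^ m)⁻¹)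
      (((1 + y ^ b) - m * b * y ^ b) * ((1 + y ^ b) ^ (m + 1))⁻¹) y := by
  have hV := Real.rpow_pos_of_pos hy b
  have hd := (hasDerivAt_id y).mul ((((Real.hasDerivAt_rpow_const (p := b) (Or.inl hy.ne')).const_add 1).pow m).inv
    (pow_ne_zero _ (by positivity)))
  have hd' : HasDerivAt (fun y : ℝ => y * ((1 + y ^ b) ^ m)⁻¹) _ y := hd
  refine hd'.congr_deriv ?_
  have h1 : y ^ (b - 1) = y ^ b / y := Real.rpow_sub_one hy.ne' b
  simp only [Pi.pow_apply, id, h1, Pi.inv_apply]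
  generalize y ^ b = V at *
  rcases m with _ | k
  · simp
    field_simp
  · simp only [Nat.add_sub_cancel]
    push_cast
    field_simp
    ring

lemma bliss_of_quantile {m : ℕ} (hm : 1 ≤ m) {p ρ Z : ℝ} (hp1 : 1 < p) (hpn : p < m + 1)
    (hρ0 : 0 < ρ) (hρ1 : ρ < 1) (hZ : 0 < Z) {φ : ℝ → ℝ} {K : NNReal} (hφ : LipschitzWith K φ)
    (h0 : ∀ r, 0 ≤ φ r) (hφ0 : 0 < φ 0) (hφρ : φ ρ = 0)
    (hint : IntervalIntegrable (fun r => |deriv φ r| ^ p * radDens m r ^ (1 - p) *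
      radVol m r ^ (m * p / (m + 1))) volume 0 ρ) {c : ℝ}
    (hc : c = extremalCdf m (p / ((p - 1) * (m + 1))) Z /
      ∫ r in (0 : ℝ)..ρ, φ r ^ ((m + 1) * p / (m + 1 - p)) * radDens m r) :
    0 < ∫ r in (0 : ℝ)..ρ, φ r ^ ((m + 1) * p / (m + 1 - p)) * radDens m r ∧
    c ^ (1 / ((m : ℝ) + 1) - 1) *
        (m / (m + 1 - p) * extremalCdf m (p / ((p - 1) * (m + 1))) Z -
          (p - 1) / (m + 1 - p) * (Z * ((1 + Z ^ (p / ((p - 1) * (m + 1)))) ^ m)⁻¹)) ≤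
      (m / (m + 1) * c ^ (1 / ((m : ℝ) + 1)) * (p / (p - 1))) ^ (1 - p) / p *
        (p * m / (m + 1 - p)) ^ p * ∫ r in (0 : ℝ)..ρ, |deriv φ r| ^ p * radDens m r ^ (1 - p) *
          radVol m r ^ (m * p / (m + 1)) := by
  have hm' : (0 : ℝ) < m := by exact_mod_cast hm
  have hn : (0 : ℝ) < m + 1 := by positivity
  have hp0 : 0 < p := by linarith
  have hp1' : 0 < p - 1 := by linarith
  have hnp : 0 < m + 1 - p := by linarith
  have hb : 0 < p / ((p - 1) * (m + 1)) := by positivity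
  have hα1 : 1 ≤ p * m / (m + 1 - p) := by
    rw [le_div_iff₀ hnp]; nlinarith
  have hps : 0 < (m + 1) * p / (m + 1 - p) := by positivity
  set ps : ℝ := (m + 1) * p / (m + 1 - p) with hps_def
  set b : ℝ := p / ((p - 1) * (m + 1)) with hb_def
  set α : ℝ := p * m / (m + 1 - p) with hα_def
  set f : ℝ → ℝ := fun r => φ r ^ ps * radDens m r with hf_def
  have hfc : ContinuousOn f (Set.Ioo (-1) 1) :=
    (hφ.continuous.rpow_const fun _ => Or.inr hps.le).continuousOn.mul (continuousOn_radDens m)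
  have h0mem : (0 : ℝ) ∈ Set.Ioo (-1 : ℝ) 1 := by constructor <;> norm_num
  have hsub : Set.Icc 0 ρ ⊆ Set.Ioo (-1 : ℝ) 1 := fun x hx => ⟨by linarith [hx.1], by linarith [hx.2]⟩
  have hfi : ∀ r ∈ Set.Ioo (-1 : ℝ) 1, ∀ s ∈ Set.Ioo (-1 : ℝ) 1, IntervalIntegrable f volume r s :=
    fun r hr s hs => (hfc.mono (Set.OrdConnected.uIcc_subset (by infer_instance) hr hs)).intervalIntegrable
  set M : ℝ → ℝ := fun r => ∫ t in (0 : ℝ)..r, f t with hM_def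
  have hMd : ∀ r ∈ Set.Ioo (-1 : ℝ) 1, HasDerivAt M (f r) r := fun r hr =>
    intervalIntegral.integral_hasDerivAt_right (hfi 0 h0mem r hr)
      (hfc.stronglyMeasurableAtFilter isOpen_Ioo r hr) (hfc.continuousAt (isOpen_Ioo.mem_nhds hr))
  have hfnn : ∀ r ∈ Set.Icc 0 ρ, 0 ≤ f r := fun r hr =>
    mul_nonneg (Real.rpow_nonneg (h0 r) _) (radDens_nonneg m hr.1 (by linarith [hr.2]))
  have hMmono : MonotoneOn M (Set.Icc 0 ρ) := by
    refine monotoneOn_of_deriv_nonneg (convex_Icc 0 ρ)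
      (fun r hr => (hMd r (hsub hr)).continuousAt.continuousWithinAt)
      (fun r hr => (hMd r (hsub (interior_subset hr))).differentiableAt.differentiableWithinAt)
      fun r hr => ?_
    rw [(hMd r (hsub (interior_subset hr))).deriv]
    exact hfnn r (interior_subset hr)
  have hM0 : M 0 = 0 := by simp [hM_def]
  have hMpos : ∀ r ∈ Set.Ioc 0 ρ, 0 < M r := by
    intro r hr
    have hev : ∀ᶠ s in nhds (0 : ℝ), 0 < φ s := hφ.continuous.continuousAt.eventually (lt_mem_nhds hφ0)
    obtain ⟨δ, hδ, hball⟩ := Metric.eventually_nhds_iff.1 hev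
    set s := min r (δ / 2) with hs
    have hs0 : 0 < s := lt_min hr.1 (by linarith)
    have hsr : s ≤ r := min_le_left _ _
    have hsδ : s < δ := (min_le_right _ _).trans_lt (by linarith)
    have : 0 < M s := by
      refine intervalIntegral.intervalIntegral_pos_of_pos_on
        (hfi 0 h0mem s (hsub ⟨hs0.le, hsr.trans hr.2⟩)) (fun x hx => ?_) hs0
      refine mul_pos (Real.rpow_pos_of_pos (hball ?_) _) (radDens_pos m hx.1 (by linarith [hx.2, hr.2]))
      rw [Real.dist_eq, sub_zero, abs_of_pos hx.1]; linarith [hx.2]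
    exact this.trans_le (hMmono ⟨hs0.le, hsr.trans hr.2⟩ ⟨hr.1.le, hr.2⟩ hsr)
  have hMρ : 0 < M ρ := hMpos ρ ⟨hρ0, le_refl _⟩
  refine ⟨hMρ, ?_⟩
  have hG := extremalCdf_pos m hb hZ
  have hcpos : 0 < c := by rw [hc]; exact div_pos hG hMρ
  have hcM : c * M ρ = extremalCdf m b Z := by
    rw [hc]; exact div_mul_cancel₀ _ hMρ.ne'
  obtain ⟨H, hHc, hHm, hH0, hHZ, hHd⟩ := exists_extremal_quantile m hb hZ
  set Y : ℝ → ℝ := fun r => H (c * M r) with hY_def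
  have hYpos : ∀ r ∈ Set.Ioc 0 ρ, 0 < Y r := fun r hr => by
    have := hHm (mul_pos hcpos (hMpos r hr))
    rwa [hH0] at this
  have hYd : ∀ r ∈ Set.Ioo 0 ρ, HasDerivAt Y (c * φ r ^ ps * radDens m r * (1 + Y r ^ b) ^ (m + 1)) r := by
    intro r hr
    have h1 : c * M r ∈ Set.Ioc 0 (extremalCdf m b Z) :=
      ⟨mul_pos hcpos (hMpos r ⟨hr.1, hr.2.le⟩), by
        rw [← hcM]
        exact mul_le_mul_of_nonneg_left (hMmono ⟨hr.1.le, hr.2.le⟩ ⟨hρ0.le, le_refl _⟩ hr.2.le) hcpos.le⟩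
    have := (hHd _ h1).comp r ((hMd r (hsub ⟨hr.1.le, hr.2.le⟩)).const_mul c)
    have h2 : HasDerivAt Y _ r := this
    refine h2.congr_deriv ?_
    simp only [hf_def, hY_def]
    ring
  have hMcd : ContDiffOn ℝ 1 M (Set.Ioo (-1) 1) := by
    refine (contDiffOn_succ_iff_deriv_of_isOpen (n := 0) isOpen_Ioo).2 ⟨fun r hr =>
      (hMd r hr).differentiableAt.differentiableWithinAt, by simp, ?_⟩
    rw [contDiffOn_zero]
    exact hfc.congr fun r hr => (hMd r hr).deriv
  have hYcd : ContDiffOn ℝ 1 Y (Set.Ioo (-1) 1) := hHc.comp_contDiffOn (contDiffOn_const.mul hMcd)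
  have hYρ : Y ρ = Z := by simp only [hY_def, hcM, hHZ]
  have hY0 : Y 0 = 0 := by simp only [hY_def, hM0, mul_zero, hH0]
  have hYnn : ∀ r ∈ Set.Icc 0 ρ, 0 ≤ Y r := fun r hr => by
    rcases hr.1.eq_or_lt with h | h
    · rw [← h, hY0]
    · exact (hYpos r ⟨h, hr.2⟩).le
  set κ : ℝ := (m / (m + 1) * c ^ (1 / ((m : ℝ) + 1)) * (p / (p - 1))) ^ (1 - p) / p * α ^ p with hκ
  set R : ℝ → ℝ := fun r => φ r ^ α * (radVol m r ^ ((m : ℝ) / (m + 1)) * Y r ^ (1 / ((m : ℝ) + 1))) -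
    c ^ (1 / ((m : ℝ) + 1) - 1) * (m / (m + 1 - p) * (c * M r) -
      (p - 1) / (m + 1 - p) * (Y r * ((1 + Y r ^ b) ^ m)⁻¹)) with hR
  have key := integral_le_sub_of_le_deriv (R := R)
    (g := fun r => -(κ * (|deriv φ r| ^ p * radDens m r ^ (1 - p) * radVol m r ^ (m * p / (m + 1)))))
    hρ0 ?_ ?_ (hint.const_mul _).neg ?_
  · rw [intervalIntegral.integral_neg, intervalIntegral.integral_const_mul] at key
    have hRρ : R ρ = - (c ^ (1 / ((m : ℝ) + 1) - 1) * (m / (m + 1 - p) * extremalCdf m b Z -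
      (p - 1) / (m + 1 - p) * (Z * ((1 + Z ^ b) ^ m)⁻¹))) := by
      simp only [hR, hφρ, hcM, hYρ, Real.zero_rpow (by linarith : α ≠ 0)]
      ring
    have hR0 : R 0 = 0 := by
      simp only [hR, hM0, hY0, radVol_zero, Real.zero_rpow (by positivity : (m : ℝ) / (m + 1) ≠ 0)]
      ring
    rw [hRρ, hR0] at key
    linarith
  · have hYc : ContinuousOn Y (Set.Icc 0 ρ) := hYcd.continuousOn.mono hsub
    have hMc : ContinuousOn M (Set.Icc 0 ρ) := hMcd.continuousOn.mono hsub
    refine ((hφ.continuous.rpow_const fun _ => Or.inr (by linarith)).continuousOn.mul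
      ((((continuousOn_radVol m).mono hsub).rpow_const fun _ _ => Or.inr (by positivity)).mul
        (hYc.rpow_const fun _ _ => Or.inr (by positivity)))).sub
      (continuousOn_const.mul ((continuousOn_const.mul (continuousOn_const.mul hMc)).sub
        (continuousOn_const.mul (hYc.mul (ContinuousOn.inv₀ ((continuousOn_const.add
          (hYc.rpow_const fun _ _ => Or.inr hb.le)).pow m) ?_)))))
    intro r hr
    have := Real.rpow_nonneg (hYnn r hr) b
    positivity
  · intro ε hε
    have hu : Set.uIcc ε ρ ⊆ Set.Ioo (-1 : ℝ) 1 := by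
      rw [Set.uIcc_of_le hε.2.le]
      exact (Set.Icc_subset_Icc_left hε.1.le).trans hsub
    have hpos : ∀ r ∈ Set.uIcc ε ρ, r ∈ Set.Ioc 0 ρ := by
      rw [Set.uIcc_of_le hε.2.le]
      exact fun r hr => ⟨hε.1.trans_le hr.1, hr.2⟩
    have hYu := hYcd.mono hu
    refine ((hφ.absolutelyContinuousOnInterval_rpow h0 hα1 ε ρ).mul
      (ContDiffOn.absolutelyContinuousOnInterval ?_)).sub
      (ContDiffOn.absolutelyContinuousOnInterval ?_)
    · refine (((contDiffOn_radVol m).mono hu).rpow_const_of_ne fun r hr => ?_).mul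
        (hYu.rpow_const_of_ne fun r hr => (hYpos r (hpos r hr)).ne')
      exact (radVol_pos m (hpos r hr).1 (by linarith [(hpos r hr).2])).ne'
    · refine contDiffOn_const.mul ((contDiffOn_const.mul (contDiffOn_const.mul (hMcd.mono hu))).sub
        (contDiffOn_const.mul (hYu.mul (ContDiffOn.inv ((contDiffOn_const.add
          (hYu.rpow_const_of_ne fun r hr => (hYpos r (hpos r hr)).ne')).pow m) ?_))))
      intro r hr
      have := Real.rpow_nonneg (hYpos r (hpos r hr)).le b
      positivity
  · filter_upwards [hφ.ae_differentiableAt] with r hr hmem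
    have h1 : r < 1 := by linarith [hmem.2]
    have hd := radDens_pos m hmem.1 h1
    have hX := radVol_pos m hmem.1 h1
    have hYr := hYpos r ⟨hmem.1, hmem.2.le⟩
    have hV := Real.rpow_pos_of_pos hYr b
    have d1 := hr.hasDerivAt.rpow_const (p := α) (Or.inr hα1)
    have d2 := (hasDerivAt_radVol m ⟨by linarith [hmem.1], h1⟩).rpow_const
      (p := (m : ℝ) / (m + 1)) (Or.inl hX.ne')
    have d3 := (hYd r hmem).rpow_const (p := 1 / ((m : ℝ) + 1)) (Or.inl hYr.ne')
    have d4 := (hMd r (hsub ⟨hmem.1.le, hmem.2.le⟩)).const_mul c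
    have d5 := (hasDerivAt_extremal_boundary m (b := b) hYr).comp r (hYd r hmem)
    have dR := (d1.mul (d2.mul d3)).sub (((d4.const_mul (m / (m + 1 - p))).sub
      (d5.const_mul ((p - 1) / (m + 1 - p)))).const_mul (c ^ (1 / ((m : ℝ) + 1) - 1)))
    have dR' : HasDerivAt R _ r := dR
    rw [dR'.deriv]
    have hpt := bliss_pointwise (d := deriv φ r) hp1 hpn hm (h0 r) hX hd hYr hcpos
    refine hpt.trans (le_of_eq ?_)
    simp only [Pi.mul_apply, hf_def, ← hps_def, ← hb_def, ← hα_def]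
    have e : ((1 + Y r ^ b) ^ (m + 1))⁻¹ * (1 + Y r ^ b) ^ (m + 1) = 1 := inv_mul_cancel₀ (by positivity)
    linear_combination (-(c ^ (1 / ((m : ℝ) + 1) - 1)) * ((p - 1) / (m + 1 - p)) *
      (((1 + Y r ^ b) - m * b * Y r ^ b)) * (c * φ r ^ ps * radDens m r)) * e

lemma lintegral_inv_one_add_rpow_pow {m : ℕ} {b : ℝ} (hb : 0 < b) (hm : 1 / b < m + 1) :
    ∫⁻ t in Set.Ioi (0 : ℝ), ENNReal.ofReal ((1 + t ^ b) ^ (m + 1))⁻¹ =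
      ENNReal.ofReal (1 / b * ProbabilityTheory.beta (1 / b) (m + 1 - 1 / b)) := by
  have ha : 0 < 1 / b := by positivity
  have hβ : 0 < (m : ℝ) + 1 - 1 / b := by linarith
  have hB := ProbabilityTheory.beta_pos ha hβ
  set a := 1 / b with ha_def
  have key := ProbabilityTheory.lintegral_betaPDF_eq_one ha hβ
  rw [ProbabilityTheory.lintegral_betaPDF] at key
  set B := ProbabilityTheory.beta a (m + 1 - a)
  have hinv : ∀ z ∈ Set.Ioo (0 : ℝ) 1, ((z / (1 - z)) ^ a) ^ b = z / (1 - z) := by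
    intro z hz
    have : 0 < 1 - z := by linarith [hz.2]
    rw [← Real.rpow_mul (div_nonneg hz.1.le this.le), ha_def, one_div_mul_cancel hb.ne', Real.rpow_one]
  have himg : (fun z : ℝ => (z / (1 - z)) ^ a) '' Set.Ioo 0 1 = Set.Ioi 0 := by
    ext t
    constructor
    · rintro ⟨z, hz, rfl⟩
      have : 0 < 1 - z := by linarith [hz.2]
      exact Real.rpow_pos_of_pos (div_pos hz.1 this) _
    · intro ht
      have hV : 0 < t ^ b := Real.rpow_pos_of_pos ht b
      refine ⟨t ^ b / (1 + t ^ b), ⟨by positivity, by rw [div_lt_one] <;> linarith⟩, ?_⟩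
      have : t ^ b / (1 + t ^ b) / (1 - t ^ b / (1 + t ^ b)) = t ^ b := by field_simp; simp
      simp only [this]
      rw [← Real.rpow_mul (le_of_lt ht), ha_def, mul_one_div_cancel hb.ne', Real.rpow_one]
  have hinj : Set.InjOn (fun z : ℝ => (z / (1 - z)) ^ a) (Set.Ioo 0 1) := by
    intro x hx y hy hxy
    have h1 : 0 < 1 - x := by linarith [hx.2]
    have h2 : 0 < 1 - y := by linarith [hy.2]
    have := congrArg (· ^ b) hxy
    simp only [hinv x hx, hinv y hy] at this
    field_simp at this
    linarith
  have hder : ∀ z ∈ Set.Ioo (0 : ℝ) 1, HasDerivWithinAt (fun z : ℝ => (z / (1 - z)) ^ a)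
      (1 / (1 - z) ^ 2 * a * (z / (1 - z)) ^ (a - 1)) (Set.Ioo 0 1) z := by
    intro z hz
    have h1 : 0 < 1 - z := by linarith [hz.2]
    have hd : HasDerivAt (fun z : ℝ => z / (1 - z)) (1 / (1 - z) ^ 2) z := by
      refine ((hasDerivAt_id z).div ((hasDerivAt_id z).const_sub 1) h1.ne').congr_deriv ?_
      simp
    exact (hd.rpow_const (Or.inl (div_pos hz.1 h1).ne')).hasDerivWithinAt
  rw [← himg, lintegral_image_eq_lintegral_abs_deriv_mul measurableSet_Ioo hder hinj]
  rw [← mul_one (ENNReal.ofReal (a * B)), ← key, ← lintegral_const_mul' _ _ (by simp)]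
  refine setLIntegral_congr_fun measurableSet_Ioo fun z hz => ?_
  have h1 : 0 < 1 - z := by linarith [hz.2]
  have h0 := hz.1
  have hq : 0 < z / (1 - z) := div_pos h0 h1
  simp only [hinv z hz]
  rw [← ENNReal.ofReal_mul (abs_nonneg _), ← ENNReal.ofReal_mul (by positivity), abs_of_nonneg (by positivity)]
  congr 1
  have e1 : 1 + z / (1 - z) = (1 - z)⁻¹ := by field_simp; ring
  have e2 : (1 - z) ^ ((m : ℝ) + 1 - a - 1) = (1 - z) ^ (m + 1) / (1 - z) ^ (a - 1) / (1 - z) ^ 2 := by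
    rw [← Real.rpow_natCast, ← Real.rpow_natCast, ← Real.rpow_sub h1, ← Real.rpow_sub h1]
    congr 1
    push_cast
    ring
  rw [e1, e2, Real.div_rpow h0.le h1.le, inv_pow, inv_inv]
  field_simp

lemma tendsto_extremalCdf {m : ℕ} {b : ℝ} (hb : 0 < b) (hm : 1 / b < m + 1) :
    Filter.Tendsto (extremalCdf m b) Filter.atTop
      (nhds (Real.Gamma (1 / b + 1) * Real.Gamma (m + 1 - 1 / b) / Real.Gamma (m + 1))) := by
  have hl := lintegral_inv_one_add_rpow_pow hb hm
  have hβ : 0 < (m : ℝ) + 1 - 1 / b := by linarith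
  have hB := ProbabilityTheory.beta_pos (one_div_pos.2 hb) hβ
  have hmeas : Measurable fun t : ℝ => ((1 + t ^ b) ^ (m + 1))⁻¹ := by fun_prop
  have hnn : ∀ t ∈ Set.Ioi (0 : ℝ), 0 ≤ ((1 + t ^ b) ^ (m + 1))⁻¹ := fun t ht => by
    have := Real.rpow_nonneg (le_of_lt ht) b
    positivity
  have hnn' := ae_restrict_of_forall_mem (μ := volume) measurableSet_Ioi hnn
  have hint : IntegrableOn (fun t : ℝ => ((1 + t ^ b) ^ (m + 1))⁻¹) (Set.Ioi 0) := by
    refine ⟨hmeas.aestronglyMeasurable, ?_⟩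
    rw [hasFiniteIntegral_iff_ofReal hnn', hl]
    exact ENNReal.ofReal_lt_top
  have hval : ∫ t in Set.Ioi (0 : ℝ), ((1 + t ^ b) ^ (m + 1))⁻¹ =
      Real.Gamma (1 / b + 1) * Real.Gamma (m + 1 - 1 / b) / Real.Gamma (m + 1) := by
    rw [integral_eq_lintegral_of_nonneg_ae hnn' hmeas.aestronglyMeasurable, hl,
      ENNReal.toReal_ofReal (by positivity), ProbabilityTheory.beta, Real.Gamma_add_one (by positivity)]
    rw [show 1 / b + ((m : ℝ) + 1 - 1 / b) = m + 1 by ring]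
    ring
  rw [← hval]
  exact intervalIntegral_tendsto_integral_Ioi 0 hint Filter.tendsto_id

lemma tendsto_extremal_boundary {m : ℕ} {b : ℝ} (hm : 1 < b * m) :
    Filter.Tendsto (fun Z : ℝ => Z * ((1 + Z ^ b) ^ m)⁻¹) Filter.atTop (nhds 0) := by
  have h := tendsto_rpow_neg_atTop (y := b * m - 1) (by linarith)
  refine squeeze_zero' ?_ ?_ h
  · filter_upwards [Filter.eventually_gt_atTop 0] with Z hZ
    positivity
  · filter_upwards [Filter.eventually_gt_atTop 0] with Z hZ
    have e : Z ^ (-(b * m - 1)) = Z * ((Z ^ b) ^ m)⁻¹ := by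
      rw [neg_sub, Real.rpow_sub hZ, Real.rpow_one, Real.rpow_mul hZ.le, Real.rpow_natCast]
      rfl
    rw [e]
    gcongr
    linarith

lemma unitBallVol_pos (n : ℕ) : 0 < unitBallVol n :=
  div_pos (by positivity) (Real.Gamma_pos_of_pos (by positivity))

lemma radial_bliss {m : ℕ} (hm : 1 ≤ m) {p ρ : ℝ} (hp1 : 1 < p) (hpn : p < m + 1)
    (hρ0 : 0 < ρ) (hρ1 : ρ < 1) {φ : ℝ → ℝ} {K : NNReal} (hφ : LipschitzWith K φ)
    (h0 : ∀ r, 0 ≤ φ r) (hφ0 : 0 < φ 0) (hφρ : φ ρ = 0)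
    (hint : IntervalIntegrable (fun r => |deriv φ r| ^ p * radDens m r ^ (1 - p) *
      radVol m r ^ (m * p / (m + 1))) volume 0 ρ) :
    ((m + 1) * (p - 1) / (m + 1 - p)) ^ (-(p - 1)) *
      (Real.Gamma ((m : ℝ) + 1 + 1 - (m + 1) / p) * Real.Gamma ((m + 1) / p) /
        Real.Gamma (m + 1)) ^ (p / (m + 1)) *
      (∫ r in (0 : ℝ)..ρ, φ r ^ ((m + 1) * p / (m + 1 - p)) * radDens m r) ^ ((m + 1 - p) / (m + 1)) ≤
    ∫ r in (0 : ℝ)..ρ, |deriv φ r| ^ p * radDens m r ^ (1 - p) *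
          radVol m r ^ (m * p / (m + 1)) := by
  have hm' : (0 : ℝ) < m := by exact_mod_cast hm
  have hn : (0 : ℝ) < m + 1 := by positivity
  have hp0 : 0 < p := by linarith
  have hp1' : 0 < p - 1 := by linarith
  have hnp : 0 < (m : ℝ) + 1 - p := by linarith
  have hM := (bliss_of_quantile hm hp1 hpn hρ0 hρ1 one_pos hφ h0 hφ0 hφρ hint rfl).1
  set b := p / ((p - 1) * ((m : ℝ) + 1)) with hb_def
  have hb : 0 < b := by positivity
  have hb1 : 1 / b = (m : ℝ) + 1 - (m + 1) / p := by rw [hb_def]; field_simp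
  have hbn : 1 / b < m + 1 := by rw [hb1]; linarith [div_pos hn hp0]
  have hbm : 1 < b * m := by
    rw [hb_def, div_mul_eq_mul_div, one_lt_div (by positivity)]
    nlinarith
  set M := ∫ r in (0 : ℝ)..ρ, φ r ^ ((m + 1) * p / (m + 1 - p)) * radDens m r
  set E := ∫ r in (0 : ℝ)..ρ, |deriv φ r| ^ p * radDens m r ^ (1 - p) *
          radVol m r ^ (m * p / (m + 1))
  set G := Real.Gamma ((m : ℝ) + 1 + 1 - (m + 1) / p) * Real.Gamma ((m + 1) / p) /
        Real.Gamma (m + 1) with hG_def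
  have hG : 0 < G := by
    refine div_pos (mul_pos (Real.Gamma_pos_of_pos ?_) (Real.Gamma_pos_of_pos (by positivity)))
      (Real.Gamma_pos_of_pos hn)
    have : 0 < 1 / b := by positivity
    linarith
  have hT : Filter.Tendsto (extremalCdf m b) Filter.atTop (nhds G) := by
    have := tendsto_extremalCdf hb hbn
    rwa [hb1, show (m : ℝ) + 1 - (m + 1) / p + 1 = m + 1 + 1 - (m + 1) / p by ring,
      show (m : ℝ) + 1 - (m + 1 - (m + 1) / p) = (m + 1) / p by ring] at this
  have hTc : Filter.Tendsto (fun Z => extremalCdf m b Z / M) Filter.atTop (nhds (G / M)) :=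
    hT.div_const M
  have hc : 0 < G / M := div_pos hG hM
  have hlim := le_of_tendsto_of_tendsto
    ((hTc.rpow_const (p := 1 / ((m : ℝ) + 1) - 1) (Or.inl hc.ne')).mul
      ((hT.const_mul (m / (m + 1 - p) : ℝ)).sub
        ((tendsto_extremal_boundary hbm).const_mul ((p - 1) / (m + 1 - p) : ℝ))))
    ((((((hTc.rpow_const (p := 1 / ((m : ℝ) + 1)) (Or.inl hc.ne')).const_mul (m / (m + 1) : ℝ)).mul_const
      (p / (p - 1))).rpow_const (p := 1 - p) (Or.inl (by positivity))).div_const p).mul_const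
        ((p * m / (m + 1 - p)) ^ p) |>.mul_const E)
    (by
      filter_upwards [Filter.eventually_gt_atTop 0] with Z hZ
      exact (bliss_of_quantile hm hp1 hpn hρ0 hρ1 hZ hφ h0 hφ0 hφρ hint rfl).2)
  rw [mul_zero, sub_zero] at hlim
  have eα : (p * m / (m + 1 - p) : ℝ) ^ p =
      (p * m / (m + 1 - p)) ^ (p - 1) * (p * m / (m + 1 - p)) := by
    rw [Real.rpow_sub_one (by positivity)]
    field_simp
  have hc1 : (G / M) ^ (1 / ((m : ℝ) + 1) - 1) * G =
      (G / M) ^ (1 / ((m : ℝ) + 1) * (1 - p)) * (G ^ (p / (m + 1)) * M ^ ((m + 1 - p) / (m + 1))) := by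
    have e1 : (1 / ((m : ℝ) + 1) - 1) = 1 / ((m : ℝ) + 1) * (1 - p) - ((m + 1 - p) / (m + 1)) := by
      field_simp
      ring
    have e2 : G = G ^ (p / (m + 1)) * G ^ ((m + 1 - p) / (m + 1)) := by
      rw [← Real.rpow_add hG, ← add_div, show p + ((m : ℝ) + 1 - p) = m + 1 by ring, div_self hn.ne',
        Real.rpow_one]
    rw [e1, Real.rpow_sub hc, Real.div_rpow hG.le hM.le (_ / _)]
    nth_rewrite 3 [e2]
    have := Real.rpow_pos_of_pos hM ((m + 1 - p) / (m + 1))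
    have := Real.rpow_pos_of_pos hG ((m + 1 - p) / (m + 1))
    field_simp
  have ec : ((m : ℝ) / (m + 1) * (G / M) ^ (1 / ((m : ℝ) + 1)) * (p / (p - 1))) ^ (1 - p) =
      (G / M) ^ (1 / ((m : ℝ) + 1) * (1 - p)) * (m / (m + 1) * (p / (p - 1))) ^ (1 - p) := by
    rw [mul_right_comm, Real.mul_rpow (by positivity) (by positivity), ← Real.rpow_mul hc.le, mul_comm]
  have ek : ((m : ℝ) / (m + 1) * (p / (p - 1))) ^ (1 - p) * (p * m / (m + 1 - p)) ^ (p - 1) =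
      ((m + 1) * (p - 1) / (m + 1 - p)) ^ (p - 1) := by
    rw [show 1 - p = -(p - 1) by ring, Real.rpow_neg (by positivity), ← Real.inv_rpow (by positivity),
      ← Real.mul_rpow (by positivity) (by positivity)]
    congr 1
    field_simp
  rw [Real.rpow_neg (by positivity), ← ek]
  rw [ec, eα] at hlim
  have hA := Real.rpow_pos_of_pos hc (1 / ((m : ℝ) + 1) * (1 - p))
  set A := (G / M) ^ (1 / ((m : ℝ) + 1) * (1 - p))
  have hk : 0 < ((m : ℝ) / (m + 1) * (p / (p - 1))) ^ (1 - p) * (p * m / (m + 1 - p)) ^ (p - 1) := by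
    positivity
  rw [mul_assoc, inv_mul_le_iff₀ hk]
  have hq : 0 < (m : ℝ) / (m + 1 - p) := by positivity
  refine le_of_mul_le_mul_left ?_ (mul_pos hA hq)
  calc A * (m / (m + 1 - p)) * (G ^ (p / ((m : ℝ) + 1)) * M ^ ((m + 1 - p) / ((m : ℝ) + 1)))
      = (G / M) ^ (1 / ((m : ℝ) + 1) - 1) * (m / (m + 1 - p) * G) := by linear_combination (-(m / (m + 1 - p)) : ℝ) * hc1
    _ ≤ _ := hlim
    _ = _ := by field_simp

lemma sobolevConst_rpow {m : ℕ} {p : ℝ} (hp1 : 1 < p) (hpn : p < m + 1) :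
    sobolevConst (m + 1) p ^ p = (m + 1) ^ p * (((m + 1) * (p - 1) / (m + 1 - p)) ^ (-(p - 1)) *
      (Real.Gamma ((m : ℝ) + 1 + 1 - (m + 1) / p) * Real.Gamma ((m + 1) / p) /
        Real.Gamma (m + 1)) ^ (p / (m + 1))) * unitBallVol (m + 1) ^ (p / (m + 1)) := by
  have hn : (0 : ℝ) < m + 1 := by positivity
  have hp0 : 0 < p := by linarith
  have hp1' : 0 < p - 1 := by linarith
  have hnp : 0 < (m : ℝ) + 1 - p := by linarith
  have hσ := unitBallVol_pos (m + 1)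
  have g1 := Real.Gamma_pos_of_pos hn
  have g2 := Real.Gamma_pos_of_pos (div_pos hn hp0)
  have g3 : 0 < Real.Gamma ((m : ℝ) + 1 + 1 - (m + 1) / p) := by
    refine Real.Gamma_pos_of_pos ?_
    have : ((m : ℝ) + 1) / p ≤ m + 1 := div_le_self hn.le hp1.le
    linarith
  unfold sobolevConst
  push_cast
  set A := ((m : ℝ) + 1) * (p - 1) / (m + 1 - p)
  have hA : 0 < A := by positivity
  set g := Real.Gamma ((m : ℝ) + 1 + 1 - (m + 1) / p)
  set h := Real.Gamma (((m : ℝ) + 1) / p)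
  set k := Real.Gamma ((m : ℝ) + 1)
  have e : (k / (h * g * unitBallVol (m + 1)))⁻¹ = g * h / k * unitBallVol (m + 1) := by
    field_simp
  rw [mul_inv, mul_inv, ← Real.inv_rpow (by positivity) (1 / ((m : ℝ) + 1)), e,
    Real.mul_rpow (by positivity) (by positivity), Real.mul_rpow (by positivity) (by positivity),
    ← Real.rpow_neg hA.le, ← Real.rpow_mul hA.le, ← Real.rpow_mul (by positivity), one_div_mul_eq_div,
    Real.mul_rpow (by positivity) hσ.le, one_div ((m : ℝ) + 1), inv_inv,
    show -(1 - 1 / p) * p = -(p - 1) by field_simp]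
  ring

lemma radial_poincareSobolev_strict {m : ℕ} (hm : 1 ≤ m) {p ρ : ℝ} (hp : 2 * ((m : ℝ) + 1) / m ≤ p)
    (hpn : p < m + 1) (hρ0 : 0 < ρ) (hρ1 : ρ < 1) {φ : ℝ → ℝ} {K : NNReal} (hφ : LipschitzWith K φ)
    (h0 : ∀ r, 0 ≤ φ r) (hφ0 : 0 < φ 0) (hφρ : φ ρ = 0) :
    sobolevConst (m + 1) p ^ p * (unitBallVol (m + 1) *
      ∫ r in (0 : ℝ)..ρ, φ r ^ ((m + 1) * p / (m + 1 - p)) * radDens m r) ^ ((m + 1 - p) / (m + 1)) +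
      (m / p) ^ p * (unitBallVol (m + 1) * ∫ r in (0 : ℝ)..ρ, φ r ^ p * radDens m r) <
    unitBallVol (m + 1) * (m + 1) ^ p *
      ∫ r in (0 : ℝ)..ρ, |deriv φ r| ^ p * radDens m r ^ (1 - p) * hypSinh r ^ (m * p) := by
  have hm' : (0 : ℝ) < m := by exact_mod_cast hm
  have hn : (0 : ℝ) < m + 1 := by positivity
  have hp1 : 1 < p := by
    refine lt_of_lt_of_le ?_ hp
    rw [lt_div_iff₀ hm']
    linarith
  have hp0 : 0 < p := by linarith
  have hnp : 0 < (m : ℝ) + 1 - p := by linarith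
  have hσ := unitBallVol_pos (m + 1)
  have hlt : ∀ r ∈ Set.Ioo 0 ρ, radVol m r ^ (m * p / (m + 1)) + (m / (m + 1)) ^ p * radVol m r ^ p <
      hypSinh r ^ (m * p) := fun r hr => radVol_rpow_add_lt hm hp hr.1 (hr.2.trans hρ1)
  have hXnn : ∀ r ∈ Set.Ioo 0 ρ, 0 < radVol m r := fun r hr => radVol_pos m hr.1 (hr.2.trans hρ1)
  have hI1 := intervalIntegrable_radial_energy hm hp1 hρ0 hρ1 hφ
  have hI2 := intervalIntegrable_radial_weight (q := m * p / (m + 1)) hm hp1 hρ0 hρ1 hφ one_pos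
    fun r hr => by
      have := hlt r hr
      have := Real.rpow_pos_of_pos (hXnn r hr) p
      have : 0 < ((m : ℝ) / (m + 1)) ^ p := by positivity
      nlinarith
  have hI3 := intervalIntegrable_radial_weight (q := p) (c := ((m : ℝ) / (m + 1)) ^ p) hm hp1 hρ0 hρ1 hφ
    (by positivity) fun r hr => by
      have := hlt r hr
      have := Real.rpow_pos_of_pos (hXnn r hr) ((m : ℝ) * p / (m + 1))
      linarith
  have hbliss := radial_bliss hm hp1 hpn hρ0 hρ1 hφ h0 hφ0 hφρ hI2
  have hhardy := radial_hardy hp1 hρ0 hρ1 hφ h0 hφρ hI3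
  set M := ∫ r in (0 : ℝ)..ρ, φ r ^ ((m + 1) * p / (m + 1 - p)) * radDens m r
  set E2 := ∫ r in (0 : ℝ)..ρ, |deriv φ r| ^ p * radDens m r ^ (1 - p) * radVol m r ^ (m * p / (m + 1))
  have hM : 0 ≤ M := intervalIntegral.integral_nonneg hρ0.le fun r hr =>
    mul_nonneg (Real.rpow_nonneg (h0 r) _) (radDens_nonneg m hr.1 (by linarith [hr.2]))
  have hstrict : E2 + (m / (m + 1)) ^ p * (∫ r in (0 : ℝ)..ρ, |deriv φ r| ^ p * radDens m r ^ (1 - p) *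
      radVol m r ^ p) < ∫ r in (0 : ℝ)..ρ, |deriv φ r| ^ p * radDens m r ^ (1 - p) * hypSinh r ^ (m * p) := by
    rw [← intervalIntegral.integral_const_mul, ← intervalIntegral.integral_add hI2 (hI3.const_mul _)]
    refine intervalIntegral.integral_lt_integral_of_ae_le_of_measure_setOfPred_lt_ne_zero hρ0.le
      (hI2.add (hI3.const_mul _)) hI1 ?_ ?_
    · rw [← restrict_Ioo_eq_restrict_Ioc]
      refine ae_restrict_of_forall_mem measurableSet_Ioo fun r hr => ?_
      have h1 : 0 ≤ |deriv φ r| ^ p * radDens m r ^ (1 - p) :=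
        mul_nonneg (by positivity) (Real.rpow_nonneg (radDens_nonneg m hr.1.le (hr.2.trans hρ1)) _)
      nlinarith [mul_le_mul_of_nonneg_left (hlt r hr).le h1]
    · intro hzero
      have hd : ∀ᵐ r ∂volume.restrict (Set.Ioc 0 ρ), deriv φ r = 0 := by
        rw [← restrict_Ioo_eq_restrict_Ioc] at hzero ⊢
        filter_upwards [ae_restrict_mem measurableSet_Ioo, measure_eq_zero_iff_ae_notMem.1 hzero] with r hr hnot
        by_contra hne
        have h1 : 0 < |deriv φ r| ^ p * radDens m r ^ (1 - p) :=
          mul_pos (Real.rpow_pos_of_pos (abs_pos.2 hne) _)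
            (Real.rpow_pos_of_pos (radDens_pos m hr.1 (hr.2.trans hρ1)) _)
        have := mul_lt_mul_of_pos_left (hlt r hr) h1
        refine hnot (?_ : _ < _)
        linarith
      have hac : AbsolutelyContinuousOnInterval φ 0 ρ :=
        (hφ.lipschitzOnWith (s := Set.uIcc 0 ρ)).absolutelyContinuousOnInterval
      have hFTC := hac.integral_deriv_eq_sub
      rw [intervalIntegral.integral_of_le hρ0.le, integral_congr_ae hd, integral_zero, hφρ] at hFTC
      linarith
  have hfac : (m / (m + 1) : ℝ) ^ p = (m / p) ^ p * p ^ p * (((m : ℝ) + 1) ^ p)⁻¹ := by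
    rw [Real.div_rpow hm'.le hn.le, Real.div_rpow hm'.le hp0.le]
    field_simp
  rw [sobolevConst_rpow hp1 hpn, Real.mul_rpow hσ.le hM]
  have eσ : unitBallVol (m + 1) = unitBallVol (m + 1) ^ (p / ((m : ℝ) + 1)) *
      unitBallVol (m + 1) ^ (((m : ℝ) + 1 - p) / (m + 1)) := by
    rw [← Real.rpow_add hσ, ← add_div, show p + ((m : ℝ) + 1 - p) = m + 1 by ring, div_self hn.ne',
      Real.rpow_one]
  have hnpp : 0 < ((m : ℝ) + 1) ^ p := by positivity
  have hmpp : 0 < ((m : ℝ) / p) ^ p := by positivity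
  rw [hfac] at hstrict
  set C := (((m : ℝ) + 1) * (p - 1) / (m + 1 - p)) ^ (-(p - 1)) *
      (Real.Gamma ((m : ℝ) + 1 + 1 - (m + 1) / p) * Real.Gamma ((m + 1) / p) /
        Real.Gamma (m + 1)) ^ (p / ((m : ℝ) + 1))
  set Q := ∫ r in (0 : ℝ)..ρ, |deriv φ r| ^ p * radDens m r ^ (1 - p) * radVol m r ^ p
  set E1 := ∫ r in (0 : ℝ)..ρ, |deriv φ r| ^ p * radDens m r ^ (1 - p) * hypSinh r ^ (m * p)
  set H := ∫ r in (0 : ℝ)..ρ, φ r ^ p * radDens m r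
  calc _ = (unitBallVol (m + 1) * (m + 1) ^ p) * (C * M ^ (((m : ℝ) + 1 - p) / (m + 1))) +
        unitBallVol (m + 1) * (m / p) ^ p * H := by
        nth_rewrite 4 [eσ]
        ring
    _ ≤ (unitBallVol (m + 1) * (m + 1) ^ p) * E2 + unitBallVol (m + 1) * (m / p) ^ p * (p ^ p * Q) := by
        gcongr
    _ = (unitBallVol (m + 1) * (m + 1) ^ p) * (E2 + (m / p) ^ p * p ^ p * (((m : ℝ) + 1) ^ p)⁻¹ * Q) := by
        field_simp
    _ < _ := by gcongr

/-- The conformal-invariant pseudo-distance `sinh² (d(x,y)/2)` of the Poincaré ball. -/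
noncomputable def hypDelta {E : Type*} [NormedAddCommGroup E] (x y : E) : ℝ :=
  ‖x - y‖ ^ 2 / ((1 - ‖x‖ ^ 2) * (1 - ‖y‖ ^ 2))

/-- The hyperbolic reflection of the Poincaré ball in the sphere centred at `a` and orthogonal to
the unit sphere. -/
noncomputable def hypRefl {E : Type*} [NormedAddCommGroup E] [InnerProductSpace ℝ E] (a x : E) : E :=
  EuclideanGeometry.inversion a (√(‖a‖ ^ 2 - 1)) x

section Reflection

variable {E : Type*} [NormedAddCommGroup E] {a x y : E}

lemma sqrt_normSq_sub_one_pos (ha : 1 < ‖a‖) : 0 < √(‖a‖ ^ 2 - 1) :=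
  Real.sqrt_pos.2 (by nlinarith)

lemma norm_sub_pos_of_mem_ball (ha : 1 < ‖a‖) (hx : ‖x‖ < 1) : 0 < ‖x - a‖ := by
  rw [norm_pos_iff, sub_ne_zero]
  rintro rfl
  linarith

lemma one_sub_normSq_pos (hx : ‖x‖ < 1) : 0 < 1 - ‖x‖ ^ 2 := by nlinarith [norm_nonneg x]

lemma hypDelta_comm (x y : E) : hypDelta x y = hypDelta y x := by
  rw [hypDelta, hypDelta, norm_sub_rev, mul_comm (1 - ‖x‖ ^ 2)]

variable [InnerProductSpace ℝ E]

lemma hypRefl_hypRefl (ha : 1 < ‖a‖) (x : E) : hypRefl a (hypRefl a x) = x :=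
  EuclideanGeometry.inversion_inversion a (sqrt_normSq_sub_one_pos ha).ne' x

lemma hypRefl_injective (ha : 1 < ‖a‖) : Function.Injective (hypRefl a) :=
  EuclideanGeometry.inversion_injective a (sqrt_normSq_sub_one_pos ha).ne'

lemma hypRefl_eq (ha : 1 < ‖a‖) (x : E) :
    hypRefl a x = ((‖a‖ ^ 2 - 1) / ‖x - a‖ ^ 2) • (x - a) + a := by
  simp only [hypRefl, EuclideanGeometry.inversion, dist_eq_norm, div_pow, vsub_eq_sub, vadd_eq_add]
  rw [Real.sq_sqrt (by nlinarith)]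

lemma normSq_sub_center (a x : E) : ‖x - a‖ ^ 2 = ‖x‖ ^ 2 - 2 * inner ℝ x a + ‖a‖ ^ 2 :=
  norm_sub_sq_real x a

lemma one_sub_normSq_hypRefl (ha : 1 < ‖a‖) (hx : ‖x‖ < 1) :
    1 - ‖hypRefl a x‖ ^ 2 = (1 - ‖x‖ ^ 2) * ((‖a‖ ^ 2 - 1) / ‖x - a‖ ^ 2) := by
  have hq := norm_sub_pos_of_mem_ball ha hx
  have h1 := normSq_sub_center a x
  rw [hypRefl_eq ha, norm_add_sq_real, norm_smul, mul_pow, Real.norm_eq_abs, sq_abs, inner_smul_left,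
    inner_sub_left, real_inner_self_eq_norm_sq]
  simp only [conj_trivial]
  have h2 : inner ℝ x a = (‖x‖ ^ 2 + ‖a‖ ^ 2 - ‖x - a‖ ^ 2) / 2 := by linarith
  rw [h2]
  field_simp
  ring

lemma norm_hypRefl_lt_one (ha : 1 < ‖a‖) (hx : ‖x‖ < 1) : ‖hypRefl a x‖ < 1 := by
  have h := one_sub_normSq_hypRefl ha hx
  have : 0 < (1 - ‖x‖ ^ 2) * ((‖a‖ ^ 2 - 1) / ‖x - a‖ ^ 2) :=
    mul_pos (one_sub_normSq_pos hx) (div_pos (by nlinarith)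
      (pow_pos (norm_sub_pos_of_mem_ball ha hx) 2))
  nlinarith [norm_nonneg (hypRefl a x)]

lemma norm_sub_hypRefl_sq (ha : 1 < ‖a‖) (hx : ‖x‖ < 1) (hy : ‖y‖ < 1) :
    ‖hypRefl a x - hypRefl a y‖ ^ 2 =
      (‖a‖ ^ 2 - 1) ^ 2 / (‖x - a‖ ^ 2 * ‖y - a‖ ^ 2) * ‖x - y‖ ^ 2 := by
  have h := EuclideanGeometry.dist_inversion_inversion (x := x) (y := y) (c := a)
    (sub_ne_zero.1 (norm_pos_iff.1 (norm_sub_pos_of_mem_ball ha hx)))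
    (sub_ne_zero.1 (norm_pos_iff.1 (norm_sub_pos_of_mem_ball ha hy))) (√(‖a‖ ^ 2 - 1))
  rw [Real.sq_sqrt (by nlinarith)] at h
  simp only [dist_eq_norm] at h
  rw [hypRefl, hypRefl, h, mul_pow, div_pow, mul_pow]

lemma hypDelta_hypRefl_hypRefl (ha : 1 < ‖a‖) (hx : ‖x‖ < 1) (hy : ‖y‖ < 1) :
    hypDelta (hypRefl a x) (hypRefl a y) = hypDelta x y := by
  have h1 := norm_sub_pos_of_mem_ball ha hx
  have h2 := norm_sub_pos_of_mem_ball ha hy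
  have h3 := one_sub_normSq_pos hx
  have h4 := one_sub_normSq_pos hy
  have h5 : 0 < ‖a‖ ^ 2 - 1 := by nlinarith
  rw [hypDelta, norm_sub_hypRefl_sq ha hx hy, one_sub_normSq_hypRefl ha hx,
    one_sub_normSq_hypRefl ha hy, hypDelta]
  field_simp

lemma hypDelta_hypRefl_left (ha : 1 < ‖a‖) (hx : ‖x‖ < 1) (hy : ‖y‖ < 1) :
    hypDelta (hypRefl a x) y = hypDelta x (hypRefl a y) := by
  rw [← hypDelta_hypRefl_hypRefl ha hx (norm_hypRefl_lt_one ha hy), hypRefl_hypRefl ha]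

lemma hypDelta_le_hypRefl (ha : 1 < ‖a‖) (hx : ‖x‖ < 1) (hy : ‖y‖ < 1)
    (hxa : ‖a‖ ^ 2 - 1 ≤ ‖x - a‖ ^ 2) (hya : ‖a‖ ^ 2 - 1 ≤ ‖y - a‖ ^ 2) :
    hypDelta x y ≤ hypDelta (hypRefl a x) y := by
  have h1 := norm_sub_pos_of_mem_ball ha hx
  have h3 := one_sub_normSq_pos hx
  have h4 := one_sub_normSq_pos hy
  have h5 : 0 < ‖a‖ ^ 2 - 1 := by nlinarith
  rw [hypDelta, hypDelta, one_sub_normSq_hypRefl ha hx]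
  have e : ‖hypRefl a x - y‖ ^ 2 / ((1 - ‖x‖ ^ 2) * ((‖a‖ ^ 2 - 1) / ‖x - a‖ ^ 2) * (1 - ‖y‖ ^ 2)) =
      (‖hypRefl a x - y‖ ^ 2 * ‖x - a‖ ^ 2 / (‖a‖ ^ 2 - 1)) / ((1 - ‖x‖ ^ 2) * (1 - ‖y‖ ^ 2)) := by
    field_simp
  rw [e]
  refine div_le_div_of_nonneg_right ?_ (mul_pos h3 h4).le
  have e1 : hypRefl a x - y = ((‖a‖ ^ 2 - 1) / ‖x - a‖ ^ 2) • (x - a) - (y - a) := by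
    rw [hypRefl_eq ha]; abel
  have e2 : x - y = (x - a) - (y - a) := by abel
  rw [e1, e2, norm_sub_sq_real (x - a), norm_sub_sq_real (_ • _), norm_smul, mul_pow, Real.norm_eq_abs, sq_abs,
    inner_smul_left]
  simp only [conj_trivial]
  generalize inner ℝ (x - a) (y - a) = I
  rw [le_div_iff₀ h5]
  have : (((‖a‖ ^ 2 - 1) / ‖x - a‖ ^ 2) ^ 2 * ‖x - a‖ ^ 2 - 2 * ((‖a‖ ^ 2 - 1) / ‖x - a‖ ^ 2 * I) +
      ‖y - a‖ ^ 2) * ‖x - a‖ ^ 2 = (‖a‖ ^ 2 - 1) ^ 2 - 2 * ((‖a‖ ^ 2 - 1) * I) + ‖y - a‖ ^ 2 * ‖x - a‖ ^ 2 := by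
    field_simp
  rw [this]
  nlinarith [mul_nonneg (sub_nonneg.2 hxa) (sub_nonneg.2 hya)]

lemma norm_le_norm_hypRefl (ha : 1 < ‖a‖) (hx : ‖x‖ < 1) (hxa : ‖a‖ ^ 2 - 1 ≤ ‖x - a‖ ^ 2) :
    ‖x‖ ≤ ‖hypRefl a x‖ := by
  have h := one_sub_normSq_hypRefl ha hx
  have h1 := norm_sub_pos_of_mem_ball ha hx
  have h2 : (‖a‖ ^ 2 - 1) / ‖x - a‖ ^ 2 ≤ 1 := (div_le_one (by positivity)).2 hxa
  have := mul_le_mul_of_nonneg_left h2 (one_sub_normSq_pos hx).le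
  exact (sq_le_sq₀ (norm_nonneg _) (norm_nonneg _)).1 (by linarith)

lemma lt_normSq_sub_of_norm_lt_norm_hypRefl (ha : 1 < ‖a‖) (hx : ‖x‖ < 1)
    (h : ‖x‖ < ‖hypRefl a x‖) : ‖a‖ ^ 2 - 1 < ‖x - a‖ ^ 2 := by
  have h0 := one_sub_normSq_hypRefl ha hx
  have h1 := norm_sub_pos_of_mem_ball ha hx
  have h2 := one_sub_normSq_pos hx
  by_contra! hcon
  have h3 : 1 ≤ (‖a‖ ^ 2 - 1) / ‖x - a‖ ^ 2 := (one_le_div (by positivity)).2 hcon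
  have := mul_le_mul_of_nonneg_left h3 h2.le
  nlinarith [norm_nonneg x]

lemma normSq_hypRefl_sub_center (ha : 1 < ‖a‖) (hx : ‖x‖ < 1) :
    ‖hypRefl a x - a‖ ^ 2 = (‖a‖ ^ 2 - 1) ^ 2 / ‖x - a‖ ^ 2 := by
  have h1 := norm_sub_pos_of_mem_ball ha hx
  rw [hypRefl_eq ha, add_sub_cancel_right, norm_smul, mul_pow, Real.norm_eq_abs, sq_abs]
  field_simp

/-- Two points at different distances to the origin are exchanged by some reflection. -/
lemma exists_hypRefl_eq (hxy : ‖x‖ < ‖y‖) (hy : ‖y‖ < 1) : ∃ a : E, 1 < ‖a‖ ∧ hypRefl a x = y := by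
  have hx : ‖x‖ < 1 := hxy.trans hy
  have h3 := one_sub_normSq_pos hx
  have h4 := one_sub_normSq_pos hy
  set t := (1 - ‖y‖ ^ 2) / (1 - ‖x‖ ^ 2) with ht
  have ht0 : 0 < t := div_pos h4 h3
  have ht1 : t < 1 := by rw [ht, div_lt_one h3]; nlinarith [norm_nonneg x]
  have ht1' : 0 < 1 - t := by linarith
  have htx : t * (1 - ‖x‖ ^ 2) = 1 - ‖y‖ ^ 2 := div_mul_cancel₀ _ h3.ne'
  clear_value t
  set a : E := (1 - t)⁻¹ • (y - t • x) with ha_def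
  have e1 : x - a = (1 - t)⁻¹ • (x - y) := by
    have : x = (1 - t)⁻¹ • ((1 - t) • x) := by rw [smul_smul, inv_mul_cancel₀ ht1'.ne', one_smul]
    conv_lhs => rw [this]
    rw [ha_def, ← smul_sub]
    congr 1
    module
  have e2 : y - a = t • (x - a) := by
    have : y = (1 - t)⁻¹ • ((1 - t) • y) := by rw [smul_smul, inv_mul_cancel₀ ht1'.ne', one_smul]
    rw [e1]
    conv_lhs => rw [this]
    rw [ha_def, ← smul_sub, smul_comm]
    congr 1
    module
  have hxy' : 0 < ‖x - y‖ := by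
    rw [norm_pos_iff, sub_ne_zero]
    rintro rfl
    exact lt_irrefl _ hxy
  have hq : ‖x - a‖ ^ 2 = ((1 - t) ^ 2)⁻¹ * ‖x - y‖ ^ 2 := by
    rw [e1, norm_smul, mul_pow, Real.norm_eq_abs, sq_abs, inv_pow]
  have hR : ‖a‖ ^ 2 - 1 = t * ‖x - a‖ ^ 2 := by
    have : ‖a‖ ^ 2 = ((1 - t) ^ 2)⁻¹ * (‖y‖ ^ 2 - 2 * (t * inner ℝ x y) + t ^ 2 * ‖x‖ ^ 2) := by
      rw [ha_def, norm_smul, mul_pow, Real.norm_eq_abs, sq_abs, inv_pow, norm_sub_sq_real, norm_smul,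
        mul_pow, Real.norm_eq_abs, sq_abs, inner_smul_right, real_inner_comm]
    rw [hq, this, norm_sub_sq_real]
    field_simp
    linear_combination (1 - t) * htx
  have hqpos : 0 < ‖x - a‖ ^ 2 := by rw [hq]; positivity
  have ha : 1 < ‖a‖ := by
    have : 0 < ‖a‖ ^ 2 - 1 := by rw [hR]; positivity
    nlinarith [norm_nonneg a]
  refine ⟨a, ha, ?_⟩
  rw [hypRefl_eq ha, hR, mul_div_cancel_right₀ _ hqpos.ne', ← e2, sub_add_cancel]

end Reflection

/-- Hyperbolic volume on the Poincaré ball. -/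
noncomputable def hypVol (E : Type*) [NormedAddCommGroup E] [InnerProductSpace ℝ E]
    [FiniteDimensional ℝ E] [MeasurableSpace E] [BorelSpace E] : Measure E :=
  (volume.restrict (Metric.ball (0 : E) 1)).withDensity
    fun x => ENNReal.ofReal ((2 / (1 - ‖x‖ ^ 2)) ^ Module.finrank ℝ E)

/-- Two-point rearrangement of `f` with respect to the hyperbolic reflection `hypRefl a`. -/
noncomputable def polarize {E : Type*} [NormedAddCommGroup E] [InnerProductSpace ℝ E] (a : E)
    (f : E → ℝ) (x : E) : ℝ :=
  if ‖a‖ ^ 2 - 1 ≤ ‖x - a‖ ^ 2 then max (f x) (f (hypRefl a x)) else min (f x) (f (hypRefl a x))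

section Measure

variable {E : Type*} [NormedAddCommGroup E] [InnerProductSpace ℝ E] {a : E}

lemma hypRefl_mem_good (ha : 1 < ‖a‖) {x : E} (hx : ‖x‖ < 1) (h : ‖x - a‖ ^ 2 ≤ ‖a‖ ^ 2 - 1) :
    ‖a‖ ^ 2 - 1 ≤ ‖hypRefl a x - a‖ ^ 2 := by
  have hq := norm_sub_pos_of_mem_ball ha hx
  rw [normSq_hypRefl_sub_center ha hx, le_div_iff₀ (by positivity)]
  nlinarith

variable [MeasurableSpace E] [BorelSpace E]

lemma measurable_hypDensity :
    Measurable fun x : E => ENNReal.ofReal ((2 / (1 - ‖x‖ ^ 2)) ^ Module.finrank ℝ E) := by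
  fun_prop

lemma measurable_hypRefl (a : E) : Measurable (hypRefl a) := by
  have : hypRefl a = fun x : E => (√(‖a‖ ^ 2 - 1) / dist x a) ^ 2 • (x - a) + a := by
    ext x
    simp [hypRefl, EuclideanGeometry.inversion]
  rw [this]
  fun_prop

variable [FiniteDimensional ℝ E]

instance : SFinite (hypVol E) := by unfold hypVol; infer_instance

lemma lintegral_hypVol {F : E → ENNReal} (hF : Measurable F) :
    ∫⁻ x, F x ∂hypVol E = ∫⁻ x in Metric.ball (0 : E) 1,
      ENNReal.ofReal ((2 / (1 - ‖x‖ ^ 2)) ^ Module.finrank ℝ E) * F x := by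
  rw [hypVol, lintegral_withDensity_eq_lintegral_mul _ measurable_hypDensity hF]
  rfl

lemma ae_hypVol_mem_ball : ∀ᵐ x ∂hypVol E, ‖x‖ < 1 := by
  refine (withDensity_absolutelyContinuous _ _).ae_le ?_
  filter_upwards [ae_restrict_mem Metric.isOpen_ball.measurableSet] with x hx
  simpa using hx

lemma measurePreserving_hypRefl (ha : 1 < ‖a‖) :
    MeasurePreserving (hypRefl a) (hypVol E) (hypVol E) := by
  refine ⟨measurable_hypRefl a, ?_⟩
  ext s hs
  have hs' : MeasurableSet (hypRefl a ⁻¹' s) := measurable_hypRefl a hs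
  have hb : MeasurableSet (Metric.ball (0 : E) 1) := Metric.isOpen_ball.measurableSet
  rw [Measure.map_apply (measurable_hypRefl a) hs, hypVol, withDensity_apply _ hs,
    withDensity_apply _ hs', Measure.restrict_restrict hs, Measure.restrict_restrict hs']
  have himg : s ∩ Metric.ball 0 1 = hypRefl a '' (hypRefl a ⁻¹' s ∩ Metric.ball 0 1) := by
    ext y
    simp only [Set.mem_inter_iff, Set.mem_image, Set.mem_preimage, mem_ball_zero_iff]
    constructor
    · rintro ⟨h1, h2⟩
      exact ⟨hypRefl a y, ⟨by rwa [hypRefl_hypRefl ha], norm_hypRefl_lt_one ha h2⟩, hypRefl_hypRefl ha y⟩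
    · rintro ⟨x, ⟨h1, h2⟩, rfl⟩
      exact ⟨h1, norm_hypRefl_lt_one ha h2⟩
  have hder : ∀ x ∈ hypRefl a ⁻¹' s ∩ Metric.ball 0 1, HasFDerivWithinAt (hypRefl a)
      ((√(‖a‖ ^ 2 - 1) / dist x a) ^ 2 • ((Submodule.span ℝ {x - a})ᗮ.reflection : E →L[ℝ] E))
      (hypRefl a ⁻¹' s ∩ Metric.ball 0 1) x := fun x hx =>
    (EuclideanGeometry.hasFDerivAt_inversion (sub_ne_zero.1 (norm_pos_iff.1
      (norm_sub_pos_of_mem_ball ha (mem_ball_zero_iff.1 hx.2))))).hasFDerivWithinAt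
  rw [himg, lintegral_image_eq_lintegral_abs_det_fderiv_mul _ (hs'.inter hb) hder
    (hypRefl_injective ha).injOn]
  refine setLIntegral_congr_fun (hs'.inter hb) fun x hx => ?_
  have hx1 : ‖x‖ < 1 := mem_ball_zero_iff.1 hx.2
  have hq := norm_sub_pos_of_mem_ball ha hx1
  have h3 := one_sub_normSq_pos hx1
  have h5 : 0 < ‖a‖ ^ 2 - 1 := by nlinarith
  rw [← ENNReal.ofReal_mul (abs_nonneg _), one_sub_normSq_hypRefl ha hx1]
  congr 1
  have hdet : |((√(‖a‖ ^ 2 - 1) / dist x a) ^ 2 •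
      ((Submodule.span ℝ {x - a})ᗮ.reflection : E →L[ℝ] E)).det| =
      ((‖a‖ ^ 2 - 1) / ‖x - a‖ ^ 2) ^ Module.finrank ℝ E := by
    rw [ContinuousLinearMap.det]
    have e : (((√(‖a‖ ^ 2 - 1) / dist x a) ^ 2 •
      ((Submodule.span ℝ {x - a})ᗮ.reflection : E →L[ℝ] E) : E →L[ℝ] E) : E →ₗ[ℝ] E) =
      (√(‖a‖ ^ 2 - 1) / dist x a) ^ 2 • ((Submodule.span ℝ {x - a})ᗮ.reflection).toLinearMap := rfl
    rw [e, LinearMap.det_smul, Submodule.det_reflection, abs_mul, abs_pow (-1 : ℝ), abs_neg, abs_one,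
      one_pow, mul_one, dist_eq_norm, div_pow, Real.sq_sqrt h5.le, abs_of_nonneg (by positivity)]
  rw [hdet, ← mul_pow]
  congr 1
  field_simp

lemma lintegral_le_of_symm (ha : 1 < ‖a‖) {F G : E → ENNReal} (hF : Measurable F) (hG : Measurable G)
    (h : ∀ x, ‖x‖ < 1 → ‖a‖ ^ 2 - 1 ≤ ‖x - a‖ ^ 2 → F x + F (hypRefl a x) ≤ G x + G (hypRefl a x)) :
    ∫⁻ x, F x ∂hypVol E ≤ ∫⁻ x, G x ∂hypVol E := by
  have hmp := measurePreserving_hypRefl ha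
  have key : ∫⁻ x, (F x + F (hypRefl a x)) ∂hypVol E ≤ ∫⁻ x, (G x + G (hypRefl a x)) ∂hypVol E := by
    refine lintegral_mono_ae ?_
    filter_upwards [ae_hypVol_mem_ball] with x hx
    rcases le_total (‖a‖ ^ 2 - 1) (‖x - a‖ ^ 2) with h1 | h1
    · exact h x hx h1
    · have := h _ (norm_hypRefl_lt_one ha hx) (hypRefl_mem_good ha hx h1)
      rwa [hypRefl_hypRefl ha, add_comm, add_comm (G _)] at this
  rw [lintegral_add_left hF, lintegral_add_left hG, hmp.lintegral_comp hF, hmp.lintegral_comp hG,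
    ← two_mul, ← two_mul] at key
  exact (ENNReal.mul_le_mul_iff_right (by simp) (by simp)).1 key

lemma lintegral_prod_le_of_symm (ha : 1 < ‖a‖) {F G : E × E → ENNReal} (hF : Measurable F)
    (hG : Measurable G)
    (h : ∀ x y, ‖x‖ < 1 → ‖y‖ < 1 → ‖a‖ ^ 2 - 1 ≤ ‖x - a‖ ^ 2 → ‖a‖ ^ 2 - 1 ≤ ‖y - a‖ ^ 2 →
      F (x, y) + F (hypRefl a x, y) + (F (x, hypRefl a y) + F (hypRefl a x, hypRefl a y)) ≤
      G (x, y) + G (hypRefl a x, y) + (G (x, hypRefl a y) + G (hypRefl a x, hypRefl a y))) :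
    ∫⁻ z, F z ∂(hypVol E).prod (hypVol E) ≤ ∫⁻ z, G z ∂(hypVol E).prod (hypVol E) := by
  have hm := measurable_hypRefl a
  have hF1 : Measurable fun x : E => ∫⁻ y, F (x, y) ∂hypVol E := hF.lintegral_prod_right'
  have hG1 : Measurable fun x : E => ∫⁻ y, G (x, y) ∂hypVol E := hG.lintegral_prod_right'
  rw [lintegral_prod _ hF.aemeasurable, lintegral_prod _ hG.aemeasurable]
  refine lintegral_le_of_symm ha hF1 hG1 fun x hx hxa => ?_
  rw [← lintegral_add_left (by fun_prop), ← lintegral_add_left (by fun_prop)]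
  exact lintegral_le_of_symm ha (by fun_prop) (by fun_prop) fun y hy hya => h x y hx hy hxa hya

end Measure

lemma convexOn_abs_rpow {p : ℝ} (hp : 1 ≤ p) : ConvexOn ℝ Set.univ fun t : ℝ => |t| ^ p := by
  refine ⟨convex_univ, fun x _ y _ s t hs ht hst => ?_⟩
  have h := (convexOn_rpow hp).2 (abs_nonneg x) (abs_nonneg y) hs ht hst
  refine le_trans (Real.rpow_le_rpow (abs_nonneg _) ?_ (by linarith)) h
  refine (abs_add_le _ _).trans (le_of_eq ?_)
  simp [abs_mul, abs_of_nonneg hs, abs_of_nonneg ht]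

lemma abs_sub_rpow_add_le_of_sorted {p : ℝ} (hp : 1 ≤ p) {a b c d : ℝ} (hab : b ≤ a) (hcd : d ≤ c) :
    |a - c| ^ p + |b - d| ^ p ≤ |a - d| ^ p + |b - c| ^ p := by
  rcases (add_nonneg (sub_nonneg.2 hab) (sub_nonneg.2 hcd)).eq_or_lt with h | h
  · have h1 : a = b := by linarith
    have h2 : c = d := by linarith
    rw [h1, h2]
  have hc := (convexOn_abs_rpow hp).2 (Set.mem_univ (a - d)) (Set.mem_univ (b - c))
  have hs : 0 ≤ (a - b) / (a - b + (c - d)) := div_nonneg (by linarith) h.le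
  have ht : 0 ≤ (c - d) / (a - b + (c - d)) := div_nonneg (by linarith) h.le
  have hst : (a - b) / (a - b + (c - d)) + (c - d) / (a - b + (c - d)) = 1 := by
    rw [← add_div, div_self h.ne']
  have h1 := hc hs ht hst
  have h2 := hc ht hs (by rw [add_comm]; exact hst)
  simp only [smul_eq_mul] at h1 h2
  have e1 : (a - b) / (a - b + (c - d)) * (a - d) + (c - d) / (a - b + (c - d)) * (b - c) = a - c := by
    field_simp
    ring
  have e2 : (c - d) / (a - b + (c - d)) * (a - d) + (a - b) / (a - b + (c - d)) * (b - c) = b - d := by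
    field_simp
    ring
  rw [e1] at h1
  rw [e2] at h2
  have e3 : (a - b) / (a - b + (c - d)) = 1 - (c - d) / (a - b + (c - d)) := by linarith
  rw [e3] at h1 h2
  linarith

/-- The two-point inequality behind polarization. -/
lemma two_point_le {p : ℝ} (hp : 1 ≤ p) {a b c d k l : ℝ} (hkl : l ≤ k) :
    k * |max a b - max c d| ^ p + l * |min a b - max c d| ^ p +
        (l * |max a b - min c d| ^ p + k * |min a b - min c d| ^ p) ≤
      k * |a - c| ^ p + l * |b - c| ^ p + (l * |a - d| ^ p + k * |b - d| ^ p) := by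
  rcases le_total a b with h1 | h1 <;> rcases le_total c d with h2 | h2 <;>
    simp only [max_eq_left, max_eq_right, min_eq_left, min_eq_right, h1, h2]
  · linarith
  · nlinarith [mul_le_mul_of_nonneg_left (abs_sub_rpow_add_le_of_sorted hp h1 h2) (sub_nonneg.2 hkl)]
  · nlinarith [mul_le_mul_of_nonneg_left (abs_sub_rpow_add_le_of_sorted hp h1 h2) (sub_nonneg.2 hkl)]
  · linarith

lemma abs_max_sub_max_le_of_le {a b c d M : ℝ} (h1 : |a - c| ≤ M) (h2 : |b - d| ≤ M) :
    |max a b - max c d| ≤ M := (abs_max_sub_max_le_max a b c d).trans (max_le h1 h2)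

lemma abs_min_sub_min_le_of_le {a b c d M : ℝ} (h1 : |a - c| ≤ M) (h2 : |b - d| ≤ M) :
    |min a b - min c d| ≤ M := (abs_min_sub_min_le_max a b c d).trans (max_le h1 h2)

/-- The nonlocal energy at scale `ε`. -/
noncomputable def hypEnergy {E : Type*} [NormedAddCommGroup E] [InnerProductSpace ℝ E]
    [FiniteDimensional ℝ E] [MeasurableSpace E] [BorelSpace E] (p ε : ℝ) (f : E → ℝ) : ENNReal :=
  ∫⁻ z : E × E, ENNReal.ofReal ((if hypDelta z.1 z.2 < ε ^ 2 then 1 else 0) * |f z.1 - f z.2| ^ p)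
    ∂(hypVol E).prod (hypVol E)

/-- Functions that share the constraints of `g` and whose energies do not exceed those of `g`. -/
structure HypCompetitor {E : Type*} [NormedAddCommGroup E] [InnerProductSpace ℝ E]
    [FiniteDimensional ℝ E] [MeasurableSpace E] [BorelSpace E] (p L B ρ : ℝ) (g f : E → ℝ) : Prop where
  nonneg : ∀ x, 0 ≤ f x
  le_bound : ∀ x, f x ≤ B
  zero : ∀ x, ρ ≤ ‖x‖ → f x = 0
  lip : ∀ x y, ‖x‖ < 1 → ‖y‖ < 1 → |f x - f y| ≤ L * √(hypDelta x y)
  norm_eq : ∀ s : ℝ, 0 < s →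
    ∫⁻ x, ENNReal.ofReal (f x ^ s) ∂hypVol E = ∫⁻ x, ENNReal.ofReal (g x ^ s) ∂hypVol E
  energy_le : ∀ ε : ℝ, 0 < ε → hypEnergy p ε f ≤ hypEnergy p ε g

lemma measurable_hypDelta {E : Type*} [NormedAddCommGroup E] [MeasurableSpace E] [BorelSpace E]
    [SecondCountableTopology E] : Measurable fun z : E × E => hypDelta z.1 z.2 := by
  unfold hypDelta
  fun_prop

lemma measurable_energyDensity {E : Type*} [NormedAddCommGroup E] [MeasurableSpace E] [BorelSpace E]
    [SecondCountableTopology E] {f : E → ℝ} (hf : Measurable f)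
    (p ε : ℝ) :
    Measurable fun z : E × E => ENNReal.ofReal
      ((if hypDelta z.1 z.2 < ε ^ 2 then 1 else 0) * |f z.1 - f z.2| ^ p) := by
  refine Measurable.ennreal_ofReal (Measurable.mul ?_ (by fun_prop))
  exact Measurable.ite (measurableSet_lt measurable_hypDelta measurable_const) measurable_const
    measurable_const

section Polarize

variable {E : Type*} [NormedAddCommGroup E] [InnerProductSpace ℝ E] {a : E}

lemma polarize_of_good {f : E → ℝ} {x : E} (h : ‖a‖ ^ 2 - 1 ≤ ‖x - a‖ ^ 2) :
    polarize a f x = max (f x) (f (hypRefl a x)) := if_pos h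

lemma polarize_hypRefl_of_good (ha : 1 < ‖a‖) {f : E → ℝ} {x : E} (hx : ‖x‖ < 1)
    (h : ‖a‖ ^ 2 - 1 ≤ ‖x - a‖ ^ 2) :
    polarize a f (hypRefl a x) = min (f x) (f (hypRefl a x)) := by
  have hq := norm_sub_pos_of_mem_ball ha hx
  have h5 : 0 < ‖a‖ ^ 2 - 1 := by nlinarith
  rw [polarize, hypRefl_hypRefl ha, min_comm (f (hypRefl a x)), max_comm]
  split_ifs with h1
  · rw [normSq_hypRefl_sub_center ha hx, le_div_iff₀ (by positivity)] at h1
    have h2 : ‖x - a‖ ^ 2 = ‖a‖ ^ 2 - 1 := le_antisymm (by nlinarith) h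
    have : hypRefl a x = x := by
      rw [hypRefl_eq ha, h2, div_self h5.ne', one_smul, sub_add_cancel]
    rw [this, max_self, min_self]
  · rfl

lemma polarize_nonneg {a : E} {f : E → ℝ} (hf : ∀ x, 0 ≤ f x) (x : E) : 0 ≤ polarize a f x := by
  unfold polarize
  split_ifs
  · exact le_max_of_le_left (hf _)
  · exact le_min (hf _) (hf _)

lemma polarize_zero (ha : 1 < ‖a‖) {f : E → ℝ} (hf : ∀ x, 0 ≤ f x) {ρ : ℝ} (hρ : ρ < 1)
    (h0 : ∀ x, ρ ≤ ‖x‖ → f x = 0) {x : E} (hx : ρ ≤ ‖x‖) : polarize a f x = 0 := by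
  rw [polarize, h0 x hx]
  split_ifs with h
  · have : ρ ≤ ‖hypRefl a x‖ := by
      rcases lt_or_ge ‖x‖ 1 with hx1 | hx1
      · exact hx.trans (norm_le_norm_hypRefl ha hx1 h)
      · by_contra! hlt
        have := norm_hypRefl_lt_one ha (hlt.trans hρ)
        rw [hypRefl_hypRefl ha] at this
        linarith
    rw [h0 _ this, max_self]
  · exact min_eq_left (hf _)

lemma exists_good (ha : 1 < ‖a‖) {x : E} (hx : ‖x‖ < 1) :
    ∃ y, ‖y‖ < 1 ∧ ‖a‖ ^ 2 - 1 ≤ ‖y - a‖ ^ 2 ∧ (x = y ∨ x = hypRefl a y) := by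
  rcases le_total (‖a‖ ^ 2 - 1) (‖x - a‖ ^ 2) with h1 | h1
  · exact ⟨x, hx, h1, Or.inl rfl⟩
  · exact ⟨hypRefl a x, norm_hypRefl_lt_one ha hx, hypRefl_mem_good ha hx h1,
      Or.inr (hypRefl_hypRefl ha x).symm⟩

lemma polarize_lip (ha : 1 < ‖a‖) {f : E → ℝ} {L : ℝ} (hL : 0 ≤ L)
    (hf : ∀ x y, ‖x‖ < 1 → ‖y‖ < 1 → |f x - f y| ≤ L * √(hypDelta x y)) {x y : E} (hx : ‖x‖ < 1)
    (hy : ‖y‖ < 1) : |polarize a f x - polarize a f y| ≤ L * √(hypDelta x y) := by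
  have hsame : ∀ x y, ‖x‖ < 1 → ‖y‖ < 1 →
      |f (hypRefl a x) - f (hypRefl a y)| ≤ L * √(hypDelta x y) := fun x y hx hy => by
    rw [← hypDelta_hypRefl_hypRefl ha hx hy]
    exact hf _ _ (norm_hypRefl_lt_one ha hx) (norm_hypRefl_lt_one ha hy)
  have hmix : ∀ x y, ‖x‖ < 1 → ‖y‖ < 1 → ‖a‖ ^ 2 - 1 ≤ ‖x - a‖ ^ 2 → ‖a‖ ^ 2 - 1 ≤ ‖y - a‖ ^ 2 →
      |polarize a f (hypRefl a x) - polarize a f y| ≤ L * √(hypDelta (hypRefl a x) y) := by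
    intro x y hx hy hxa hya
    have hle : L * √(hypDelta x y) ≤ L * √(hypDelta (hypRefl a x) y) :=
      mul_le_mul_of_nonneg_left (Real.sqrt_le_sqrt (hypDelta_le_hypRefl ha hx hy hxa hya)) hL
    rw [polarize_of_good hya, polarize_hypRefl_of_good ha hx hxa]
    have b1 := (hf x y hx hy).trans hle
    have b2 := (hsame x y hx hy).trans hle
    have b3 := hf (hypRefl a x) y (norm_hypRefl_lt_one ha hx) hy
    have b4 := hf x (hypRefl a y) hx (norm_hypRefl_lt_one ha hy)
    rw [← hypDelta_hypRefl_left ha hx hy] at b4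
    rcases min_choice (f x) (f (hypRefl a x)) with e1 | e1 <;>
      rcases max_choice (f y) (f (hypRefl a y)) with e2 | e2 <;> rw [e1, e2] <;> assumption
  obtain ⟨x', hx', hxa, rfl | rfl⟩ := exists_good ha hx <;>
    obtain ⟨y', hy', hya, rfl | rfl⟩ := exists_good ha hy
  · rw [polarize_of_good hxa, polarize_of_good hya]
    exact abs_max_sub_max_le_of_le (hf _ _ hx hy) (hsame _ _ hx hy)
  · rw [abs_sub_comm, hypDelta_comm]
    exact hmix _ _ hy' hx hya hxa
  · exact hmix _ _ hx' hy hxa hya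
  · rw [polarize_hypRefl_of_good ha hx' hxa, polarize_hypRefl_of_good ha hy' hya,
      hypDelta_hypRefl_hypRefl ha hx' hy']
    exact abs_min_sub_min_le_of_le (hf _ _ hx' hy') (hsame _ _ hx' hy')

variable [MeasurableSpace E] [BorelSpace E]

lemma measurable_polarize {f : E → ℝ} (hf : Measurable f) : Measurable (polarize a f) := by
  have := measurable_hypRefl a
  unfold polarize
  refine Measurable.ite ?_ (by fun_prop) (by fun_prop)
  exact measurableSet_le (by fun_prop) (by fun_prop)

variable [FiniteDimensional ℝ E]

lemma hypEnergy_polarize_le (ha : 1 < ‖a‖) {p ε : ℝ} (hp : 1 ≤ p) {f : E → ℝ} (hf : Measurable f) :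
    hypEnergy p ε (polarize a f) ≤ hypEnergy p ε f := by
  refine lintegral_prod_le_of_symm ha (measurable_energyDensity (measurable_polarize hf) p ε)
    (measurable_energyDensity hf p ε) fun x y hx hy hxa hya => ?_
  simp only [polarize_of_good hxa, polarize_of_good hya, polarize_hypRefl_of_good ha hx hxa,
    polarize_hypRefl_of_good ha hy hya, hypDelta_hypRefl_hypRefl ha hx hy,
    ← hypDelta_hypRefl_left ha hx hy]
  set k : ℝ := if hypDelta x y < ε ^ 2 then 1 else 0 with hk
  set l : ℝ := if hypDelta (hypRefl a x) y < ε ^ 2 then 1 else 0 with hl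
  have hl0 : 0 ≤ l := by rw [hl]; split_ifs <;> norm_num
  have hkl : l ≤ k := by
    have := hypDelta_le_hypRefl ha hx hy hxa hya
    rw [hl, hk]
    split_ifs <;> first | (exfalso; linarith) | norm_num
  have hk0 := hl0.trans hkl
  rw [← ENNReal.ofReal_add, ← ENNReal.ofReal_add, ← ENNReal.ofReal_add, ← ENNReal.ofReal_add,
    ← ENNReal.ofReal_add, ← ENNReal.ofReal_add]
  · exact ENNReal.ofReal_le_ofReal (two_point_le hp hkl)
  all_goals positivity

lemma lintegral_polarize_rpow (ha : 1 < ‖a‖) {s : ℝ} {f : E → ℝ} (hf : Measurable f) :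
    ∫⁻ x, ENNReal.ofReal (polarize a f x ^ s) ∂hypVol E = ∫⁻ x, ENNReal.ofReal (f x ^ s) ∂hypVol E := by
  have hm := measurable_polarize (a := a) hf
  have key : ∀ x, ‖x‖ < 1 → ‖a‖ ^ 2 - 1 ≤ ‖x - a‖ ^ 2 → ENNReal.ofReal (polarize a f x ^ s) +
      ENNReal.ofReal (polarize a f (hypRefl a x) ^ s) = ENNReal.ofReal (f x ^ s) +
      ENNReal.ofReal (f (hypRefl a x) ^ s) := by
    intro x hx hxa
    rw [polarize_of_good hxa, polarize_hypRefl_of_good ha hx hxa]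
    rcases le_total (f x) (f (hypRefl a x)) with h | h
    · rw [max_eq_right h, min_eq_left h, add_comm]
    · rw [max_eq_left h, min_eq_right h]
  exact le_antisymm
    (lintegral_le_of_symm ha (by fun_prop) (by fun_prop) fun x hx hxa => (key x hx hxa).le)
    (lintegral_le_of_symm ha (by fun_prop) (by fun_prop) fun x hx hxa => (key x hx hxa).ge)

end Polarize

section

variable {E : Type*} [NormedAddCommGroup E] {x y : E}

lemma hypDelta_le_of_norm_le {ρ : ℝ} (hρ : ρ < 1) (hx : ‖x‖ ≤ ρ) (hy : ‖y‖ ≤ ρ) :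
    √(hypDelta x y) ≤ ‖x - y‖ / (1 - ρ ^ 2) := by
  have h0 : 0 ≤ ρ := (norm_nonneg x).trans hx
  have h1 : 0 < 1 - ρ ^ 2 := by nlinarith
  have h2 : 1 - ρ ^ 2 ≤ 1 - ‖x‖ ^ 2 := by nlinarith [norm_nonneg x]
  have h3 : 1 - ρ ^ 2 ≤ 1 - ‖y‖ ^ 2 := by nlinarith [norm_nonneg y]
  have h4 := h1.trans_le h2
  refine Real.sqrt_le_iff.2 ⟨by positivity, ?_⟩
  rw [hypDelta, div_pow]
  gcongr
  rw [sq]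
  gcongr

lemma norm_sub_le_sqrt_hypDelta (hx : ‖x‖ < 1) (hy : ‖y‖ < 1) :
    ‖x - y‖ ≤ √(hypDelta x y) := by
  have h2 := one_sub_normSq_pos hx
  have h3 := one_sub_normSq_pos hy
  refine Real.le_sqrt_of_sq_le ?_
  rw [hypDelta, le_div_iff₀ (by positivity)]
  refine mul_le_of_le_one_right (by positivity) (mul_le_one₀ ?_ h3.le ?_) <;>
    nlinarith [norm_nonneg x, norm_nonneg y]

end

section Competitor

variable {E : Type*} [NormedAddCommGroup E] [InnerProductSpace ℝ E] [MeasurableSpace E]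
  [BorelSpace E] [FiniteDimensional ℝ E] {p L B ρ : ℝ} {g f : E → ℝ}

namespace HypCompetitor

lemma dist_le_of_norm_le (hc : HypCompetitor p L B ρ g f) (hL : 0 ≤ L) (hρ : ρ < 1) {x y : E}
    (hx : ‖x‖ ≤ ρ) (hy : ‖y‖ ≤ ρ) : |f x - f y| ≤ L / (1 - ρ ^ 2) * ‖x - y‖ := by
  refine (hc.lip x y (hx.trans_lt hρ) (hy.trans_lt hρ)).trans ?_
  refine (mul_le_mul_of_nonneg_left (hypDelta_le_of_norm_le hρ hx hy) hL).trans (le_of_eq ?_)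
  ring

lemma le_mul_sub_norm [Nontrivial E] (hc : HypCompetitor p L B ρ g f) (hL : 0 ≤ L) (hρ0 : 0 < ρ)
    (hρ : ρ < 1) {x : E} (hx : ‖x‖ ≤ ρ) : f x ≤ L / (1 - ρ ^ 2) * (ρ - ‖x‖) := by
  obtain ⟨z, hz, hxz⟩ : ∃ z : E, ‖z‖ = ρ ∧ ‖x - z‖ = ρ - ‖x‖ := by
    rcases eq_or_ne x 0 with rfl | h0
    · obtain ⟨z, hz⟩ := exists_norm_eq E hρ0.le
      exact ⟨z, hz, by simp [hz]⟩
    · have hn : 0 < ‖x‖ := norm_pos_iff.2 h0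
      refine ⟨(ρ / ‖x‖) • x, ?_, ?_⟩
      · rw [norm_smul, Real.norm_of_nonneg (by positivity)]
        field_simp
      · have : x - (ρ / ‖x‖) • x = (1 - ρ / ‖x‖) • x := by rw [sub_smul, one_smul]
        rw [this, norm_smul, Real.norm_eq_abs, abs_sub_comm, abs_of_nonneg]
        · field_simp
        · rw [sub_nonneg, le_div_iff₀ hn]
          linarith
  have h := hc.dist_le_of_norm_le hL hρ hx hz.le
  rw [hc.zero z hz.ge, sub_zero, abs_of_nonneg (hc.nonneg x), hxz] at h
  exact h

lemma dist_le [Nontrivial E] (hc : HypCompetitor p L B ρ g f) (hL : 0 ≤ L) (hρ0 : 0 < ρ)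
    (hρ : ρ < 1) (x y : E) : |f x - f y| ≤ L / (1 - ρ ^ 2) * ‖x - y‖ := by
  have h1 : 0 < 1 - ρ ^ 2 := by nlinarith
  wlog h : ‖x‖ ≤ ‖y‖ generalizing x y
  · rw [abs_sub_comm, norm_sub_rev]
    exact this y x (le_of_not_ge h)
  rcases le_or_gt ‖y‖ ρ with hy | hy
  · exact hc.dist_le_of_norm_le hL hρ (h.trans hy) hy
  · rw [hc.zero y hy.le, sub_zero, abs_of_nonneg (hc.nonneg x)]
    rcases le_or_gt ‖x‖ ρ with hx | hx
    · refine (hc.le_mul_sub_norm hL hρ0 hρ hx).trans (mul_le_mul_of_nonneg_left ?_ (by positivity))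
      have := norm_sub_norm_le y x
      rw [norm_sub_rev] at this
      linarith
    · rw [hc.zero x hx.le]
      positivity

lemma lipschitzWith [Nontrivial E] (hc : HypCompetitor p L B ρ g f) (hL : 0 ≤ L) (hρ0 : 0 < ρ)
    (hρ : ρ < 1) : LipschitzWith (L / (1 - ρ ^ 2)).toNNReal f := by
  have h1 : 0 < 1 - ρ ^ 2 := by nlinarith
  refine LipschitzWith.of_dist_le_mul fun x y => ?_
  rw [Real.dist_eq, dist_eq_norm, Real.coe_toNNReal _ (by positivity)]
  exact hc.dist_le hL hρ0 hρ x y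

lemma polarize [Nontrivial E] (hc : HypCompetitor p L B ρ g f) (hp : 1 ≤ p) (hL : 0 ≤ L)
    (hρ0 : 0 < ρ) (hρ : ρ < 1) {a : E} (ha : 1 < ‖a‖) :
    HypCompetitor p L B ρ g (polarize a f) := by
  have hm := (hc.lipschitzWith hL hρ0 hρ).continuous.measurable
  refine ⟨polarize_nonneg hc.nonneg, fun x => ?_, fun x hx => polarize_zero ha hc.nonneg hρ hc.zero hx,
    fun x y hx hy => polarize_lip ha hL hc.lip hx hy, fun s hs => ?_, fun ε hε => ?_⟩
  · unfold _root_.polarize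
    split_ifs
    · exact max_le (hc.le_bound _) (hc.le_bound _)
    · exact (min_le_left _ _).trans (hc.le_bound _)
  · rw [lintegral_polarize_rpow ha hm, hc.norm_eq s hs]
  · exact (hypEnergy_polarize_le ha hp hm).trans (hc.energy_le ε hε)

end HypCompetitor

end Competitor

section Compactness

open Filter Topology
open scoped BoundedContinuousFunction

variable {E : Type*} [NormedAddCommGroup E] [InnerProductSpace ℝ E] [MeasurableSpace E]
  [BorelSpace E] [FiniteDimensional ℝ E] {p L B ρ : ℝ} {g f : E → ℝ}

lemma hypVol_closedBall_lt_top (hρ : ρ < 1) : hypVol E (Metric.closedBall 0 ρ) < ⊤ := by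
  have hs : MeasurableSet (Metric.closedBall (0 : E) ρ) := Metric.isClosed_closedBall.measurableSet
  rw [hypVol, withDensity_apply _ hs, Measure.restrict_restrict hs]
  refine setLIntegral_lt_top_of_le_nnreal ?_
    ⟨((2 / (1 - ρ ^ 2)) ^ Module.finrank ℝ E).toNNReal, ?_⟩
  · exact ((measure_mono Set.inter_subset_left).trans_lt measure_closedBall_lt_top).ne
  · rintro x ⟨hx, -⟩
    rw [mem_closedBall_zero_iff] at hx
    have h0 : 0 ≤ ρ := (norm_nonneg x).trans hx
    have h1 : 0 < 1 - ρ ^ 2 := by nlinarith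
    have h2 : 1 - ρ ^ 2 ≤ 1 - ‖x‖ ^ 2 := by nlinarith [norm_nonneg x]
    rw [ENNReal.ofReal, ENNReal.coe_le_coe]
    refine Real.toNNReal_le_toNNReal ?_
    have := h1.trans_le h2
    gcongr

/-- The linear functional that detects radially decreasing functions. -/
noncomputable def hypMoment (f : E → ℝ) : ENNReal :=
  ∫⁻ x, ENNReal.ofReal (f x * (1 - ‖x‖ ^ 2)) ∂hypVol E

lemma tendsto_lintegral_hypVol {ι : Type*} {l : Filter ι} [l.IsCountablyGenerated] (hρ : ρ < 1)
    {F : ι → E → ℝ} {C : ℝ} (hm : ∀ᶠ i in l, Measurable (F i)) (hC : ∀ᶠ i in l, ∀ x, ‖x‖ < 1 → F i x ≤ C)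
    (hz : ∀ᶠ i in l, ∀ x, ρ ≤ ‖x‖ → F i x = 0)
    (hlim : ∀ x, ‖x‖ < 1 → Tendsto (fun i => F i x) l (𝓝 (f x))) :
    Tendsto (fun i => ∫⁻ x, ENNReal.ofReal (F i x) ∂hypVol E) l
      (𝓝 (∫⁻ x, ENNReal.ofReal (f x) ∂hypVol E)) := by
  refine tendsto_lintegral_filter_of_dominated_convergence
    ((Metric.closedBall 0 ρ).indicator fun _ => ENNReal.ofReal C) ?_ ?_ ?_ ?_
  · exact hm.mono fun i hi => hi.ennreal_ofReal
  · filter_upwards [hC, hz] with i h1 h2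
    filter_upwards [ae_hypVol_mem_ball] with x hx
    by_cases h : x ∈ Metric.closedBall (0 : E) ρ
    · rw [Set.indicator_of_mem h]
      exact ENNReal.ofReal_le_ofReal (h1 x hx)
    · rw [mem_closedBall_zero_iff, not_le] at h
      rw [h2 x h.le, ENNReal.ofReal_zero]
      exact zero_le
  · rw [lintegral_indicator_const Metric.isClosed_closedBall.measurableSet]
    exact ENNReal.mul_ne_top ENNReal.ofReal_ne_top (hypVol_closedBall_lt_top hρ).ne
  · filter_upwards [ae_hypVol_mem_ball] with x hx
    exact (ENNReal.continuous_ofReal.tendsto _).comp (hlim x hx)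

namespace HypCompetitor

lemma hypMoment_lt_top (hc : HypCompetitor p L B ρ g f) (hρ : ρ < 1) :
    hypMoment f < ⊤ := by
  have hs : MeasurableSet (Metric.closedBall (0 : E) ρ) := Metric.isClosed_closedBall.measurableSet
  refine lt_of_le_of_lt (b := ∫⁻ x, (Metric.closedBall 0 ρ).indicator (fun _ => ENNReal.ofReal B) x
    ∂hypVol E) (lintegral_mono_ae ?_) ?_
  · filter_upwards [ae_hypVol_mem_ball] with x hx
    by_cases h : x ∈ Metric.closedBall (0 : E) ρ
    · rw [Set.indicator_of_mem h]
      exact ENNReal.ofReal_le_ofReal ((mul_le_of_le_one_right (hc.nonneg x)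
        (by nlinarith [norm_nonneg x])).trans (hc.le_bound x))
    · rw [mem_closedBall_zero_iff, not_le] at h
      rw [hc.zero x h.le, zero_mul, ENNReal.ofReal_zero]
      exact zero_le
  · rw [lintegral_indicator_const hs]
    exact ENNReal.mul_lt_top ENNReal.ofReal_lt_top (hypVol_closedBall_lt_top hρ)

variable [Nontrivial E]

lemma measurable (hc : HypCompetitor p L B ρ g f) (hL : 0 ≤ L) (hρ0 : 0 < ρ) (hρ : ρ < 1) :
    Measurable f := (hc.lipschitzWith hL hρ0 hρ).continuous.measurable

lemma of_tendsto (hp : 0 ≤ p) (hL : 0 ≤ L) (hρ0 : 0 < ρ) (hρ : ρ < 1) {F : ℕ → E → ℝ}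
    (hF : ∀ k, HypCompetitor p L B ρ g (F k)) (hlim : ∀ x, Tendsto (fun k => F k x) atTop (𝓝 (f x))) :
    HypCompetitor p L B ρ g f := by
  have hm := fun k => (hF k).measurable hL hρ0 hρ
  refine ⟨fun x => ge_of_tendsto' (hlim x) fun k => (hF k).nonneg x,
    fun x => le_of_tendsto' (hlim x) fun k => (hF k).le_bound x,
    fun x hx => tendsto_nhds_unique (hlim x)
      (tendsto_const_nhds.congr fun k => ((hF k).zero x hx).symm),
    fun x y hx hy => le_of_tendsto' ((hlim x).sub (hlim y)).abs fun k => (hF k).lip x y hx hy,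
    fun s hs => ?_, fun ε hε => ?_⟩
  · have h := tendsto_lintegral_hypVol (f := fun x => f x ^ s) (F := fun k x => F k x ^ s) (C := B ^ s)
      (l := atTop) hρ (.of_forall fun k => (hm k).pow_const s)
      (.of_forall fun k x _ => Real.rpow_le_rpow ((hF k).nonneg x) ((hF k).le_bound x) hs.le)
      (.of_forall fun k x hx => by rw [(hF k).zero x hx, Real.zero_rpow hs.ne'])
      fun x _ => (hlim x).rpow_const (Or.inr hs.le)
    exact tendsto_nhds_unique h (tendsto_const_nhds.congr fun k => ((hF k).norm_eq s hs).symm)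
  · have key : hypEnergy p ε f ≤ liminf (fun k => hypEnergy p ε (F k)) atTop := by
      refine le_trans (le_of_eq ?_)
        (lintegral_liminf_le fun k => measurable_energyDensity (hm k) p ε)
      refine lintegral_congr fun z => (Tendsto.liminf_eq ?_).symm
      refine (ENNReal.continuous_ofReal.tendsto _).comp (Tendsto.const_mul _ ?_)
      exact ((hlim z.1).sub (hlim z.2)).abs.rpow_const (Or.inr hp)
    refine key.trans ?_
    exact liminf_le_of_frequently_le' (.of_forall fun k => (hF k).energy_le ε hε)

lemma exists_maximizer (hg : HypCompetitor p L B ρ g g) (hp : 0 ≤ p) (hL : 0 ≤ L) (hρ0 : 0 < ρ)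
    (hρ : ρ < 1) : ∃ f, HypCompetitor p L B ρ g f ∧
      ∀ f', HypCompetitor p L B ρ g f' → hypMoment f' ≤ hypMoment f := by
  classical
  let D := Metric.closedBall (0 : E) 1
  let extd : (D →ᵇ ℝ) → E → ℝ := fun φ x => if h : x ∈ D then φ ⟨x, h⟩ else 0
  have : CompactSpace D := isCompact_iff_compactSpace.1 (isCompact_closedBall 0 1)
  have hcont : ∀ x, Continuous fun φ => extd φ x := fun x => by
    simp only [extd]
    split_ifs with h
    · exact continuous_eval_const _
    · exact continuous_const
  have hsurj : ∀ f, HypCompetitor p L B ρ g f → ∃ φ, extd φ = f := fun f hf => by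
    refine ⟨BoundedContinuousFunction.mkOfCompact
      ⟨fun x => f x, (hf.lipschitzWith hL hρ0 hρ).continuous.comp continuous_subtype_val⟩, ?_⟩
    ext x
    simp only [extd]
    split_ifs with h
    · rfl
    · rw [hf.zero]
      simp only [D, mem_closedBall_zero_iff, not_le] at h
      linarith
  let A : Set (D →ᵇ ℝ) := {φ | HypCompetitor p L B ρ g (extd φ)}
  have hext : ∀ (φ : D →ᵇ ℝ) (x : D), extd φ x = φ x := fun φ x => by simp [extd]
  have hA : IsCompact A := by
    refine BoundedContinuousFunction.arzela_ascoli₂ (Set.Icc 0 B) isCompact_Icc A ?_ ?_ ?_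
    · refine IsSeqClosed.isClosed fun F φ hF hlim => ?_
      exact of_tendsto hp hL hρ0 hρ hF fun x => ((hcont x).tendsto φ).comp hlim
    · intro φ x hφ
      rw [← hext]
      exact ⟨hφ.nonneg _, hφ.le_bound _⟩
    · have : UniformEquicontinuous ((↑) : A → D → ℝ) := by
        refine LipschitzWith.uniformEquicontinuous _ (L / (1 - ρ ^ 2)).toNNReal fun φ => ?_
        have h := (φ.2.lipschitzWith hL hρ0 hρ).comp (LipschitzWith.subtype_val D)
        rw [mul_one] at h
        convert h using 1
        ext x
        exact (hext _ _).symm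
      exact this.equicontinuous
  obtain ⟨φ₀, hφ₀⟩ := hsurj g hg
  have hne : A.Nonempty := ⟨φ₀, by simpa only [A, Set.mem_ofPred_eq, hφ₀] using hg⟩
  have hJ : ContinuousOn (fun φ => hypMoment (extd φ)) A := by
    intro φ _
    refine tendsto_lintegral_hypVol (C := B) hρ ?_ ?_ ?_ ?_
    · filter_upwards [self_mem_nhdsWithin] with ψ hψ
      have := hψ.measurable hL hρ0 hρ
      fun_prop
    · filter_upwards [self_mem_nhdsWithin] with ψ hψ x hx
      exact (mul_le_of_le_one_right (hψ.nonneg x) (by nlinarith [norm_nonneg x])).trans (hψ.le_bound x)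
    · filter_upwards [self_mem_nhdsWithin] with ψ hψ x hx
      rw [hψ.zero x hx, zero_mul]
    · intro x _
      exact (((hcont x).tendsto φ).mono_left nhdsWithin_le_nhds).mul_const _
  obtain ⟨φ, hφ, hmax⟩ := hA.exists_isMaxOn hne hJ
  refine ⟨extd φ, hφ, fun f' hf' => ?_⟩
  obtain ⟨ψ, rfl⟩ := hsurj f' hf'
  exact hmax hf'

end HypCompetitor

end Compactness

section Maximizer

open Filter Topology

variable {E : Type*} [NormedAddCommGroup E] [InnerProductSpace ℝ E]

lemma continuousAt_hypRefl {a x : E} (ha : 1 < ‖a‖) (hx : ‖x‖ < 1) :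
    ContinuousAt (hypRefl a) x :=
  (EuclideanGeometry.hasFDerivAt_inversion (sub_ne_zero.1 (norm_pos_iff.1
    (norm_sub_pos_of_mem_ball ha hx)))).continuousAt

lemma moment_le_polarize {f : E → ℝ} {a x : E} (ha : 1 < ‖a‖) (hx : ‖x‖ < 1)
    (h : ‖a‖ ^ 2 - 1 ≤ ‖x - a‖ ^ 2) :
    f x * (1 - ‖x‖ ^ 2) + f (hypRefl a x) * (1 - ‖hypRefl a x‖ ^ 2) ≤
      polarize a f x * (1 - ‖x‖ ^ 2) + polarize a f (hypRefl a x) * (1 - ‖hypRefl a x‖ ^ 2) := by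
  rw [polarize_of_good h, polarize_hypRefl_of_good ha hx h]
  have hn : ‖x‖ ^ 2 ≤ ‖hypRefl a x‖ ^ 2 := by gcongr; exact norm_le_norm_hypRefl ha hx h
  rcases le_total (f x) (f (hypRefl a x)) with h1 | h1
  · rw [max_eq_right h1, min_eq_left h1]
    nlinarith
  · rw [max_eq_left h1, min_eq_right h1]

variable [MeasurableSpace E] [BorelSpace E] [FiniteDimensional ℝ E] {p L B ρ : ℝ} {g f : E → ℝ}

lemma ae_of_ae_hypVol {P : E → Prop} (h : ∀ᵐ x ∂hypVol E, P x) : ∀ᵐ x : E, ‖x‖ < 1 → P x := by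
  rw [hypVol, ae_withDensity_iff measurable_hypDensity,
    ae_restrict_iff' Metric.isOpen_ball.measurableSet] at h
  filter_upwards [h] with x hx h1
  refine hx (by simpa using h1) (ne_of_gt ?_)
  have := one_sub_normSq_pos h1
  rw [ENNReal.ofReal_pos]
  positivity

lemma hypMoment_lt_polarize {a x : E} (ha : 1 < ‖a‖) (hf0 : ∀ x, 0 ≤ f x) (hf : Continuous f)
    (hfin : hypMoment f < ⊤) (hx : ‖hypRefl a x‖ < 1) (hlt : ‖x‖ < ‖hypRefl a x‖)
    (hfx : f x < f (hypRefl a x)) : hypMoment f < hypMoment (polarize a f) := by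
  have hmp := measurePreserving_hypRefl ha
  have hR := measurable_hypRefl a
  have hx1 := hlt.trans hx
  have hdouble : ∀ F : E → ℝ, Measurable F → ∫⁻ x, (ENNReal.ofReal (F x * (1 - ‖x‖ ^ 2)) +
      ENNReal.ofReal (F (hypRefl a x) * (1 - ‖hypRefl a x‖ ^ 2))) ∂hypVol E = 2 * hypMoment F := by
    intro F hF
    rw [lintegral_add_left (by fun_prop), hmp.lintegral_comp
      (f := fun x => ENNReal.ofReal (F x * (1 - ‖x‖ ^ 2))) (by fun_prop), two_mul]
    rfl
  have hofReal : ∀ F : E → ℝ, (∀ x, 0 ≤ F x) → ∀ x, ‖x‖ < 1 →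
      ENNReal.ofReal (F x * (1 - ‖x‖ ^ 2)) +
        ENNReal.ofReal (F (hypRefl a x) * (1 - ‖hypRefl a x‖ ^ 2)) =
      ENNReal.ofReal (F x * (1 - ‖x‖ ^ 2) + F (hypRefl a x) * (1 - ‖hypRefl a x‖ ^ 2)) := by
    intro F hF x hx
    rw [ENNReal.ofReal_add (mul_nonneg (hF _) (one_sub_normSq_pos hx).le)
      (mul_nonneg (hF _) (one_sub_normSq_pos (norm_hypRefl_lt_one ha hx)).le)]
  have hpm := measurable_polarize (a := a) hf.measurable
  have key : 2 * hypMoment f < 2 * hypMoment (polarize a f) := by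
    rw [← hdouble _ hf.measurable, ← hdouble _ hpm]
    refine lintegral_strict_mono_of_ae_le_of_frequently_ae_lt (by fun_prop) ?_ ?_ ?_
    · rw [hdouble _ hf.measurable]
      exact ENNReal.mul_ne_top (by simp) hfin.ne
    · filter_upwards [ae_hypVol_mem_ball] with z hz
      rw [hofReal _ hf0 z hz, hofReal _ (polarize_nonneg hf0) z hz]
      refine ENNReal.ofReal_le_ofReal ?_
      rcases le_total (‖a‖ ^ 2 - 1) (‖z - a‖ ^ 2) with h1 | h1
      · exact moment_le_polarize ha hz h1
      · have := moment_le_polarize (f := f) ha (norm_hypRefl_lt_one ha hz) (hypRefl_mem_good ha hz h1)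
        rw [hypRefl_hypRefl ha] at this
        linarith
    · intro hae
      have hd := Measure.dense_of_ae (ae_of_ae_hypVol hae)
      have hc := continuousAt_hypRefl ha hx1
      have e1 : ∀ᶠ z in 𝓝 x, ‖z‖ < 1 := continuous_norm.continuousAt.eventually_lt_const hx1
      have e2 : ∀ᶠ z in 𝓝 x, ‖z‖ < ‖hypRefl a z‖ := continuous_norm.continuousAt.eventually_lt hc.norm hlt
      have e3 : ∀ᶠ z in 𝓝 x, f z < f (hypRefl a z) :=
        hf.continuousAt.eventually_lt (hf.continuousAt.comp hc) hfx
      obtain ⟨z, ⟨⟨h1, h2⟩, h3⟩, h4⟩ := mem_closure_iff_nhds.1 (hd x) _ ((e1.and e2).and e3)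
      have h1' : ‖z‖ < 1 := h1
      have h4' := h4 h1
      refine h4' (ne_of_lt ?_)
      rw [hofReal _ hf0 z h1, hofReal _ (polarize_nonneg hf0) z h1]
      have hg := (lt_normSq_sub_of_norm_lt_norm_hypRefl ha h1 h2).le
      have hn : ‖z‖ ^ 2 < ‖hypRefl a z‖ ^ 2 := by gcongr
      have h5 := one_sub_normSq_pos h1'
      have h6 := one_sub_normSq_pos (norm_hypRefl_lt_one ha h1)
      have h7 := mul_nonneg (hf0 z) h5.le
      have h8 : 0 < f (hypRefl a z) := (hf0 z).trans_lt h3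
      rw [polarize_of_good hg, polarize_hypRefl_of_good ha h1 hg, max_eq_right h3.le, min_eq_left h3.le]
      refine (ENNReal.ofReal_lt_ofReal_iff ?_).2 ?_
      · have := mul_nonneg (hf0 z) h6.le
        positivity
      · have h3' : f z < f (hypRefl a z) := h3
        nlinarith
  exact (ENNReal.mul_lt_mul_iff_right (by simp) (by simp)).1 key

lemma HypCompetitor.antitone_norm_of_maximizer [Nontrivial E] (hc : HypCompetitor p L B ρ g f)
    (hmax : ∀ f', HypCompetitor p L B ρ g f' → hypMoment f' ≤ hypMoment f) (hp : 1 ≤ p) (hL : 0 ≤ L)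
    (hρ0 : 0 < ρ) (hρ : ρ < 1) {x y : E} (hxy : ‖x‖ ≤ ‖y‖) : f y ≤ f x := by
  have hcont := (hc.lipschitzWith hL hρ0 hρ).continuous
  have hstrict : ∀ x y : E, ‖x‖ < ‖y‖ → f y ≤ f x := by
    intro x y hxy
    rcases le_or_gt 1 ‖y‖ with hy | hy
    · rw [hc.zero y (hρ.le.trans hy)]
      exact hc.nonneg x
    by_contra! hlt
    obtain ⟨a, ha, rfl⟩ := exists_hypRefl_eq hxy hy
    exact (hypMoment_lt_polarize ha hc.nonneg hcont (hc.hypMoment_lt_top hρ) hy hxy hlt).not_ge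
      (hmax _ (hc.polarize hp hL hρ0 hρ ha))
  rcases hxy.lt_or_eq with h | h
  · exact hstrict x y h
  rcases eq_or_ne y 0 with rfl | hy
  · rw [norm_zero, norm_eq_zero] at h
    rw [h]
  have hlim : Tendsto (fun t : ℝ => f (t • y)) (𝓝[>] 1) (𝓝 (f ((1 : ℝ) • y))) :=
    ((hcont.comp (continuous_id.smul continuous_const)).tendsto 1).mono_left nhdsWithin_le_nhds
  rw [one_smul] at hlim
  refine le_of_tendsto hlim ?_
  filter_upwards [self_mem_nhdsWithin] with t ht
  have ht1 : (1 : ℝ) < t := ht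
  refine hstrict _ _ ?_
  rw [norm_smul, Real.norm_of_nonneg (by linarith), h]
  have := norm_pos_iff.2 hy
  nlinarith

end Maximizer

section Localization

open Filter Topology

variable {E : Type*} [NormedAddCommGroup E] [InnerProductSpace ℝ E]

/-- The integrand of the rescaled nonlocal energy. -/
noncomputable def scaledDensity (d : ℕ) (p ε : ℝ) (f : E → ℝ) (z : E × E) : ℝ :=
  (2 / (1 - ‖z.1‖ ^ 2)) ^ d * ((if ‖z.1 + ε • z.2‖ < 1 ∧
      ‖z.2‖ ^ 2 < (1 - ‖z.1‖ ^ 2) * (1 - ‖z.1 + ε • z.2‖ ^ 2) then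
    (2 / (1 - ‖z.1 + ε • z.2‖ ^ 2)) ^ d else 0) * |ε⁻¹ * (f (z.1 + ε • z.2) - f z.1)| ^ p)

lemma hypDensity_indicator_eq {d : ℕ} {p ε : ℝ} (hε : 0 < ε) {f : E → ℝ} {x : E} (hx : ‖x‖ < 1) (h : E) :
    ENNReal.ofReal ((2 / (1 - ‖x‖ ^ 2)) ^ d) * (Metric.ball (0 : E) 1).indicator
      (fun y => ENNReal.ofReal ((2 / (1 - ‖y‖ ^ 2)) ^ d) *
        ENNReal.ofReal ((if hypDelta x y < ε ^ 2 then 1 else 0) * |f x - f y| ^ p)) (x + ε • h) =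
      ENNReal.ofReal (ε ^ p) * ENNReal.ofReal (scaledDensity d p ε f (x, h)) := by
  have h1 := one_sub_normSq_pos hx
  rw [scaledDensity, ← ENNReal.ofReal_mul (by positivity)]
  by_cases hy : ‖x + ε • h‖ < 1
  · rw [Set.indicator_of_mem (by simpa using hy)]
    have h2 := one_sub_normSq_pos hy
    simp only [hy, true_and]
    rw [← ENNReal.ofReal_mul (by positivity), ← ENNReal.ofReal_mul (by positivity)]
    congr 1
    have hiff : hypDelta x (x + ε • h) < ε ^ 2 ↔
        ‖h‖ ^ 2 < (1 - ‖x‖ ^ 2) * (1 - ‖x + ε • h‖ ^ 2) := by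
      rw [hypDelta, div_lt_iff₀ (by positivity), sub_add_cancel_left, norm_neg, norm_smul, mul_pow,
        Real.norm_of_nonneg hε.le, mul_lt_mul_iff_right₀ (by positivity)]
    simp only [hiff]
    split_ifs
    · rw [abs_mul, abs_of_pos (inv_pos.2 hε), Real.mul_rpow (by positivity) (abs_nonneg _),
        Real.inv_rpow hε.le, abs_sub_comm (f x)]
      field_simp
    · simp
  · rw [Set.indicator_of_notMem (by simpa using hy)]
    simp [hy]

variable [MeasurableSpace E] [BorelSpace E]

lemma measurable_scaledDensity [SecondCountableTopology E] {d : ℕ} {p ε : ℝ} {f : E → ℝ}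
    (hf : Measurable f) : Measurable (scaledDensity d p ε f) := by
  have h1 : MeasurableSet {z : E × E | ‖z.1 + ε • z.2‖ < 1} :=
    measurableSet_lt (by fun_prop) (by fun_prop)
  have h2 : MeasurableSet {z : E × E | ‖z.2‖ ^ 2 < (1 - ‖z.1‖ ^ 2) * (1 - ‖z.1 + ε • z.2‖ ^ 2)} :=
    measurableSet_lt (by fun_prop) (by fun_prop)
  unfold scaledDensity
  exact Measurable.mul (by fun_prop) (Measurable.mul (Measurable.ite (h1.inter h2) (by fun_prop)
    (by fun_prop)) (by fun_prop))

variable [FiniteDimensional ℝ E]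

lemma lintegral_comp_add_smul {G : E → ENNReal} (hG : Measurable G) (x : E) {ε : ℝ} (hε : 0 < ε) :
    ∫⁻ y, G y = ENNReal.ofReal (ε ^ Module.finrank ℝ E) * ∫⁻ h, G (x + ε • h) := by
  have h1 : ∫⁻ h, G (x + ε • h) = ∫⁻ y, G (x + y) ∂(Measure.map (ε • ·) (volume : Measure E)) :=
    (lintegral_map (f := fun y => G (x + y)) (by fun_prop) (measurable_const_smul ε)).symm
  rw [h1, Measure.map_addHaar_smul _ hε.ne', lintegral_smul_measure, smul_eq_mul, ← mul_assoc,
    ← ENNReal.ofReal_mul (by positivity), abs_of_pos (by positivity), mul_inv_cancel₀ (by positivity),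
    ENNReal.ofReal_one, one_mul, lintegral_add_left_eq_self]

lemma hypEnergy_eq {p ε : ℝ} (hε : 0 < ε) {f : E → ℝ} (hf : Measurable f) :
    hypEnergy p ε f = ENNReal.ofReal (ε ^ Module.finrank ℝ E * ε ^ p) *
      ∫⁻ z, ENNReal.ofReal (scaledDensity (Module.finrank ℝ E) p ε f z)
        ∂((volume.restrict (Metric.ball (0 : E) 1)).prod volume) := by
  have hmD := measurable_energyDensity hf p ε
  have hmS := (measurable_scaledDensity (d := Module.finrank ℝ E) (p := p) (ε := ε) hf).ennreal_ofReal
  have hin : Measurable fun x : E => ∫⁻ y, ENNReal.ofReal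
      ((if hypDelta x y < ε ^ 2 then 1 else 0) * |f x - f y| ^ p) ∂hypVol E := hmD.lintegral_prod_right'
  have hb : MeasurableSet (Metric.ball (0 : E) 1) := Metric.isOpen_ball.measurableSet
  have hcongr : ∀ x ∈ Metric.ball (0 : E) 1,
      ENNReal.ofReal ((2 / (1 - ‖x‖ ^ 2)) ^ Module.finrank ℝ E) * ∫⁻ y, ENNReal.ofReal
        ((if hypDelta x y < ε ^ 2 then 1 else 0) * |f x - f y| ^ p) ∂hypVol E =
      ENNReal.ofReal (ε ^ Module.finrank ℝ E * ε ^ p) *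
        ∫⁻ h, ENNReal.ofReal (scaledDensity (Module.finrank ℝ E) p ε f (x, h)) := by
    intro x hx
    have hx1 : ‖x‖ < 1 := mem_ball_zero_iff.1 hx
    have hmx : Measurable fun y => ENNReal.ofReal ((if hypDelta x y < ε ^ 2 then 1 else 0) *
        |f x - f y| ^ p) := by
      have := hmD.comp (measurable_prodMk_left (x := x))
      simpa only [Function.comp_def] using this
    have hmSx : Measurable fun y => ENNReal.ofReal (scaledDensity (Module.finrank ℝ E) p ε f (x, y)) :=
      hmS.comp (measurable_prodMk_left (x := x))
    have hmi := (measurable_hypDensity.mul hmx).indicator hb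
    have hmic := hmi.comp (f := fun h : E => x + ε • h) (by fun_prop)
    rw [lintegral_hypVol hmx, ← lintegral_indicator hb]
    refine (congrArg _ (lintegral_comp_add_smul hmi x hε)).trans ?_
    rw [ENNReal.ofReal_mul (by positivity), mul_left_comm, mul_assoc, ← lintegral_const_mul _ hmSx]
    congr 1
    refine (lintegral_const_mul _ hmic).symm.trans ?_
    exact lintegral_congr fun h => hypDensity_indicator_eq hε hx1 h
  calc hypEnergy p ε f
      = ∫⁻ x, ∫⁻ y, ENNReal.ofReal
          ((if hypDelta x y < ε ^ 2 then 1 else 0) * |f x - f y| ^ p) ∂hypVol E ∂hypVol E :=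
        lintegral_prod _ hmD.aemeasurable
    _ = _ := lintegral_hypVol hin
    _ = _ := setLIntegral_congr_fun hb hcongr
    _ = _ := lintegral_const_mul _ hmS.lintegral_prod_right'
    _ = _ := congrArg _ (lintegral_prod _ hmS.aemeasurable).symm

end Localization

lemma two_div_one_sub_sq_pow_le {E : Type*} [NormedAddCommGroup E] {ρ : ℝ} (hρ : ρ < 1) {x : E}
    (hx : ‖x‖ ≤ ρ) (d : ℕ) :
    (2 / (1 - ‖x‖ ^ 2)) ^ d ≤ (2 / (1 - ρ ^ 2)) ^ d := by
  have h0 : 0 ≤ ρ := (norm_nonneg x).trans hx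
  have h1 : 0 < 1 - ρ ^ 2 := by nlinarith
  have h2 : 1 - ρ ^ 2 ≤ 1 - ‖x‖ ^ 2 := by nlinarith [norm_nonneg x]
  have := h1.trans_le h2
  gcongr

section LocalLimit

open Filter Topology

variable {E : Type*} [NormedAddCommGroup E] [InnerProductSpace ℝ E]

lemma scaledDensity_le {d : ℕ} {p ε ρ : ℝ} {f : E → ℝ} {K : NNReal} (hf : LipschitzWith K f)
    (hp : 0 < p) (h0 : ∀ x, ρ ≤ ‖x‖ → f x = 0) (hε : 0 < ε) (hερ : ε ≤ (1 - ρ) / 2) {z : E × E} (hz : ‖z.1‖ < 1) :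
    ENNReal.ofReal (scaledDensity d p ε f z) ≤
      (Metric.closedBall (0 : E) ((1 + ρ) / 2) ×ˢ Metric.closedBall (0 : E) 1).indicator
        (fun _ => ENNReal.ofReal ((2 / (1 - ((1 + ρ) / 2) ^ 2)) ^ d *
          ((2 / (1 - ((1 + ρ) / 2) ^ 2)) ^ d * (K : ℝ) ^ p))) z := by
  obtain ⟨x, h⟩ := z
  simp only at hz
  have h1 := one_sub_normSq_pos hz
  by_cases hcond : ‖x + ε • h‖ < 1 ∧ ‖h‖ ^ 2 < (1 - ‖x‖ ^ 2) * (1 - ‖x + ε • h‖ ^ 2)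
  swap
  · rw [scaledDensity, if_neg hcond]
    simp
  have h2 := one_sub_normSq_pos hcond.1
  have hh : ‖h‖ ≤ 1 := by
    have : (1 - ‖x‖ ^ 2) * (1 - ‖x + ε • h‖ ^ 2) ≤ 1 :=
      mul_le_one₀ (by nlinarith [norm_nonneg x]) h2.le (by nlinarith [norm_nonneg (x + ε • h)])
    nlinarith [norm_nonneg h, hcond.2]
  have hd : ‖ε • h‖ ≤ (1 - ρ) / 2 := by
    rw [norm_smul, Real.norm_of_nonneg hε.le]
    nlinarith [norm_nonneg h]
  by_cases hout : ρ ≤ ‖x‖ ∧ ρ ≤ ‖x + ε • h‖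
  · rw [scaledDensity]
    simp [h0 x hout.1, h0 _ hout.2, Real.zero_rpow hp.ne']
  have hxy : ‖x‖ ≤ (1 + ρ) / 2 ∧ ‖x + ε • h‖ ≤ (1 + ρ) / 2 := by
    have e1 := norm_add_le x (ε • h)
    have e2 := norm_sub_norm_le x (-(ε • h))
    rw [sub_neg_eq_add, norm_neg] at e2
    rw [not_and_or, not_le, not_le] at hout
    rcases hout with h3 | h3 <;> constructor <;> linarith
  rw [Set.indicator_of_mem (by simpa using ⟨hxy.1, hh⟩)]
  refine ENNReal.ofReal_le_ofReal ?_
  rw [scaledDensity, if_pos hcond]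
  have hρ' : (1 + ρ) / 2 < 1 := by linarith
  have hL : |ε⁻¹ * (f (x + ε • h) - f x)| ≤ K := by
    have := hf.dist_le_mul (x + ε • h) x
    rw [Real.dist_eq, dist_eq_norm, add_sub_cancel_left, norm_smul, Real.norm_of_nonneg hε.le] at this
    rw [abs_mul, abs_of_pos (inv_pos.2 hε), inv_mul_le_iff₀ hε]
    nlinarith [K.coe_nonneg, mul_nonneg K.coe_nonneg hε.le]
  have b1 := two_div_one_sub_sq_pow_le hρ' hxy.1 d
  have b2 := two_div_one_sub_sq_pow_le hρ' hxy.2 d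
  have b3 := Real.rpow_le_rpow (abs_nonneg _) hL hp.le
  dsimp only
  have b4 : 0 ≤ (2 / (1 - ‖x‖ ^ 2)) ^ d := by positivity
  have b5 : 0 ≤ (2 / (1 - ‖x + ε • h‖ ^ 2)) ^ d := by positivity
  have b6 := b4.trans b1
  gcongr

/-- The integrand of the local limit of the rescaled energies. -/
noncomputable def limitDensity (d : ℕ) (p : ℝ) (f : E → ℝ) (z : E × E) : ℝ :=
  (2 / (1 - ‖z.1‖ ^ 2)) ^ d * ((if ‖z.2‖ < 1 - ‖z.1‖ ^ 2 then
    (2 / (1 - ‖z.1‖ ^ 2)) ^ d else 0) * |fderiv ℝ f z.1 z.2| ^ p)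

lemma tendsto_scaledDensity {d : ℕ} {p : ℝ} (hp : 0 < p) {f : E → ℝ} {z : E × E} (hz : ‖z.1‖ < 1)
    (hf : DifferentiableAt ℝ f z.1) (hz2 : ‖z.2‖ ≠ 1 - ‖z.1‖ ^ 2) :
    Tendsto (fun ε => scaledDensity d p ε f z) (𝓝[>] 0) (𝓝 (limitDensity d p f z)) := by
  obtain ⟨x, h⟩ := z
  simp only at hz hf hz2
  have h1 := one_sub_normSq_pos hz
  have hy : Tendsto (fun ε : ℝ => x + ε • h) (𝓝[>] 0) (𝓝 x) := by
    have : Tendsto (fun ε : ℝ => x + ε • h) (𝓝 0) (𝓝 (x + (0 : ℝ) • h)) :=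
      (continuous_const.add (continuous_id.smul continuous_const)).tendsto 0
    rw [zero_smul, add_zero] at this
    exact this.mono_left nhdsWithin_le_nhds
  have hq : Tendsto (fun ε : ℝ => ε⁻¹ * (f (x + ε • h) - f x)) (𝓝[>] 0) (𝓝 (fderiv ℝ f x h)) := by
    have := (hf.hasFDerivAt.hasLineDerivAt h).tendsto_slope_zero
    exact this.mono_left (nhdsWithin_mono _ fun t ht => (Set.mem_Ioi.1 ht).ne')
  have hw : Tendsto (fun ε : ℝ => (1 - ‖x‖ ^ 2) * (1 - ‖x + ε • h‖ ^ 2)) (𝓝[>] 0)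
      (𝓝 ((1 - ‖x‖ ^ 2) * (1 - ‖x‖ ^ 2))) := ((hy.norm.pow 2).const_sub 1).const_mul _
  have hpow := hq.abs.rpow_const (p := p) (Or.inr hp.le)
  unfold scaledDensity limitDensity
  refine Tendsto.const_mul _ ?_
  rcases lt_or_gt_of_ne hz2 with hlt | hgt
  · rw [if_pos hlt]
    have hev : ∀ᶠ ε in 𝓝[>] (0 : ℝ), ‖x + ε • h‖ < 1 ∧
        ‖h‖ ^ 2 < (1 - ‖x‖ ^ 2) * (1 - ‖x + ε • h‖ ^ 2) :=
      (hy.norm.eventually_lt_const hz).and (hw.eventually_const_lt (by nlinarith [norm_nonneg h]))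
    have hW : Tendsto (fun ε : ℝ => (2 / (1 - ‖x + ε • h‖ ^ 2)) ^ d) (𝓝[>] 0)
        (𝓝 ((2 / (1 - ‖x‖ ^ 2)) ^ d)) :=
      (tendsto_const_nhds.div ((hy.norm.pow 2).const_sub 1) h1.ne').pow d
    refine (hW.mul hpow).congr' ?_
    filter_upwards [hev] with ε hε
    rw [if_pos hε]
  · rw [if_neg (not_lt.2 hgt.le), zero_mul]
    refine tendsto_const_nhds.congr' ?_
    filter_upwards [hw.eventually_lt_const (u := ‖h‖ ^ 2) (by nlinarith)] with ε hε
    rw [if_neg (fun hc => hε.not_gt hc.2), zero_mul]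

variable [MeasurableSpace E] [BorelSpace E] [FiniteDimensional ℝ E]

lemma tendsto_lintegral_scaledDensity [Nontrivial E] {d : ℕ} {p ρ : ℝ} {f : E → ℝ} {K : NNReal}
    (hf : LipschitzWith K f) (hp : 0 < p) (hρ1 : ρ < 1) (h0 : ∀ x, ρ ≤ ‖x‖ → f x = 0) :
    Tendsto (fun ε => ∫⁻ z, ENNReal.ofReal (scaledDensity d p ε f z)
        ∂((volume.restrict (Metric.ball (0 : E) 1)).prod volume)) (𝓝[>] 0)
      (𝓝 (∫⁻ z, ENNReal.ofReal (limitDensity d p f z)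
        ∂((volume.restrict (Metric.ball (0 : E) 1)).prod volume))) := by
  have hball : ∀ᵐ z ∂((volume.restrict (Metric.ball (0 : E) 1)).prod (volume : Measure E)),
      ‖z.1‖ < 1 := by
    refine Measure.quasiMeasurePreserving_fst.ae (p := fun x : E => ‖x‖ < 1) ?_
    filter_upwards [ae_restrict_mem Metric.isOpen_ball.measurableSet] with x hx
    simpa using hx
  refine tendsto_lintegral_filter_of_dominated_convergence
    ((Metric.closedBall (0 : E) ((1 + ρ) / 2) ×ˢ Metric.closedBall (0 : E) 1).indicator
        (fun _ => ENNReal.ofReal ((2 / (1 - ((1 + ρ) / 2) ^ 2)) ^ d *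
          ((2 / (1 - ((1 + ρ) / 2) ^ 2)) ^ d * (K : ℝ) ^ p)))) ?_ ?_ ?_ ?_
  · exact .of_forall fun ε => (measurable_scaledDensity hf.continuous.measurable).ennreal_ofReal
  · have : Set.Ioc 0 ((1 - ρ) / 2) ∈ 𝓝[>] (0 : ℝ) := Ioc_mem_nhdsGT (by linarith)
    filter_upwards [this] with ε hε
    filter_upwards [hball] with z hz
    exact scaledDensity_le hf hp h0 hε.1 hε.2 hz
  · rw [lintegral_indicator_const (Metric.isClosed_closedBall.measurableSet.prod
      Metric.isClosed_closedBall.measurableSet), Measure.prod_prod]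
    refine ENNReal.mul_ne_top ENNReal.ofReal_ne_top (ENNReal.mul_ne_top ?_ measure_closedBall_lt_top.ne)
    exact ((Measure.restrict_apply_le _ _).trans_lt measure_closedBall_lt_top).ne
  · have hdiff : ∀ᵐ z ∂((volume.restrict (Metric.ball (0 : E) 1)).prod (volume : Measure E)),
        DifferentiableAt ℝ f z.1 :=
      Measure.quasiMeasurePreserving_fst.ae (ae_restrict_of_ae hf.ae_differentiableAt)
    have hsphere : ∀ᵐ z ∂((volume.restrict (Metric.ball (0 : E) 1)).prod (volume : Measure E)),
        ‖z.2‖ ≠ 1 - ‖z.1‖ ^ 2 := by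
      refine (Measure.ae_prod_mem_iff_ae_ae_mem (s := {z : E × E | ‖z.2‖ ≠ 1 - ‖z.1‖ ^ 2}) ?_).2 ?_
      · exact (measurableSet_eq_fun (by fun_prop) (by fun_prop)).compl
      · refine .of_forall fun x => ?_
        have := Measure.addHaar_sphere (volume : Measure E) 0 (1 - ‖x‖ ^ 2)
        rw [measure_eq_zero_iff_ae_notMem] at this
        filter_upwards [this] with h hh
        simpa using hh
    filter_upwards [hball, hdiff, hsphere] with z h1 h2 h3
    exact (ENNReal.continuous_ofReal.tendsto _).comp (tendsto_scaledDensity hp h1 h2 h3)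

end LocalLimit

section LocalEnergy

open Filter Topology

variable {E : Type*} [NormedAddCommGroup E] [InnerProductSpace ℝ E] [MeasurableSpace E] [BorelSpace E]
  [FiniteDimensional ℝ E] [Nontrivial E]

lemma exists_lintegral_ball_abs_rpow_eq {p : ℝ} (hp : 0 < p) : ∃ c : ENNReal, c ≠ 0 ∧ c ≠ ⊤ ∧
    ∀ l : E →L[ℝ] ℝ, ∫⁻ h, ENNReal.ofReal ((if ‖h‖ < 1 then 1 else 0) * |l h| ^ p) =
      c * ENNReal.ofReal (‖l‖ ^ p) := by
  have hmeas : ∀ v : E, Measurable fun h : E =>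
      ENNReal.ofReal ((if ‖h‖ < 1 then 1 else 0) * |inner ℝ v h| ^ p) := fun v =>
    ((Measurable.ite (measurableSet_lt measurable_norm measurable_const) measurable_const
      measurable_const).mul (by fun_prop)).ennreal_ofReal
  obtain ⟨e, he⟩ := exists_norm_eq E zero_le_one
  refine ⟨∫⁻ h, ENNReal.ofReal ((if ‖h‖ < 1 then 1 else 0) * |inner ℝ e h| ^ p), ?_, ?_, ?_⟩
  · rw [Ne, lintegral_eq_zero_iff (hmeas e)]
    intro hae
    have hd := Measure.dense_of_ae hae
    have hc : Continuous fun h : E => inner ℝ e h := by fun_prop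
    have hopen : IsOpen {h : E | ‖h‖ < 1 ∧ 0 < inner ℝ e h} :=
      (isOpen_lt continuous_norm continuous_const).inter (isOpen_lt continuous_const hc)
    obtain ⟨h, h1, h2⟩ := hd.exists_mem_open hopen ⟨(1 / 2 : ℝ) • e, by
      rw [norm_smul, he]; norm_num, by
      rw [inner_smul_right, real_inner_self_eq_norm_sq, he]; norm_num⟩
    have h3 : 0 < |inner ℝ e h| ^ p := Real.rpow_pos_of_pos (abs_pos.2 h2.2.ne') p
    have h4 : ENNReal.ofReal ((if ‖h‖ < 1 then 1 else 0) * |inner ℝ e h| ^ p) = 0 := h1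
    rw [if_pos h2.1, one_mul, ENNReal.ofReal_eq_zero] at h4
    linarith
  · refine ne_of_lt (lt_of_le_of_lt (b := ∫⁻ h, (Metric.ball (0 : E) 1).indicator 1 h)
      (lintegral_mono fun h => ?_) ?_)
    · by_cases hh : ‖h‖ < 1
      · rw [Set.indicator_of_mem (by simpa using hh), if_pos hh, one_mul]
        refine ENNReal.ofReal_le_one.2 (Real.rpow_le_one (abs_nonneg _) ?_ hp.le)
        exact (abs_real_inner_le_norm e h).trans (by rw [he, one_mul]; exact hh.le)
      · simp [hh]
    · rw [lintegral_indicator_one Metric.isOpen_ball.measurableSet]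
      exact measure_ball_lt_top
  · intro l
    obtain ⟨v, rfl⟩ := (InnerProductSpace.toDual ℝ E).surjective l
    simp only [InnerProductSpace.toDual_apply_apply, LinearIsometryEquiv.norm_map]
    have hnorm : ‖v‖ = ‖‖v‖ • e‖ := by rw [norm_smul, he, norm_norm, mul_one]
    have hT := Submodule.reflection_sub hnorm
    set T := (Submodule.span ℝ {v - ‖v‖ • e})ᗮ.reflection
    have hmT : Measurable fun h : E =>
        ENNReal.ofReal ((if ‖T h‖ < 1 then 1 else 0) * |inner ℝ e (T h)| ^ p) :=
      (hmeas e).comp T.continuous.measurable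
    rw [← T.measurePreserving.lintegral_comp (hmeas e), ← lintegral_mul_const _ hmT]
    refine lintegral_congr fun h => ?_
    have hin : inner ℝ v h = ‖v‖ * inner ℝ e (T h) := by
      rw [← T.inner_map_map v h, hT, real_inner_smul_left]
    rw [hin, T.norm_map, abs_mul, abs_norm, Real.mul_rpow (norm_nonneg _) (abs_nonneg _),
      ← ENNReal.ofReal_mul (by positivity)]
    congr 1
    ring

lemma lintegral_limitDensity {p : ℝ} (hp : 0 < p) : ∃ c : ENNReal, c ≠ 0 ∧ c ≠ ⊤ ∧
    ∀ f : E → ℝ, ∫⁻ z, ENNReal.ofReal (limitDensity (Module.finrank ℝ E) p f z)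
        ∂((volume.restrict (Metric.ball (0 : E) 1)).prod volume) =
      c * ∫⁻ x in Metric.ball (0 : E) 1, ENNReal.ofReal (((1 - ‖x‖ ^ 2) / 2) ^ p * ‖fderiv ℝ f x‖ ^ p *
        (2 / (1 - ‖x‖ ^ 2)) ^ Module.finrank ℝ E) := by
  set d := Module.finrank ℝ E with hd
  obtain ⟨c, hc0, hct, hc⟩ := exists_lintegral_ball_abs_rpow_eq (E := E) hp
  refine ⟨c * ENNReal.ofReal (2 ^ d * 2 ^ p), ?_, ?_, fun f => ?_⟩
  · exact mul_ne_zero hc0 (by rw [Ne, ENNReal.ofReal_eq_zero, not_le]; positivity)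
  · exact ENNReal.mul_ne_top hct ENNReal.ofReal_ne_top
  have hfm : Measurable (fderiv ℝ f) := measurable_fderiv ℝ f
  have hm : Measurable fun z : E × E => ENNReal.ofReal (limitDensity d p f z) := by
    have h1 : MeasurableSet {z : E × E | ‖z.2‖ < 1 - ‖z.1‖ ^ 2} :=
      measurableSet_lt (by fun_prop) (by fun_prop)
    have h2 : Measurable fun z : E × E => fderiv ℝ f z.1 z.2 := by
      exact (isBoundedBilinearMap_apply (𝕜 := ℝ) (E := E) (F := ℝ)).continuous.measurable.comp
        ((hfm.comp measurable_fst).prodMk measurable_snd)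
    unfold limitDensity
    exact (Measurable.mul (by fun_prop) (Measurable.mul (Measurable.ite h1 (by fun_prop)
      (by fun_prop)) (by fun_prop))).ennreal_ofReal
  rw [lintegral_prod _ hm.aemeasurable, ← lintegral_const_mul _ (by fun_prop)]
  refine setLIntegral_congr_fun Metric.isOpen_ball.measurableSet fun x hx => ?_
  have hx1 : ‖x‖ < 1 := mem_ball_zero_iff.1 hx
  have hR := one_sub_normSq_pos hx1
  set R := 1 - ‖x‖ ^ 2 with hRdef
  set l := fderiv ℝ f x with hl
  have hmx : Measurable fun h : E => ENNReal.ofReal (limitDensity d p f (x, h)) :=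
    hm.comp (measurable_prodMk_left (x := x))
  have hml : Measurable fun h : E => ENNReal.ofReal ((if ‖h‖ < 1 then 1 else 0) * |l h| ^ p) :=
    ((Measurable.ite (measurableSet_lt measurable_norm measurable_const) measurable_const
      measurable_const).mul (by fun_prop)).ennreal_ofReal
  have hscale : ∀ h : E, ENNReal.ofReal (limitDensity d p f (x, 0 + R • h)) =
      ENNReal.ofReal ((2 / R) ^ d * (2 / R) ^ d * R ^ p) *
        ENNReal.ofReal ((if ‖h‖ < 1 then 1 else 0) * |l h| ^ p) := by
    intro h
    rw [← ENNReal.ofReal_mul (by positivity)]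
    congr 1
    simp only [limitDensity, zero_add, norm_smul, Real.norm_of_nonneg hR.le, ← hRdef, ← hl, map_smul,
      smul_eq_mul, abs_mul, abs_of_pos hR, Real.mul_rpow hR.le (abs_nonneg _),
      mul_lt_iff_lt_one_right hR]
    split_ifs <;> ring
  rw [lintegral_comp_add_smul hmx 0 hR, lintegral_congr hscale, lintegral_const_mul _ hml, hc,
    ← mul_assoc, ← ENNReal.ofReal_mul (by positivity), mul_left_comm, mul_assoc,
    ← ENNReal.ofReal_mul (by positivity), mul_assoc c, ← ENNReal.ofReal_mul (by positivity)]
  congr 2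
  rw [← hd, Real.div_rpow hR.le (by norm_num), div_pow]
  field_simp

lemma lintegral_energy_le {p ρ : ℝ} {f u : E → ℝ} {K K' : NNReal} (hp : 0 < p) (hρ1 : ρ < 1)
    (hf : LipschitzWith K f) (hf0 : ∀ x, ρ ≤ ‖x‖ → f x = 0)
    (hu : LipschitzWith K' u) (hu0 : ∀ x, ρ ≤ ‖x‖ → u x = 0)
    (hle : ∀ ε, 0 < ε → hypEnergy p ε f ≤ hypEnergy p ε u) :
    ∫⁻ x in Metric.ball (0 : E) 1, ENNReal.ofReal (((1 - ‖x‖ ^ 2) / 2) ^ p * ‖fderiv ℝ f x‖ ^ p *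
        (2 / (1 - ‖x‖ ^ 2)) ^ Module.finrank ℝ E) ≤
      ∫⁻ x in Metric.ball (0 : E) 1, ENNReal.ofReal (((1 - ‖x‖ ^ 2) / 2) ^ p * ‖fderiv ℝ u x‖ ^ p *
        (2 / (1 - ‖x‖ ^ 2)) ^ Module.finrank ℝ E) := by
  obtain ⟨c, hc0, hct, hc⟩ := lintegral_limitDensity (E := E) hp
  have h1 := tendsto_lintegral_scaledDensity (d := Module.finrank ℝ E) hf hp hρ1 hf0
  have h2 := tendsto_lintegral_scaledDensity (d := Module.finrank ℝ E) hu hp hρ1 hu0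
  have h3 := le_of_tendsto_of_tendsto h1 h2 (by
    filter_upwards [self_mem_nhdsWithin] with ε hε
    have hε0 : (0 : ℝ) < ε := hε
    have h := hle ε hε0
    rw [hypEnergy_eq hε0 hf.continuous.measurable, hypEnergy_eq hε0 hu.continuous.measurable] at h
    refine (ENNReal.mul_le_mul_iff_right ?_ ENNReal.ofReal_ne_top).1 h
    rw [Ne, ENNReal.ofReal_eq_zero, not_le]
    positivity)
  rw [hc, hc] at h3
  exact (ENNReal.mul_le_mul_iff_right hc0 hct).1 h3

end LocalEnergy

section Comparison

variable {E : Type*} [NormedAddCommGroup E] [InnerProductSpace ℝ E] [MeasurableSpace E] [BorelSpace E]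
  [FiniteDimensional ℝ E]

lemma HypCompetitor.abs_self {p ρ B : ℝ} {u : E → ℝ} {K : NNReal} (hu : LipschitzWith K u)
    (hB : ∀ x, |u x| ≤ B) (hu0 : ∀ x, ρ ≤ ‖x‖ → u x = 0) :
    HypCompetitor p K B ρ (fun x => |u x|) fun x => |u x| where
  nonneg x := abs_nonneg _
  le_bound := hB
  zero x hx := by rw [hu0 x hx, abs_zero]
  lip x y hx hy := by
    refine (abs_abs_sub_abs_le _ _).trans ((Real.dist_eq (u x) (u y)).symm.le.trans ?_)
    refine (hu.dist_le_mul x y).trans ?_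
    rw [dist_eq_norm]
    exact mul_le_mul_of_nonneg_left (norm_sub_le_sqrt_hypDelta hx hy) K.coe_nonneg
  norm_eq _ _ := rfl
  energy_le _ _ := le_rfl

lemma hypEnergy_abs_le {p ε : ℝ} (hp : 0 ≤ p) (u : E → ℝ) :
    hypEnergy p ε (fun x => |u x|) ≤ hypEnergy p ε u :=
  lintegral_mono fun z => ENNReal.ofReal_le_ofReal <| mul_le_mul_of_nonneg_left
    (Real.rpow_le_rpow (abs_nonneg _) (abs_abs_sub_abs_le _ _) hp) (by split_ifs <;> norm_num)

/-- Hyperbolic symmetrization of a compactly supported Lipschitz function. -/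
lemma exists_radial_comparison [Nontrivial E] {p ρ B : ℝ} {u : E → ℝ} {K : NNReal} (hp : 1 ≤ p)
    (hρ0 : 0 < ρ) (hρ : ρ < 1) (hu : LipschitzWith K u) (hB : ∀ x, |u x| ≤ B)
    (hu0 : ∀ x, ρ ≤ ‖x‖ → u x = 0) :
    ∃ (f : E → ℝ) (K' : NNReal), LipschitzWith K' f ∧ (∀ x, 0 ≤ f x) ∧ (∀ x, ρ ≤ ‖x‖ → f x = 0) ∧
      (∀ x y, ‖x‖ ≤ ‖y‖ → f y ≤ f x) ∧
      (∀ s : ℝ, 0 < s → ∫⁻ x in Metric.ball (0 : E) 1,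
        ENNReal.ofReal (f x ^ s * (2 / (1 - ‖x‖ ^ 2)) ^ Module.finrank ℝ E) =
        ∫⁻ x in Metric.ball (0 : E) 1,
          ENNReal.ofReal (|u x| ^ s * (2 / (1 - ‖x‖ ^ 2)) ^ Module.finrank ℝ E)) ∧
      ∫⁻ x in Metric.ball (0 : E) 1, ENNReal.ofReal (((1 - ‖x‖ ^ 2) / 2) ^ p * ‖fderiv ℝ f x‖ ^ p *
          (2 / (1 - ‖x‖ ^ 2)) ^ Module.finrank ℝ E) ≤
        ∫⁻ x in Metric.ball (0 : E) 1, ENNReal.ofReal (((1 - ‖x‖ ^ 2) / 2) ^ p * ‖fderiv ℝ u x‖ ^ p *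
          (2 / (1 - ‖x‖ ^ 2)) ^ Module.finrank ℝ E) := by
  have hp0 : 0 < p := by linarith
  obtain ⟨f, hf, hmax⟩ := (HypCompetitor.abs_self (p := p) hu hB hu0).exists_maximizer hp0.le
    K.coe_nonneg hρ0 hρ
  have hfL := hf.lipschitzWith K.coe_nonneg hρ0 hρ
  refine ⟨f, _, hfL, hf.nonneg, hf.zero,
    fun x y hxy => hf.antitone_norm_of_maximizer hmax hp K.coe_nonneg hρ0 hρ hxy, fun s hs => ?_,
    lintegral_energy_le hp0 hρ hfL hf.zero hu hu0
      fun ε hε => (hf.energy_le ε hε).trans (hypEnergy_abs_le hp0.le u)⟩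
  have h := hf.norm_eq s hs
  have hfm := hfL.continuous.measurable
  have hum := hu.continuous.measurable
  rw [lintegral_hypVol (by fun_prop), lintegral_hypVol (by fun_prop)] at h
  have key : ∀ v : E → ℝ, (∀ x, 0 ≤ v x) → ∫⁻ x in Metric.ball (0 : E) 1,
      ENNReal.ofReal (v x ^ s * (2 / (1 - ‖x‖ ^ 2)) ^ Module.finrank ℝ E) =
      ∫⁻ x in Metric.ball (0 : E) 1,
        ENNReal.ofReal ((2 / (1 - ‖x‖ ^ 2)) ^ Module.finrank ℝ E) * ENNReal.ofReal (v x ^ s) :=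
    fun v hv => lintegral_congr fun x => by
      rw [ENNReal.ofReal_mul (Real.rpow_nonneg (hv x) s), mul_comm]
  rw [key f hf.nonneg, h, ← key _ fun x => abs_nonneg (u x)]

end Comparison

section Profile

variable {E : Type*} [NormedAddCommGroup E] [InnerProductSpace ℝ E]

lemma LipschitzWith.comp_smul_of_norm_eq_one {f : E → ℝ} {K : NNReal} (hf : LipschitzWith K f) {e : E}
    (he : ‖e‖ = 1) : LipschitzWith K fun r : ℝ => f (r • e) := by
  refine LipschitzWith.of_dist_le_mul fun r s => (hf.dist_le_mul _ _).trans (le_of_eq ?_)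
  rw [dist_eq_norm, dist_eq_norm, ← sub_smul, norm_smul, he, mul_one]

lemma abs_deriv_profile_le {f : E → ℝ} {e x : E} (he : ‖e‖ = 1)
    (hrad : ∀ x y : E, ‖x‖ = ‖y‖ → f x = f y) (hx : x ≠ 0) (hd : DifferentiableAt ℝ f x) :
    |deriv (fun r : ℝ => f (r • e)) ‖x‖| ≤ ‖fderiv ℝ f x‖ := by
  have hx0 : ‖x‖ ≠ 0 := norm_ne_zero_iff.2 hx
  have hv : ‖‖x‖⁻¹ • x‖ = 1 := by rw [norm_smul, norm_inv, norm_norm, inv_mul_cancel₀ hx0]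
  have heq : (fun r : ℝ => f (r • e)) = fun r : ℝ => f (r • ‖x‖⁻¹ • x) :=
    funext fun r => hrad _ _ (by rw [norm_smul, norm_smul, he, hv])
  have hxx : ‖x‖ • ‖x‖⁻¹ • x = x := smul_inv_smul₀ hx0 x
  have h1 : HasDerivAt (fun r : ℝ => r • ‖x‖⁻¹ • x) (‖x‖⁻¹ • x) ‖x‖ := by
    simpa using (hasDerivAt_id ‖x‖).smul_const (‖x‖⁻¹ • x)
  have h2 : HasFDerivAt f (fderiv ℝ f x) (‖x‖ • ‖x‖⁻¹ • x) := by rw [hxx]; exact hd.hasFDerivAt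
  have h3 : HasDerivAt (fun r : ℝ => f (r • ‖x‖⁻¹ • x)) _ ‖x‖ := h2.comp_hasDerivAt _ h1
  rw [heq, h3.deriv]
  simpa [hv] using (fderiv ℝ f x).le_opNorm (‖x‖⁻¹ • x)

end Profile

section Polar

lemma setIntegral_ball_norm {m : ℕ} {ρ : ℝ} (hρ0 : 0 ≤ ρ) (hρ1 : ρ < 1) {F : ℝ → ℝ}
    (hF : ∀ r, ρ < r → F r = 0) :
    ∫ x in Metric.ball (0 : EuclideanSpace ℝ (Fin (m + 1))) 1, F ‖x‖ =
      (m + 1) * unitBallVol (m + 1) * ∫ r in (0 : ℝ)..ρ, r ^ m * F r := by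
  have h1 : ∫ x in Metric.ball (0 : EuclideanSpace ℝ (Fin (m + 1))) 1, F ‖x‖ =
      ∫ x : EuclideanSpace ℝ (Fin (m + 1)), F ‖x‖ := by
    refine setIntegral_eq_integral_of_forall_compl_eq_zero fun x hx => hF _ ?_
    rw [mem_ball_zero_iff, not_lt] at hx
    linarith
  have h2 : ∫ r in Set.Ioi (0 : ℝ), r ^ m • F r = ∫ r in (0 : ℝ)..ρ, r ^ m * F r := by
    rw [intervalIntegral.integral_of_le hρ0]
    refine (setIntegral_eq_of_subset_of_forall_sdiff_eq_zero measurableSet_Ioi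
      Set.Ioc_subset_Ioi_self fun r hr => ?_).trans rfl
    rw [hF r (lt_of_not_ge fun h => hr.2 ⟨hr.1, h⟩), smul_zero]
  have hΓ : 0 < Real.Gamma (((m + 1 : ℕ) : ℝ) / 2 + 1) := Real.Gamma_pos_of_pos (by positivity)
  have h3 : (volume : Measure (EuclideanSpace ℝ (Fin (m + 1)))).real (Metric.ball 0 1) =
      unitBallVol (m + 1) := by
    rw [Measure.real, EuclideanSpace.volume_ball, Fintype.card_fin, ENNReal.ofReal_one, one_pow, one_mul,
      ENNReal.toReal_ofReal (div_nonneg (by positivity) hΓ.le),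
      unitBallVol, Real.sqrt_eq_rpow, ← Real.rpow_mul_natCast Real.pi_pos.le]
    congr 2
    ring
  rw [h1, integral_fun_norm_addHaar, finrank_euclideanSpace_fin, Nat.add_sub_cancel, h2, h3]
  simp [mul_assoc]

lemma setIntegral_ball_radial_rpow {m : ℕ} {ρ s : ℝ} (hρ0 : 0 ≤ ρ) (hρ1 : ρ < 1) (hs : s ≠ 0) {φ : ℝ → ℝ}
    (hφ : ∀ r, ρ < r → φ r = 0) :
    ∫ x in Metric.ball (0 : EuclideanSpace ℝ (Fin (m + 1))) 1,
        φ ‖x‖ ^ s * (2 / (1 - ‖x‖ ^ 2)) ^ (m + 1) =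
      unitBallVol (m + 1) * ∫ r in (0 : ℝ)..ρ, φ r ^ s * radDens m r := by
  rw [setIntegral_ball_norm (F := fun r => φ r ^ s * (2 / (1 - r ^ 2)) ^ (m + 1)) hρ0 hρ1
    fun r hr => by simp [hφ r hr, hs], mul_comm ((m : ℝ) + 1), mul_assoc,
    ← intervalIntegral.integral_const_mul]
  congr 2
  ext r
  unfold radDens hypSinh confFactor
  rw [show 2 * r / (1 - r ^ 2) = r * (2 / (1 - r ^ 2)) by ring]
  ring

lemma setIntegral_ball_radial_energy {m : ℕ} {ρ p : ℝ} (hρ0 : 0 ≤ ρ) (hρ1 : ρ < 1) (hp : p ≠ 0) {φ : ℝ → ℝ}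
    (hφ : ∀ r, ρ < r → φ r = 0) :
    ∫ x in Metric.ball (0 : EuclideanSpace ℝ (Fin (m + 1))) 1,
        ((1 - ‖x‖ ^ 2) / 2) ^ p * |deriv φ ‖x‖| ^ p * (2 / (1 - ‖x‖ ^ 2)) ^ (m + 1) =
      unitBallVol (m + 1) * (m + 1) ^ p *
        ∫ r in (0 : ℝ)..ρ, |deriv φ r| ^ p * radDens m r ^ (1 - p) * hypSinh r ^ (m * p) := by
  have hd : ∀ r, ρ < r → deriv φ r = 0 := fun r hr => by
    have : φ =ᶠ[nhds r] fun _ => (0 : ℝ) := by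
      filter_upwards [lt_mem_nhds hr] with s hs using hφ s hs
    rw [this.deriv_eq, deriv_const]
  rw [setIntegral_ball_norm (F := fun r => ((1 - r ^ 2) / 2) ^ p * |deriv φ r| ^ p *
    (2 / (1 - r ^ 2)) ^ (m + 1)) hρ0 hρ1 fun r hr => by simp [hd r hr, hp],
    mul_comm ((m : ℝ) + 1), mul_assoc, mul_assoc]
  congr 1
  rw [← intervalIntegral.integral_const_mul, ← intervalIntegral.integral_const_mul]
  refine intervalIntegral.integral_congr_ae (Filter.Eventually.of_forall fun r hr => ?_)
  rw [Set.uIoc_of_le hρ0] at hr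
  have hr0 := hr.1
  have hR : 0 < 1 - r ^ 2 := by nlinarith [hr.2]
  have hw : 0 < 2 / (1 - r ^ 2) := by positivity
  have hm : (0 : ℝ) < m + 1 := by positivity
  unfold radDens hypSinh confFactor
  rw [show 2 * r / (1 - r ^ 2) = r * (2 / (1 - r ^ 2)) by ring,
    show (1 - r ^ 2) / 2 = (2 / (1 - r ^ 2))⁻¹ by rw [inv_div], Real.inv_rpow hw.le]
  set w := 2 / (1 - r ^ 2)
  rw [Real.rpow_natCast_mul (by positivity), Real.mul_rpow (by positivity) hw.le,
    Real.mul_rpow hm.le (by positivity), Real.rpow_sub hm, Real.rpow_sub (by positivity),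
    Real.rpow_sub hw, Real.rpow_one, Real.rpow_one, Real.rpow_one]
  have h1 : 0 < ((m : ℝ) + 1) ^ p := by positivity
  have h2 : 0 < ((r * w) ^ m) ^ p := by positivity
  have h3 : 0 < w ^ p := by positivity
  field_simp
  ring

end Polar

lemma exists_radial_profile {m : ℕ} {p ρ B : ℝ} {u : EuclideanSpace ℝ (Fin (m + 1)) → ℝ} {K : NNReal}
    (hp : 1 ≤ p) (hρ0 : 0 < ρ) (hρ : ρ < 1) (hu : LipschitzWith K u) (hB : ∀ x, |u x| ≤ B)
    (hu0 : ∀ x, ρ ≤ ‖x‖ → u x = 0) (hne : ∃ x, u x ≠ 0)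
    (hfin : ∫⁻ x in Metric.ball (0 : EuclideanSpace ℝ (Fin (m + 1))) 1, ENNReal.ofReal
      (((1 - ‖x‖ ^ 2) / 2) ^ p * ‖fderiv ℝ u x‖ ^ p * (2 / (1 - ‖x‖ ^ 2)) ^ (m + 1)) ≠ ⊤) :
    ∃ (φ : ℝ → ℝ) (K' : NNReal), LipschitzWith K' φ ∧ (∀ r, 0 ≤ φ r) ∧ 0 < φ 0 ∧ φ ρ = 0 ∧
      (∀ s : ℝ, 0 < s → ∫ x in Metric.ball (0 : EuclideanSpace ℝ (Fin (m + 1))) 1,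
          |u x| ^ s * (2 / (1 - ‖x‖ ^ 2)) ^ (m + 1) =
        unitBallVol (m + 1) * ∫ r in (0 : ℝ)..ρ, φ r ^ s * radDens m r) ∧
      unitBallVol (m + 1) * (m + 1) ^ p *
          ∫ r in (0 : ℝ)..ρ, |deriv φ r| ^ p * radDens m r ^ (1 - p) * hypSinh r ^ (m * p) ≤
        ∫ x in Metric.ball (0 : EuclideanSpace ℝ (Fin (m + 1))) 1,
          ((1 - ‖x‖ ^ 2) / 2) ^ p * ‖fderiv ℝ u x‖ ^ p * (2 / (1 - ‖x‖ ^ 2)) ^ (m + 1) := by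
  have hp0 : 0 < p := by linarith
  obtain ⟨f, K', hf, hf_nonneg, hf0, hanti, hnorm, hen⟩ := exists_radial_comparison hp hρ0 hρ hu hB hu0
  rw [finrank_euclideanSpace_fin] at hen
  simp only [finrank_euclideanSpace_fin] at hnorm
  obtain ⟨e, he⟩ := exists_norm_eq (EuclideanSpace ℝ (Fin (m + 1))) zero_le_one
  have hrad : ∀ x y, ‖x‖ = ‖y‖ → f x = f y := fun x y h => le_antisymm (hanti _ _ h.ge) (hanti _ _ h.le)
  set φ : ℝ → ℝ := fun r => f (r • e) with hφdef
  have hφ : LipschitzWith K' φ := hf.comp_smul_of_norm_eq_one he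
  have hφf : ∀ x, φ ‖x‖ = f x := fun x => hrad _ _ (by rw [norm_smul, he, norm_norm, mul_one])
  have hφ0 : ∀ r, ρ ≤ r → φ r = 0 := fun r hr =>
    hf0 _ (by rw [norm_smul, he, mul_one]; exact hr.trans (le_abs_self r))
  have hmf := hf.continuous.measurable
  have hmu := hu.continuous.measurable
  have hball : MeasurableSet (Metric.ball (0 : EuclideanSpace ℝ (Fin (m + 1))) 1) :=
    Metric.isOpen_ball.measurableSet
  have hw : ∀ x ∈ Metric.ball (0 : EuclideanSpace ℝ (Fin (m + 1))) 1, 0 < 2 / (1 - ‖x‖ ^ 2) :=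
    fun x hx => div_pos two_pos (one_sub_normSq_pos (mem_ball_zero_iff.1 hx))
  refine ⟨φ, K', hφ, fun r => hf_nonneg _, ?_, hφ0 ρ le_rfl, fun s hs => ?_, ?_⟩
  · refine (hf_nonneg _).lt_of_ne fun h0 => ?_
    have hfz : ∀ x, f x = 0 := fun x => le_antisymm
      ((hanti ((0 : ℝ) • e) x (by simp)).trans h0.ge) (hf_nonneg x)
    have h1 := (hnorm 1 one_pos).symm
    simp only [hfz, Real.rpow_one, zero_mul, ENNReal.ofReal_zero, lintegral_zero] at h1
    rw [lintegral_eq_zero_iff (by fun_prop)] at h1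
    obtain ⟨x₀, hx₀⟩ := hne
    have hx1 : ‖x₀‖ < 1 := by
      by_contra! h
      exact hx₀ (hu0 x₀ (hρ.le.trans h))
    have h2 := (ae_restrict_iff' hball).1 h1
    obtain ⟨y, hy1, hy2, hy3⟩ := (Measure.dense_of_ae h2).exists_mem_open
      (Metric.isOpen_ball.inter (isOpen_ne_fun hu.continuous continuous_const))
      ⟨x₀, mem_ball_zero_iff.2 hx1, hx₀⟩
    have h3 := hy1 hy2
    have := hw y hy2
    have h4 : 0 < |u y| := abs_pos.2 hy3
    simp only [Pi.zero_apply, ENNReal.ofReal_eq_zero] at h3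
    have : 0 < |u y| * (2 / (1 - ‖y‖ ^ 2)) ^ (m + 1) := by positivity
    linarith
  · rw [← setIntegral_ball_radial_rpow hρ0.le hρ hs.ne' fun r hr => hφ0 r hr.le,
      integral_eq_lintegral_of_nonneg_ae, integral_eq_lintegral_of_nonneg_ae]
    · simp only [hφf, hnorm s hs]
    · refine (ae_restrict_iff' hball).2 (Filter.Eventually.of_forall fun x hx => ?_)
      have := hw x hx
      have := hf_nonneg (‖x‖ • e)
      exact mul_nonneg (Real.rpow_nonneg this _) (by positivity)
    · simp only [hφf]
      exact Measurable.aestronglyMeasurable (by fun_prop)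
    · refine (ae_restrict_iff' hball).2 (Filter.Eventually.of_forall fun x hx => ?_)
      have := hw x hx
      exact mul_nonneg (by positivity) (by positivity)
    · exact Measurable.aestronglyMeasurable (by fun_prop)
  · have hmd := measurable_deriv φ
    have hmfd := measurable_fderiv ℝ u
    rw [← setIntegral_ball_radial_energy hρ0.le hρ hp0.ne' fun r hr => hφ0 r hr.le,
      integral_eq_lintegral_of_nonneg_ae, integral_eq_lintegral_of_nonneg_ae]
    · refine ENNReal.toReal_mono hfin (le_trans ?_ hen)
      refine setLIntegral_mono_ae' hball ?_
      filter_upwards [hf.ae_differentiableAt, Measure.ae_ne volume 0] with x hd hx0 hx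
      have := hw x hx
      have hR := one_sub_normSq_pos (mem_ball_zero_iff.1 hx)
      have := abs_deriv_profile_le he hrad hx0 hd
      refine ENNReal.ofReal_le_ofReal ?_
      gcongr
    · refine (ae_restrict_iff' hball).2 (Filter.Eventually.of_forall fun x hx => ?_)
      have := hw x hx
      have hR := one_sub_normSq_pos (mem_ball_zero_iff.1 hx)
      exact mul_nonneg (by positivity) (by positivity)
    · exact Measurable.aestronglyMeasurable (by fun_prop)
    · refine (ae_restrict_iff' hball).2 (Filter.Eventually.of_forall fun x hx => ?_)
      have := hw x hx
      have hR := one_sub_normSq_pos (mem_ball_zero_iff.1 hx)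
      exact mul_nonneg (by positivity) (by positivity)
    · exact Measurable.aestronglyMeasurable (by fun_prop)

lemma integrable_energy_of_contDiff {m : ℕ} {p : ℝ} (hp : 0 < p)
    {u : EuclideanSpace ℝ (Fin (m + 1)) → ℝ} (hu : ContDiff ℝ 1 u)
    (hsupp : tsupport u ⊆ Metric.ball 0 1) (hc : HasCompactSupport u) :
    Integrable fun x =>
      ((1 - ‖x‖ ^ 2) / 2) ^ p * ‖fderiv ℝ u x‖ ^ p * (2 / (1 - ‖x‖ ^ 2)) ^ (m + 1) := by
  have hcont : ContinuousOn (fun x : EuclideanSpace ℝ (Fin (m + 1)) =>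
      ((1 - ‖x‖ ^ 2) / 2) ^ p * ‖fderiv ℝ u x‖ ^ p * (2 / (1 - ‖x‖ ^ 2)) ^ (m + 1)) (tsupport u) := by
    have h1 := hu.continuous_fderiv one_ne_zero
    refine ContinuousOn.mul (Continuous.continuousOn ?_) ((ContinuousOn.div (by fun_prop) (by fun_prop)
      fun x hx => (one_sub_normSq_pos (mem_ball_zero_iff.1 (hsupp hx))).ne').pow _)
    exact (Continuous.rpow_const (by fun_prop) fun _ => Or.inr hp.le).mul
      (Continuous.rpow_const (by fun_prop) fun _ => Or.inr hp.le)
  refine (integrableOn_iff_integrable_of_support_subset fun x hx => ?_).1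
    (hcont.integrableOn_compact hc)
  refine support_fderiv_subset ℝ fun h0 => hx ?_
  simp [hp.ne', h0]

/-- Equality in the Poincaré–Sobolev inequality in `ℍⁿ` holds only for `u ≡ 0`. -/
theorem poincare_sobolev_hyperbolic_equality_case (n : ℕ) (hn : 4 ≤ n) (p : ℝ)
    (hp1 : 2 * (n : ℝ) / ((n : ℝ) - 1) ≤ p) (hp2 : p < n)
    (u : EuclideanSpace ℝ (Fin n) → ℝ) (hu : ContDiff ℝ (⊤ : ℕ∞) u)
    (hsupp : tsupport u ⊆ Metric.ball (0 : EuclideanSpace ℝ (Fin n)) 1)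
    (heq : (∫ x in Metric.ball (0 : EuclideanSpace ℝ (Fin n)) 1,
        ((1 - ‖x‖ ^ 2) / 2) ^ p * ‖fderiv ℝ u x‖ ^ p * (2 / (1 - ‖x‖ ^ 2)) ^ (n : ℝ))
      - (((n : ℝ) - 1) / p) ^ p *
        ∫ x in Metric.ball (0 : EuclideanSpace ℝ (Fin n)) 1,
          |u x| ^ p * (2 / (1 - ‖x‖ ^ 2)) ^ (n : ℝ)
      = sobolevConst n p ^ p *
        (∫ x in Metric.ball (0 : EuclideanSpace ℝ (Fin n)) 1,
            |u x| ^ ((n : ℝ) * p / ((n : ℝ) - p)) * (2 / (1 - ‖x‖ ^ 2)) ^ (n : ℝ)) ^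
          (((n : ℝ) - p) / (n : ℝ))) :
    ∀ x, u x = 0 := by
  obtain ⟨m, rfl⟩ : ∃ m, n = m + 1 := ⟨n - 1, by omega⟩
  have hm : 1 ≤ m := by omega
  have hm0 : (0 : ℝ) < m := by exact_mod_cast hm
  simp only [Real.rpow_natCast] at heq
  push_cast at hp1 hp2 heq
  rw [add_sub_cancel_right] at hp1 heq
  have hp : 1 ≤ p := by
    refine le_trans ?_ hp1
    rw [le_div_iff₀ hm0]
    linarith
  have hp0 : 0 < p := by linarith
  by_contra! hne
  have hcs : HasCompactSupport u :=
    (isCompact_closedBall 0 1).of_isClosed_subset (isClosed_tsupport u)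
      (hsupp.trans Metric.ball_subset_closedBall)
  obtain ⟨ρ, ⟨hρ0, hρ1⟩, hρ⟩ := exists_pos_lt_subset_ball one_pos (isClosed_tsupport u) hsupp
  have hu0 : ∀ x, ρ ≤ ‖x‖ → u x = 0 := fun x hx =>
    image_eq_zero_of_notMem_tsupport fun h => (mem_ball_zero_iff.1 (hρ h)).not_ge hx
  obtain ⟨K, hK⟩ := hu.lipschitzWith_of_hasCompactSupport hcs (by simp)
  obtain ⟨B, hB⟩ := hcs.exists_bound_of_continuous hu.continuous
  have hint := (integrable_energy_of_contDiff hp0 (hu.of_le (by simp)) hsupp hcs).integrableOn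
    (s := Metric.ball 0 1)
  obtain ⟨φ, K', hφ, hφ_nonneg, hφ0, hφρ, hnorm, hen⟩ :=
    exists_radial_profile hp hρ0 hρ1 hK hB hu0 hne hint.lintegral_lt_top.ne
  have hq : 0 < ((m : ℝ) + 1) * p / (m + 1 - p) := div_pos (by positivity) (by linarith)
  have hstrict := radial_poincareSobolev_strict hm hp1 hp2 hρ0 hρ1 hφ hφ_nonneg hφ0 hφρ
  rw [← hnorm _ hq, ← hnorm _ hp0] at hstrict
  linarith
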